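/- Let X be a linearly recurrent subshift on the alphabet of positive integers. Then every element of the set C_X is either a quadratic irrational number or a transcendental number. -/

import Mathlib

open Filter Topology

/-- Denominators of the convergents of the continued fraction `[0; a 0, a 1, ...]`,
where `a i` denotes the `(i+1)`-st partial quotient `a_{i+1}` of the paper:
`q_0 = 1`, `q_1 = a_1`, `q_{ℓ+1} = a_{ℓ+1} q_ℓ + q_{ℓ-1}`. -/
def cfQ (a : ℕ → ℕ) : ℕ → ℕ
  | 0 => 1
  | 1 => a 0
  | n + 2 => a (n + 1) * cfQ a (n + 1) + cfQ a n

/-- Numerators of the convergents of the continued fraction `[0; a 0, a 1, ...]`: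
`p_0 = 0`, `p_1 = 1`, `p_{ℓ+1} = a_{ℓ+1} p_ℓ + p_{ℓ-1}`. -/
def cfP (a : ℕ → ℕ) : ℕ → ℕ
  | 0 => 0
  | 1 => 1
  | n + 2 => a (n + 1) * cfP a (n + 1) + cfP a n


/-- The finite word `W` occurs in the infinite word `x` at position `i`
(0-indexed). -/
def Occurs {A : Type*} (x : ℕ → A) (W : List A) (i : ℕ) : Prop :=
  ∀ t < W.length, W[t]? = some (x (i + t))


section CF

lemma cfQ_pos {x : ℕ → ℕ} (hx : ∀ n, 0 < x n) : ∀ n, 0 < cfQ x n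
  | 0 => by simp [cfQ]
  | 1 => by simpa [cfQ] using hx 0
  | n + 2 => by
      have := cfQ_pos hx n
      simp only [cfQ]; omega

lemma cfQ_mono_step {x : ℕ → ℕ} (hx : ∀ n, 0 < x n) (n : ℕ) : cfQ x n ≤ cfQ x (n + 1) := by
  cases n with
  | zero => simp only [cfQ]; exact hx 0
  | succ n =>
    have h1 := hx (n + 1)
    simp only [cfQ]
    nlinarith [cfQ_pos hx (n + 1), Nat.zero_le (cfQ x n)]

lemma cfQ_mono {x : ℕ → ℕ} (hx : ∀ n, 0 < x n) : Monotone (cfQ x) :=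
  monotone_nat_of_le_succ (cfQ_mono_step hx)

lemma cfQ_two_mul {x : ℕ → ℕ} (hx : ∀ n, 0 < x n) (n : ℕ) : 2 * cfQ x n ≤ cfQ x (n + 2) := by
  have h1 := hx (n + 1)
  have h2 := cfQ_mono_step hx n
  have : cfQ x (n + 2) = x (n + 1) * cfQ x (n + 1) + cfQ x n := rfl
  nlinarith

lemma cfQ_lower {x : ℕ → ℕ} (hx : ∀ n, 0 < x n) (n : ℕ) : 2 ^ n ≤ 2 * (cfQ x n) ^ 2 := by
  induction n using Nat.twoStepInduction with
  | zero => simp [cfQ]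
  | one => have := hx 0; simp only [cfQ]; nlinarith
  | more n ih _ =>
    have := cfQ_two_mul hx n
    have h2 : (2 * cfQ x n) ^ 2 ≤ (cfQ x (n + 2)) ^ 2 := Nat.pow_le_pow_left this 2
    rw [pow_add]; nlinarith

lemma cfQ_step_upper {x : ℕ → ℕ} (hx : ∀ n, 0 < x n) {A : ℕ} (hA : ∀ n, x n ≤ A) (n : ℕ) :
    cfQ x (n + 1) ≤ (A + 1) * cfQ x n := by
  cases n with
  | zero => simp only [cfQ]; have := hA 0; omega
  | succ n =>
    have h1 := hA (n + 1)
    have h2 := cfQ_mono_step hx n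
    have : cfQ x (n + 2) = x (n + 1) * cfQ x (n + 1) + cfQ x n := rfl
    rw [this]
    have := Nat.mul_le_mul_right (cfQ x (n + 1)) h1
    nlinarith

lemma cfQ_upper {x : ℕ → ℕ} (hx : ∀ n, 0 < x n) {A : ℕ} (hA : ∀ n, x n ≤ A) (n : ℕ) :
    cfQ x n ≤ (A + 1) ^ n := by
  induction n with
  | zero => simp [cfQ]
  | succ n ih =>
    calc _ ≤ (A + 1) * cfQ x n := cfQ_step_upper hx hA n
      _ ≤ (A + 1) * (A + 1) ^ n := Nat.mul_le_mul_left _ ih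
      _ = _ := by ring

lemma cfP_le_cfQ {x : ℕ → ℕ} (hx : ∀ n, 0 < x n) : ∀ n, x 0 * cfP x n ≤ cfQ x n
  | 0 => by simp [cfP]
  | 1 => by simp [cfP, cfQ]
  | n + 2 => by
      have h1 := cfP_le_cfQ hx n
      have h2 := cfP_le_cfQ hx (n + 1)
      simp only [cfP, cfQ]
      calc _ = x (n + 1) * (x 0 * cfP x (n + 1)) + x 0 * cfP x n := by ring
        _ ≤ _ := by gcongr

lemma cf_det (x : ℕ → ℕ) (n : ℕ) :
    (cfP x (n + 1) : ℤ) * cfQ x n - cfP x n * cfQ x (n + 1) = (-1) ^ n := by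
  induction n with
  | zero => simp [cfP, cfQ]
  | succ n ih =>
    simp only [cfP, cfQ, pow_succ]
    push_cast
    linear_combination (-1) * ih

lemma cf_det_real (x : ℕ → ℕ) (n : ℕ) :
    (cfP x (n + 1) : ℝ) * cfQ x n - cfP x n * cfQ x (n + 1) = (-1) ^ n := by
  exact_mod_cast cf_det x n

lemma cf_shift (x : ℕ → ℕ) (k n : ℕ) :
    cfQ x (k + 1 + n) = cfQ x (k + 1) * cfQ (fun i => x (k + 1 + i)) n
        + cfQ x k * cfP (fun i => x (k + 1 + i)) n ∧
    cfP x (k + 1 + n) = cfP x (k + 1) * cfQ (fun i => x (k + 1 + i)) n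
        + cfP x k * cfP (fun i => x (k + 1 + i)) n := by
  induction n using Nat.twoStepInduction with
  | zero => simp [cfP, cfQ]
  | one =>
    have h : k + 1 + 1 = k + 2 := rfl
    simp only [h, cfP, cfQ, add_zero]
    constructor <;> ring
  | more n ih1 ih2 =>
    have h : k + 1 + (n + 2) = (k + 1 + n) + 2 := by ring
    have h2 : k + 1 + n + 1 = k + 1 + (n + 1) := by ring
    rw [h]
    simp only [cfP, cfQ]
    rw [h2, ih1.1, ih1.2, ih2.1, ih2.2]
    constructor <;> ring

lemma cf_congr {x y : ℕ → ℕ} {l : ℕ} (h : ∀ t < l, x t = y t) :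
    ∀ n ≤ l, cfQ x n = cfQ y n ∧ cfP x n = cfP y n := by
  intro n
  induction n using Nat.twoStepInduction with
  | zero => intro; simp [cfP, cfQ]
  | one => intro hl; simp [cfP, cfQ, h 0 (by omega)]
  | more n ih1 ih2 =>
    intro hl
    simp only [cfP, cfQ]
    rw [(ih1 (by omega)).1, (ih1 (by omega)).2, (ih2 (by omega)).1, (ih2 (by omega)).2,
      h (n + 1) (by omega)]
    simp

/-- the error `α q_n - p_n` -/
noncomputable def cfE (x : ℕ → ℕ) (α : ℝ) (n : ℕ) : ℝ := α * cfQ x n - cfP x n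

lemma cf_diff {x : ℕ → ℕ} (hx : ∀ n, 0 < x n) (k n : ℕ) :
    |(cfP x (k + 1 + n) : ℝ) / cfQ x (k + 1 + n) * cfQ x (k + 1) - cfP x (k + 1)|
      ≤ 1 / cfQ x (k + 2) := by
  obtain ⟨h1, h2⟩ := cf_shift x k n
  have hq := cfQ_pos hx (k + 1 + n)
  have hq2 := cfQ_pos hx (k + 2)
  set Q := cfQ (fun i => x (k + 1 + i)) n
  set P := cfP (fun i => x (k + 1 + i)) n
  have hPQ : x (k + 1) * P ≤ Q := by
    simpa using cfP_le_cfQ (x := fun i => x (k + 1 + i)) (fun i => hx _) n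
  have hd := cf_det_real x k
  have hqR : (0 : ℝ) < cfQ x (k + 1 + n) := by exact_mod_cast hq
  have hq2R : (0 : ℝ) < cfQ x (k + 2) := by exact_mod_cast hq2
  have e : (cfP x (k + 1 + n) : ℝ) / cfQ x (k + 1 + n) * cfQ x (k + 1) - cfP x (k + 1)
      = (-(-1) ^ k * P) / cfQ x (k + 1 + n) := by
    rw [eq_div_iff hqR.ne']
    have : (cfP x (k + 1 + n) : ℝ) / cfQ x (k + 1 + n) * cfQ x (k + 1 + n)
       = cfP x (k + 1 + n) := by field_simp
    have h1' : (cfQ x (k + 1 + n) : ℝ) = cfQ x (k + 1) * Q + cfQ x k * P := by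
      exact_mod_cast h1
    have h2' : (cfP x (k + 1 + n) : ℝ) = cfP x (k + 1) * Q + cfP x k * P := by
      exact_mod_cast h2
    have : ((cfP x (k + 1 + n) : ℝ) / cfQ x (k + 1 + n) * cfQ x (k + 1) - cfP x (k + 1))
        * cfQ x (k + 1 + n) = cfP x (k + 1 + n) * cfQ x (k + 1)
          - cfP x (k + 1) * cfQ x (k + 1 + n) := by field_simp
    rw [this, h1', h2']
    linear_combination (-(P : ℝ)) * hd
  rw [e, abs_div, abs_of_pos hqR, div_le_div_iff₀ hqR hq2R, abs_mul, abs_neg, abs_pow]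
  simp only [abs_neg, abs_one, one_pow, one_mul, Nat.abs_cast]
  have : P * cfQ x (k + 2) ≤ cfQ x (k + 1 + n) := by
    rw [h1]
    have : cfQ x (k + 2) = x (k + 1) * cfQ x (k + 1) + cfQ x k := rfl
    rw [this]
    nlinarith [Nat.mul_le_mul_right (cfQ x (k + 1)) hPQ]
  exact_mod_cast this

lemma cfE_le {x : ℕ → ℕ} (hx : ∀ n, 0 < x n) {α : ℝ}
    (hα : Tendsto (fun ℓ => (cfP x ℓ : ℝ) / (cfQ x ℓ : ℝ)) atTop (𝓝 α)) (k : ℕ) :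
    |cfE x α (k + 1)| ≤ 1 / cfQ x (k + 2) := by
  have h := hα.comp (tendsto_add_atTop_nat (k + 1))
  have h2 : Tendsto (fun n => |(cfP x (n + (k + 1)) : ℝ) / cfQ x (n + (k + 1)) * cfQ x (k + 1)
      - cfP x (k + 1)|) atTop (𝓝 |α * cfQ x (k + 1) - cfP x (k + 1)|) :=
    ((h.mul_const _).sub_const _).abs
  refine le_of_tendsto' h2 fun n => ?_
  have := cf_diff hx k n
  rwa [add_comm (k + 1) n] at this

lemma cfE_ge {x : ℕ → ℕ} (hx : ∀ n, 0 < x n) {α : ℝ}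
    (hα : Tendsto (fun ℓ => (cfP x ℓ : ℝ) / (cfQ x ℓ : ℝ)) atTop (𝓝 α)) (k : ℕ) :
    1 / (2 * cfQ x (k + 1)) ≤ |cfE x α k| := by
  have h1 := cfE_le hx hα k
  have hd := cf_det_real x k
  have e : cfE x α k * cfQ x (k + 1) - cfE x α (k + 1) * cfQ x k = (-1) ^ k := by
    unfold cfE; linear_combination hd
  have hq1 : (0 : ℝ) < cfQ x (k + 1) := by exact_mod_cast cfQ_pos hx (k + 1)
  have hq0 : (0 : ℝ) < cfQ x k := by exact_mod_cast cfQ_pos hx k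
  have hq2 : (0 : ℝ) < cfQ x (k + 2) := by exact_mod_cast cfQ_pos hx (k + 2)
  have h2 : (2 : ℝ) * cfQ x k ≤ cfQ x (k + 2) := by exact_mod_cast cfQ_two_mul hx k
  have h3 : |cfE x α (k + 1) * cfQ x k| ≤ 1 / 2 := by
    rw [abs_mul, abs_of_pos hq0]
    calc _ ≤ 1 / (cfQ x (k + 2) : ℝ) * cfQ x k := by gcongr
      _ ≤ 1 / 2 := by
        rw [div_mul_eq_mul_div, div_le_div_iff₀ hq2 (by norm_num)]; linarith
  have h4 : 1 / 2 ≤ |cfE x α k * cfQ x (k + 1)| := by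
    have : cfE x α k * cfQ x (k + 1) = (-1) ^ k + cfE x α (k + 1) * cfQ x k := by linarith
    rw [this]
    have h5 := abs_sub_abs_le_abs_sub ((-1 : ℝ) ^ k) (-(cfE x α (k + 1) * cfQ x k))
    rw [abs_neg, sub_neg_eq_add, abs_pow, abs_neg, abs_one, one_pow] at h5
    linarith
  rw [abs_mul, abs_of_pos hq1] at h4
  rw [div_le_iff₀ (by positivity)]
  nlinarith

lemma cfE_tail {x : ℕ → ℕ} (hx : ∀ n, 0 < x n) {α : ℝ}
    (hα : Tendsto (fun ℓ => (cfP x ℓ : ℝ) / (cfQ x ℓ : ℝ)) atTop (𝓝 α)) (k l : ℕ)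
    (hl : 1 ≤ l)
    (h : ∀ t < l, x (k + 1 + t) = x t) :
    |-cfE x α (k + 1) / cfE x α k - α| ≤ 3 / (cfQ x l : ℝ) ^ 2 := by
  obtain ⟨h1, h2⟩ := cf_shift x k l
  obtain ⟨h3, h4⟩ := cf_congr h l le_rfl
  rw [h3, h4] at h1 h2
  have hql : (0 : ℝ) < cfQ x l := by exact_mod_cast cfQ_pos hx l
  have hqk : (0 : ℝ) < cfQ x (k + 1) := by exact_mod_cast cfQ_pos hx (k + 1)
  have hge := cfE_ge hx hα k
  have hek : 0 < |cfE x α k| := lt_of_lt_of_le (by positivity) hge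
  have hek0 : cfE x α k ≠ 0 := abs_pos.mp hek
  have e1 : cfE x α (k + 1) * cfQ x l + cfE x α k * cfP x l = cfE x α (k + 1 + l) := by
    unfold cfE; rw [h1, h2]; push_cast; ring
  have e2 : -cfE x α (k + 1) / cfE x α k - α
      = - (cfE x α l) / cfQ x l - cfE x α (k + 1 + l) / (cfE x α k * cfQ x l) := by
    rw [← e1]; field_simp; unfold cfE; ring
  obtain ⟨l', rfl⟩ : ∃ l', l = l' + 1 := ⟨l - 1, by omega⟩
  have b1 := cfE_le hx hα l'
  have b2 := cfE_le hx hα (k + 1 + l')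
  have m1 : (cfQ x (l' + 1) : ℝ) ≤ cfQ x (l' + 2) := by exact_mod_cast cfQ_mono_step hx (l' + 1)
  have m2 : (cfQ x (k + 1) : ℝ) * cfQ x (l' + 1) ≤ cfQ x (k + 1 + l' + 2) := by
    have i1 : cfQ x (k + 1) * cfQ x (l' + 1) ≤ cfQ x (k + 1 + (l' + 1)) := by
      rw [h1]; exact Nat.le_add_right _ _
    have i2 := cfQ_mono_step hx (k + 1 + (l' + 1))
    exact_mod_cast i1.trans i2
  rw [e2]
  have c1 : |-(cfE x α (l' + 1)) / cfQ x (l' + 1)| ≤ 1 / (cfQ x (l' + 1) : ℝ) ^ 2 := by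
    rw [abs_div, abs_neg, abs_of_pos hql, div_le_iff₀ hql]
    refine b1.trans ?_
    have : 1 / (cfQ x (l' + 1) : ℝ) ^ 2 * cfQ x (l' + 1) = 1 / cfQ x (l' + 1) := by
      field_simp
    rw [this]
    exact one_div_le_one_div_of_le hql m1
  have c2 : |cfE x α (k + 1 + (l' + 1)) / (cfE x α k * cfQ x (l' + 1))|
      ≤ 2 / (cfQ x (l' + 1) : ℝ) ^ 2 := by
    rw [abs_div, abs_mul, abs_of_pos hql, div_le_iff₀ (by positivity)]
    have b2' : |cfE x α (k + 1 + (l' + 1))| ≤ 1 / (cfQ x (k + 1) * cfQ x (l' + 1)) :=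
      b2.trans (one_div_le_one_div_of_le (by positivity) m2)
    refine b2'.trans ?_
    calc _ = 2 / (cfQ x (l' + 1) : ℝ) ^ 2 * (1 / (2 * cfQ x (k + 1)) * cfQ x (l' + 1)) := by
          field_simp
      _ ≤ _ := by gcongr
  calc _ ≤ _ := abs_sub _ _
    _ ≤ 1 / (cfQ x (l' + 1) : ℝ) ^ 2 + 2 / (cfQ x (l' + 1) : ℝ) ^ 2 := by gcongr
    _ = _ := by ring

lemma cfE_zero_le {x : ℕ → ℕ} (hx : ∀ n, 0 < x n) {α : ℝ}
    (hα : Tendsto (fun ℓ => (cfP x ℓ : ℝ) / (cfQ x ℓ : ℝ)) atTop (𝓝 α)) :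
    |cfE x α 0| ≤ 1 / cfQ x 1 := by
  have h0 : (0 : ℝ) < x 0 := by exact_mod_cast hx 0
  have h1 : 0 ≤ α := ge_of_tendsto' hα fun n => by positivity
  have h2 : α ≤ 1 / x 0 := by
    refine le_of_tendsto' hα fun n => ?_
    have hq : (0 : ℝ) < cfQ x n := by exact_mod_cast cfQ_pos hx n
    rw [div_le_div_iff₀ hq h0]
    have : (x 0 : ℝ) * cfP x n ≤ cfQ x n := by exact_mod_cast cfP_le_cfQ hx n
    linarith
  simp only [cfE, cfQ, cfP]
  push_cast
  rw [mul_one, sub_zero, abs_of_nonneg h1]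
  exact h2

lemma cfE_le' {x : ℕ → ℕ} (hx : ∀ n, 0 < x n) {α : ℝ}
    (hα : Tendsto (fun ℓ => (cfP x ℓ : ℝ) / (cfQ x ℓ : ℝ)) atTop (𝓝 α)) (k : ℕ) :
    |cfE x α k| ≤ 1 / cfQ x (k + 1) := by
  cases k with
  | zero => exact cfE_zero_le hx hα
  | succ k => exact cfE_le hx hα k

lemma cfQ_even {x : ℕ → ℕ} (hx : ∀ n, 0 < x n) (j : ℕ) : 2 ^ j ≤ cfQ x (2 * j) := by
  induction j with
  | zero => simp [cfQ]
  | succ j ih =>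
    have := cfQ_two_mul hx (2 * j)
    have e : 2 * (j + 1) = 2 * j + 2 := by ring
    rw [e, pow_succ]; omega

lemma cf_badly {x : ℕ → ℕ} (hx : ∀ n, 0 < x n) {A : ℕ} (hA : ∀ n, x n ≤ A) {α : ℝ}
    (hα : Tendsto (fun ℓ => (cfP x ℓ : ℝ) / (cfQ x ℓ : ℝ)) atTop (𝓝 α)) :
    ∃ c0 : ℝ, 0 < c0 ∧ ∀ y z : ℤ, y ≠ 0 → c0 ≤ |(y : ℝ)| * |z - α * y| := by
  refine ⟨1 / (4 * (A + 1)), by positivity, ?_⟩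
  intro y z hy
  have hy1 : (1 : ℝ) ≤ |(y : ℝ)| := by exact_mod_cast Int.one_le_abs hy
  have hyn : 1 ≤ y.natAbs := Int.natAbs_pos.mpr hy
  have hex : ∃ n, 2 * y.natAbs ≤ cfQ x n :=
    ⟨2 * (2 * y.natAbs), (Nat.lt_two_pow_self.le).trans (cfQ_even hx _)⟩
  classical
  obtain ⟨n, hn⟩ : ∃ n, Nat.find hex = n + 1 := by
    refine ⟨Nat.find hex - 1, ?_⟩
    have : Nat.find hex ≠ 0 := by
      intro h0
      have := Nat.find_spec hex
      rw [h0] at this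
      simp only [cfQ] at this
      omega
    omega
  have hN := Nat.find_spec hex
  rw [hn] at hN
  have hn1 : cfQ x n < 2 * y.natAbs := by
    have := Nat.find_min hex (m := n) (by omega)
    omega
  have eabs : ((y.natAbs : ℕ) : ℝ) = |(y : ℝ)| := by
    rw [Nat.cast_natAbs]; push_cast; rfl
  have hNR : 2 * |(y : ℝ)| ≤ cfQ x (n + 1) := by rw [← eabs]; exact_mod_cast hN
  have hnR : (cfQ x n : ℝ) ≤ 2 * |(y : ℝ)| := by rw [← eabs]; exact_mod_cast hn1.le
  have hq0 : (0 : ℝ) < cfQ x n := by exact_mod_cast cfQ_pos hx n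
  have hq1 : (0 : ℝ) < cfQ x (n + 1) := by exact_mod_cast cfQ_pos hx (n + 1)
  have hub := cfE_le' hx hα n
  have hlb := cfE_ge hx hα n
  have hst : (cfQ x (n + 1) : ℝ) ≤ (A + 1) * cfQ x n := by
    exact_mod_cast cfQ_step_upper hx hA n
  have hA0 : (0 : ℝ) ≤ A := by positivity
  by_cases hz : z * cfQ x n = y * cfP x n
  · have hd := cf_det x n
    have hdvd : (cfQ x n : ℤ) ∣ y := by
      have h1 : y * (-1) ^ n = cfQ x n * (y * cfP x (n + 1) - z * cfQ x (n + 1)) := by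
        rw [← hd]; linear_combination (cfQ x (n + 1) : ℤ) * hz
      have h2 : (cfQ x n : ℤ) ∣ y * (-1) ^ n := ⟨_, h1⟩
      have h3 : y = y * (-1) ^ n * (-1) ^ n := by
        rw [mul_assoc, ← mul_pow]; simp
      rw [h3]; exact h2.mul_right _
    have hge : (cfQ x n : ℝ) ≤ |(y : ℝ)| := by
      have := Int.natAbs_dvd_natAbs.mpr hdvd
      have := Nat.le_of_dvd (by omega) this
      rw [← eabs]; exact_mod_cast this
    have hzR : (z : ℝ) * cfQ x n = y * cfP x n := by exact_mod_cast hz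
    have e : |(z : ℝ) - α * y| * cfQ x n = |(y : ℝ)| * |cfE x α n| := by
      rw [← abs_of_pos hq0, ← abs_mul, ← abs_mul, ← abs_neg]
      congr 1
      unfold cfE; linear_combination -hzR
    have h5 : 1 / (2 * (A + 1)) ≤ |cfE x α n| * cfQ x n := by
      calc 1 / (2 * ((A : ℝ) + 1)) = (1 / (2 * ((A + 1) * cfQ x n))) * cfQ x n := by field_simp
        _ ≤ (1 / (2 * cfQ x (n + 1))) * cfQ x n := by gcongr
        _ ≤ _ := by gcongr
    have h6 : |cfE x α n| ≤ |(z : ℝ) - α * y| := by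
      have : |cfE x α n| * cfQ x n ≤ |(z : ℝ) - α * y| * cfQ x n := by
        rw [e, mul_comm]; gcongr
      exact le_of_mul_le_mul_right this hq0
    calc 1 / (4 * ((A : ℝ) + 1)) ≤ 1 / (2 * (A + 1)) := by gcongr; norm_num
      _ ≤ |cfE x α n| * cfQ x n := h5
      _ ≤ |(z : ℝ) - α * y| * |(y : ℝ)| := by gcongr
      _ = _ := mul_comm _ _
  · have h1 : (1 : ℝ) ≤ |(z : ℝ) * cfQ x n - y * cfP x n| := by
      have : (1 : ℤ) ≤ |z * cfQ x n - y * cfP x n| := Int.one_le_abs (sub_ne_zero.mpr hz)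
      exact_mod_cast this
    have e : (z : ℝ) * cfQ x n - y * cfP x n = (z - α * y) * cfQ x n + y * cfE x α n := by
      unfold cfE; ring
    rw [e] at h1
    have h2 := abs_add_le ((z - α * y) * cfQ x n) (y * cfE x α n)
    rw [abs_mul, abs_mul, abs_of_pos hq0] at h2
    have h3 : |(y : ℝ)| * |cfE x α n| ≤ 1 / 2 := by
      calc _ ≤ |(y : ℝ)| * (1 / cfQ x (n + 1)) := by gcongr
        _ ≤ 1 / 2 := by
          rw [mul_one_div, div_le_div_iff₀ hq1 (by norm_num)]; linarith
    have h4 : |(z : ℝ) - α * y| * cfQ x n ≤ |(z : ℝ) - α * y| * (2 * |(y : ℝ)|) := by gcongr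
    have h5 : 1 / (4 * ((A : ℝ) + 1)) ≤ 1 / 4 := by
      apply one_div_le_one_div_of_le (by norm_num); linarith
    linarith

end CF


section Comb

lemma occ_window {x : ℕ → ℕ} {c : ℝ}
    (hlr : ∀ W : List ℕ, W ≠ [] → ∀ i, Occurs x W i →
      ∃ j, i < j ∧ (j : ℝ) ≤ (i : ℝ) + c * (W.length : ℝ) ∧ Occurs x W j)
    (W : List ℕ) (hW : W ≠ []) (i : ℕ) (hi : Occurs x W i) (j : ℕ) (hij : i ≤ j) :
    ∃ j', j < j' ∧ (j' : ℝ) ≤ (j : ℝ) + c * (W.length : ℝ) ∧ Occurs x W j' := by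
  induction j, hij using Nat.le_induction with
  | base => exact hlr W hW i hi
  | succ j hj ih =>
    obtain ⟨j', h1, h2, h3⟩ := ih
    by_cases h : j' = j + 1
    · subst h; exact hlr W hW _ h3
    · exact ⟨j', by omega, by push_cast; linarith, h3⟩

lemma comb_bounded {x : ℕ → ℕ} {c : ℝ}
    (hlr : ∀ W : List ℕ, W ≠ [] → ∀ i, Occurs x W i →
      ∃ j, i < j ∧ (j : ℝ) ≤ (i : ℝ) + c * (W.length : ℝ) ∧ Occurs x W j) :
    ∃ A : ℕ, ∀ n, x n ≤ A := by
  by_contra hcon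
  push Not at hcon
  have hinf : (Set.range x).Infinite := by
    apply Set.infinite_of_not_bddAbove
    rintro ⟨A, hA⟩
    obtain ⟨n, hn⟩ := hcon A
    have := hA ⟨n, rfl⟩
    omega
  obtain ⟨t, hts, htc⟩ := hinf.exists_subset_card_eq (⌊c⌋₊ + 1)
  have hidx : ∀ v : ℕ, ∃ i, v ∈ t → x i = v := by
    intro v
    by_cases hv : v ∈ t
    · obtain ⟨i, hi⟩ := hts hv; exact ⟨i, fun _ => hi⟩
    · exact ⟨0, fun h => absurd h hv⟩
  choose f hf using hidx
  set i := t.sup f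
  have hsub : t ⊆ (Finset.Ioc i (i + ⌊c⌋₊)).image x := by
    intro v hv
    have ho : Occurs x [v] (f v) := by
      intro s hs
      have : s = 0 := by simpa using hs
      subst this
      simp [hf v hv]
    obtain ⟨j', h1, h2, h3⟩ := occ_window hlr [v] (by simp) (f v) ho i (Finset.le_sup hv)
    have h4 := h3 0 (by simp)
    simp only [add_zero, List.getElem?_cons_zero, Option.some.injEq] at h4
    simp only [List.length_singleton, Nat.cast_one, mul_one] at h2
    refine Finset.mem_image.mpr ⟨j', Finset.mem_Ioc.mpr ⟨h1, ?_⟩, h4.symm⟩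
    have h5 : ((j' - i : ℕ) : ℝ) ≤ c := by
      rw [Nat.cast_sub h1.le]; linarith
    have := Nat.le_floor h5
    omega
  have h1 := Finset.card_le_card hsub
  have h2 := Finset.card_image_le (s := Finset.Ioc i (i + ⌊c⌋₊)) (f := x)
  rw [Nat.card_Ioc] at h2
  omega

lemma comb_return {x : ℕ → ℕ} {c : ℝ}
    (hlr : ∀ W : List ℕ, W ≠ [] → ∀ i, Occurs x W i →
      ∃ j, i < j ∧ (j : ℝ) ≤ (i : ℝ) + c * (W.length : ℝ) ∧ Occurs x W j) :
    ∃ M : ℕ, ∀ n ≥ 1, ∃ k, n ≤ k ∧ k ≤ M * n ∧ ∀ t < n, x (k + t) = x t := by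
  refine ⟨max 2 (2 * ⌈c⌉₊), fun n hn => ?_⟩
  set W : List ℕ := (List.range (2 * n)).map x
  have hWl : W.length = 2 * n := by simp [W]
  have hW : W ≠ [] := by
    intro h; rw [h] at hWl; simp at hWl; omega
  have h0 : Occurs x W 0 := by
    intro t ht
    rw [hWl] at ht
    simp [W, ht]
  obtain ⟨j, hj0, hj1, hj2⟩ := hlr W hW 0 h0
  have hj3 : ∀ t < 2 * n, x (j + t) = x t := by
    intro t ht
    have := hj2 t (by rw [hWl]; exact ht)
    simp only [W, List.getElem?_map, List.getElem?_range ht, Option.map_some,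
      Option.some.injEq] at this
    exact this.symm
  have hjb : j ≤ 2 * ⌈c⌉₊ * n := by
    rw [hWl] at hj1
    push_cast at hj1
    have h1 : c ≤ ⌈c⌉₊ := Nat.le_ceil c
    have : (j : ℝ) ≤ 2 * ⌈c⌉₊ * n := by
      have : c * (2 * n) ≤ ⌈c⌉₊ * (2 * n) := by gcongr
      linarith
    exact_mod_cast this
  by_cases hjn : n ≤ j
  · exact ⟨j, hjn, hjb.trans (Nat.mul_le_mul_right _ (le_max_right _ _)),
      fun t ht => hj3 t (by omega)⟩
  · push Not at hjn
    have key : ∀ m t : ℕ, m * j + t < 2 * n + j → x (m * j + t) = x t := by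
      intro m
      induction m with
      | zero => intro t _; simp
      | succ m ih =>
        intro t ht
        have e : (m + 1) * j + t = j + (m * j + t) := by ring
        rw [e] at ht ⊢
        rw [hj3 _ (by omega)]
        exact ih t (by omega)
    have hdm := Nat.div_add_mod (n + j - 1) j
    have hmod := Nat.mod_lt (n + j - 1) hj0
    set m := (n + j - 1) / j
    have hmj : m * j = j * m := mul_comm _ _
    refine ⟨m * j, by omega, ?_, fun t ht => key m t (by omega)⟩
    calc m * j ≤ 2 * n := by omega
      _ ≤ _ := Nat.mul_le_mul_right _ (le_max_left _ _)

end Comb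


section Liou

set_option maxHeartbeats 1000000 in
open IntermediateField in
lemma liouville2 {α : ℝ} (hα : IsAlgebraic ℚ α) :
    ∃ c1 : ℝ, 0 < c1 ∧ ∃ d : ℕ, ∀ A B C : ℤ, (A : ℝ) * α ^ 2 + B * α + C ≠ 0 →
      ∀ H : ℝ, 1 ≤ H → |(A : ℝ)| ≤ H → |(B : ℝ)| ≤ H → |(C : ℝ)| ≤ H →
      c1 ≤ |(A : ℝ) * α ^ 2 + B * α + C| * H ^ d := by
  have hIntg : IsIntegral ℚ α := hα.isIntegral
  have : FiniteDimensional ℚ ℚ⟮α⟯ := adjoin.finiteDimensional hIntg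
  set g : ℚ⟮α⟯ := AdjoinSimple.gen ℚ α with hg
  have hgα : (g : ℝ) = α := AdjoinSimple.coe_gen ℚ α
  have halg : IsAlgebraic ℤ g := by
    have h1 : IsAlgebraic ℚ g := Algebra.IsAlgebraic.isAlgebraic g
    exact (IsFractionRing.isAlgebraic_iff ℤ ℚ ℚ⟮α⟯).mpr h1
  obtain ⟨D, hD0, hDint⟩ := halg.exists_integral_multiple
  classical
  -- embeddings
  let σ0 : ℚ⟮α⟯ →ₐ[ℚ] ℂ := ((Complex.ofRealHom : ℝ →+* ℂ).comp (algebraMap ℚ⟮α⟯ ℝ)).toRatAlgHom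
  have hσ0 : ∀ z : ℚ⟮α⟯, ‖σ0 z‖ = |(z : ℝ)| := by
    intro z
    change ‖((z : ℝ) : ℂ)‖ = _
    simp
  set M : ℝ := ∑ σ : ℚ⟮α⟯ →ₐ[ℚ] ℂ, (‖σ g‖ ^ 2 + ‖σ g‖ + 1) with hM
  have hMσ : ∀ σ : ℚ⟮α⟯ →ₐ[ℚ] ℂ, ‖σ g‖ ^ 2 + ‖σ g‖ + 1 ≤ M := fun σ =>
    Finset.single_le_sum (f := fun σ : ℚ⟮α⟯ →ₐ[ℚ] ℂ => ‖σ g‖ ^ 2 + ‖σ g‖ + 1)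
      (fun _ _ => by positivity) (Finset.mem_univ σ)
  have hM1 : 1 ≤ M := by
    have := hMσ σ0
    nlinarith [norm_nonneg (σ0 g)]
  set N : ℕ := (Finset.univ.erase σ0).card
  have hDR : (1 : ℝ) ≤ |(D : ℝ)| := by exact_mod_cast Int.one_le_abs hD0
  refine ⟨1 / (|(D : ℝ)| ^ 2 * (|(D : ℝ)| ^ 2 * M) ^ N), by positivity, N, ?_⟩
  intro A B C hne H hH hA hB hC
  set β : ℚ⟮α⟯ := A * g ^ 2 + B * g + C with hβ
  have hβα : (β : ℝ) = (A : ℝ) * α ^ 2 + B * α + C := by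
    rw [hβ]; push_cast; rw [hgα]
  have hβ0 : β ≠ 0 := by
    intro h; apply hne; rw [← hβα, h]; simp
  have hI : IsIntegral ℤ ((D : ℚ⟮α⟯) ^ 2 * β) := by
    have e : (D : ℚ⟮α⟯) ^ 2 * β = A * (D • g) ^ 2 + (B * D : ℤ) * (D • g) + (C * D ^ 2 : ℤ) := by
      rw [hβ, zsmul_eq_mul]; push_cast; ring
    rw [e]
    have hz : ∀ n : ℤ, IsIntegral ℤ (n : ℚ⟮α⟯) := fun n => isIntegral_algebraMap (R := ℤ) (x := n)
    exact (((hz A).mul (hDint.pow 2)).add ((hz _).mul hDint)).add (hz _)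
  have hD0' : (D : ℚ⟮α⟯) ≠ 0 := by exact_mod_cast hD0
  have hx0 : (D : ℚ⟮α⟯) ^ 2 * β ≠ 0 := mul_ne_zero (pow_ne_zero 2 hD0') hβ0
  have hn := Algebra.isIntegral_norm ℚ hI
  obtain ⟨y, hy⟩ := IsIntegrallyClosed.isIntegral_iff.mp hn
  have hn0 : Algebra.norm ℚ ((D : ℚ⟮α⟯) ^ 2 * β) ≠ 0 := by
    rw [Ne, Algebra.norm_eq_zero_iff]; exact hx0
  have hy0 : y ≠ 0 := by
    rintro rfl; apply hn0; rw [← hy]; simp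
  have hprod := Algebra.norm_eq_prod_embeddings ℚ ℂ ((D : ℚ⟮α⟯) ^ 2 * β)
  have h1 : (1 : ℝ) ≤ ∏ σ : ℚ⟮α⟯ →ₐ[ℚ] ℂ, ‖σ ((D : ℚ⟮α⟯) ^ 2 * β)‖ := by
    rw [← norm_prod, ← hprod, ← hy]
    simp only [eq_intCast, map_intCast]
    rw [Complex.norm_intCast]
    exact_mod_cast Int.one_le_abs hy0
  rw [← Finset.mul_prod_erase Finset.univ _ (Finset.mem_univ σ0)] at h1
  have hfac : ∀ σ : ℚ⟮α⟯ →ₐ[ℚ] ℂ, ‖σ ((D : ℚ⟮α⟯) ^ 2 * β)‖ ≤ |(D : ℝ)| ^ 2 * M * H := by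
    intro σ
    rw [map_mul, map_pow, map_intCast, norm_mul, norm_pow, Complex.norm_intCast]
    have : ‖σ β‖ ≤ M * H := by
      rw [hβ, map_add, map_add, map_mul, map_mul, map_pow, map_intCast, map_intCast, map_intCast]
      calc _ ≤ ‖(A : ℂ) * σ g ^ 2‖ + ‖(B : ℂ) * σ g‖ + ‖(C : ℂ)‖ := norm_add₃_le
        _ = |(A : ℝ)| * ‖σ g‖ ^ 2 + |(B : ℝ)| * ‖σ g‖ + |(C : ℝ)| := by
          rw [norm_mul, norm_mul, norm_pow, Complex.norm_intCast, Complex.norm_intCast,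
            Complex.norm_intCast]
        _ ≤ H * ‖σ g‖ ^ 2 + H * ‖σ g‖ + H := by gcongr
        _ = (‖σ g‖ ^ 2 + ‖σ g‖ + 1) * H := by ring
        _ ≤ M * H := by gcongr; exact hMσ σ
    rw [mul_assoc]; gcongr
  have h2 : ∏ σ ∈ Finset.univ.erase σ0, ‖σ ((D : ℚ⟮α⟯) ^ 2 * β)‖ ≤ (|(D : ℝ)| ^ 2 * M * H) ^ N := by
    rw [← Finset.prod_const]
    exact Finset.prod_le_prod (fun _ _ => norm_nonneg _) (fun σ _ => hfac σ)
  have h3 : ‖σ0 ((D : ℚ⟮α⟯) ^ 2 * β)‖ = |(D : ℝ)| ^ 2 * |(A : ℝ) * α ^ 2 + B * α + C| := by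
    have e : (((D : ℚ⟮α⟯) ^ 2 * β : ℚ⟮α⟯) : ℝ) = (D : ℝ) ^ 2 * (β : ℝ) := by
      have e1 := map_mul (algebraMap ℚ⟮α⟯ ℝ) ((D : ℚ⟮α⟯) ^ 2) β
      rw [map_pow, map_intCast] at e1
      exact e1
    rw [hσ0, e, hβα, abs_mul, abs_pow]
  rw [h3] at h1
  rw [div_le_iff₀ (by positivity)]
  calc (1 : ℝ) ≤ _ := h1
    _ ≤ |(D : ℝ)| ^ 2 * |(A : ℝ) * α ^ 2 + B * α + C| * (|(D : ℝ)| ^ 2 * M * H) ^ N := by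
      gcongr
    _ = _ := by rw [mul_pow (_ * M) H]; ring

end Liou


section G1

/-- pigeonhole on an interval -/
lemma ph_real {ι : Type*} (S : Finset ι) (f : ι → ℝ) (R : ℝ) (hf : ∀ a ∈ S, |f a| ≤ R)
    (h2 : 2 ≤ S.card) : ∃ a ∈ S, ∃ b ∈ S, a ≠ b ∧ |f a - f b| ≤ 4 * R / S.card := by
  classical
  obtain ⟨a0, ha0, b0, hb0, hab0⟩ := Finset.one_lt_card.mp h2
  have hR0 : 0 ≤ R := (abs_nonneg _).trans (hf a0 ha0)
  by_cases hc : S.card = 2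
  · refine ⟨a0, ha0, b0, hb0, hab0, ?_⟩
    rw [hc]
    have := abs_sub (f a0) (f b0)
    have h1 := hf a0 ha0
    have h2 := hf b0 hb0
    push_cast
    linarith
  have h3 : 3 ≤ S.card := by omega
  rcases hR0.eq_or_lt with h0 | hRpos
  · refine ⟨a0, ha0, b0, hb0, hab0, ?_⟩
    have h1 := hf a0 ha0
    have h2 := hf b0 hb0
    rw [← h0] at h1 h2 ⊢
    rw [abs_nonpos_iff.mp h1, abs_nonpos_iff.mp h2]; simp
  obtain ⟨N, hNdef⟩ : ∃ N : ℝ, N = (S.card : ℝ) := ⟨_, rfl⟩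
  have hN : (3 : ℝ) ≤ N := by rw [hNdef]; exact_mod_cast h3
  let g : ι → ℕ := fun a => ⌊(f a + R) * N / (4 * R)⌋₊
  have hnn : ∀ a ∈ S, 0 ≤ (f a + R) * N / (4 * R) := by
    intro a ha
    have := abs_le.mp (hf a ha)
    have : 0 ≤ f a + R := by linarith
    positivity
  have hmaps : ∀ a ∈ S, g a ∈ Finset.range (S.card / 2 + 1) := by
    intro a ha
    rw [Finset.mem_range, Nat.lt_succ_iff, Nat.le_div_iff_mul_le (by norm_num)]
    have h1 : (g a : ℝ) ≤ (f a + R) * N / (4 * R) := Nat.floor_le (hnn a ha)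
    have h2 : (f a + R) * N / (4 * R) ≤ N / 2 := by
      rw [div_le_div_iff₀ (by positivity) (by norm_num)]
      have := abs_le.mp (hf a ha)
      nlinarith
    have : (g a : ℝ) * 2 ≤ S.card := by linarith
    exact_mod_cast this
  obtain ⟨a, ha, b, hb, hab, hg⟩ := Finset.exists_ne_map_eq_of_card_lt_of_maps_to
    (s := S) (t := Finset.range (S.card / 2 + 1)) (by rw [Finset.card_range]; omega) hmaps
  refine ⟨a, ha, b, hb, hab, ?_⟩
  have h1 := Nat.floor_le (hnn a ha)
  have h2 := Nat.floor_le (hnn b hb)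
  have h3 := Nat.lt_floor_add_one ((f a + R) * N / (4 * R))
  have h4 := Nat.lt_floor_add_one ((f b + R) * N / (4 * R))
  change g a = g b at hg
  change ((g a : ℕ) : ℝ) ≤ _ at h1
  change ((g b : ℕ) : ℝ) ≤ _ at h2
  change _ < ((g a : ℕ) : ℝ) + 1 at h3
  change _ < ((g b : ℕ) : ℝ) + 1 at h4
  rw [hg] at h1 h3
  have h5 : |(f a + R) * N / (4 * R) - (f b + R) * N / (4 * R)| ≤ 1 := by
    rw [abs_le]; constructor <;> linarith
  have e : (f a + R) * N / (4 * R) - (f b + R) * N / (4 * R) = (f a - f b) * (N / (4 * R)) := by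
    ring
  rw [e, abs_mul, abs_of_pos (show 0 < N / (4 * R) by positivity)] at h5
  rw [← hNdef, le_div_iff₀ (by positivity)]
  calc _ = |f a - f b| * (N / (4 * R)) * (4 * R) := by field_simp
    _ ≤ 1 * (4 * R) := by gcongr
    _ = _ := by ring

/-- three by three determinant -/
def det3 (a b c : ℤ × ℤ × ℤ) : ℤ :=
  a.1 * (b.2.1 * c.2.2 - b.2.2 * c.2.1) - a.2.1 * (b.1 * c.2.2 - b.2.2 * c.1)
    + a.2.2 * (b.1 * c.2.1 - b.2.1 * c.1)

/-- points -/
lemma G1_points {α : ℝ} (t : ℕ) (ht : 1 ≤ t) :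
    ∃ S : Finset (ℤ × ℤ × ℤ), (0 : ℤ × ℤ × ℤ) ∈ S ∧ t ^ 12 < S.card ∧
      (∀ a ∈ S, ∀ b ∈ S, a.1 = b.1 → a = b) ∧
      (∀ a ∈ S, |(a.1 : ℝ)| ≤ t ^ 40 ∧ |(a.2.1 : ℝ) - α * a.1| ≤ 1 / t ^ 14 ∧
        |(a.2.2 : ℝ) - α * a.2.1| ≤ 1 / t ^ 14) := by
  classical
  let F : ℕ → ℤ × ℤ × ℤ := fun n => ((n : ℤ), ⌊α * n⌋, ⌊α * ⌊α * n⌋⌋)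
  let cell : ℕ → ℕ × ℕ := fun n => (⌊Int.fract (α * n) * t ^ 14⌋₊,
    ⌊Int.fract (α * ⌊α * n⌋) * t ^ 14⌋₊)
  have htR : (1 : ℝ) ≤ t := by exact_mod_cast ht
  have hmem : ∀ n ∈ Finset.range (t ^ 40 + 1), cell n ∈
      (Finset.range (t ^ 14)) ×ˢ (Finset.range (t ^ 14)) := by
    intro n _
    have key : ∀ u : ℝ, ⌊Int.fract u * (t : ℝ) ^ 14⌋₊ < t ^ 14 := by
      intro u
      rw [Nat.floor_lt (by positivity)]
      have := Int.fract_lt_one u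
      push_cast
      have h2 : (0 : ℝ) < (t : ℝ) ^ 14 := by positivity
      nlinarith
    simp only [Finset.mem_product, Finset.mem_range, cell]
    exact ⟨key _, key _⟩
  obtain ⟨v, _, hv⟩ := Finset.exists_lt_card_fiber_of_mul_lt_card_of_maps_to (n := t ^ 12) hmem (by
    rw [Finset.card_product, Finset.card_range, Finset.card_range]
    have : t ^ 14 * t ^ 14 * t ^ 12 = t ^ 40 := by ring
    omega)
  set U := (Finset.range (t ^ 40 + 1)).filter (fun n => cell n = v) with hU
  have hUne : U.Nonempty := Finset.card_pos.mp (by omega)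
  obtain ⟨n0, hn0⟩ := hUne
  have hFinj : Function.Injective (fun n => F n - F n0) := by
    intro a b hab
    have := congrArg Prod.fst hab
    simp only [F, Prod.fst_sub] at this
    omega
  have hfr : ∀ u w : ℝ, ⌊Int.fract u * (t : ℝ) ^ 14⌋₊ = ⌊Int.fract w * (t : ℝ) ^ 14⌋₊ →
      |Int.fract u - Int.fract w| ≤ 1 / t ^ 14 := by
    intro u w h
    have h2 : (0 : ℝ) < (t : ℝ) ^ 14 := by positivity
    have a1 := Nat.floor_le (show 0 ≤ Int.fract u * (t : ℝ) ^ 14 by positivity)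
    have a2 := Nat.floor_le (show 0 ≤ Int.fract w * (t : ℝ) ^ 14 by positivity)
    have a3 := Nat.lt_floor_add_one (Int.fract u * (t : ℝ) ^ 14)
    have a4 := Nat.lt_floor_add_one (Int.fract w * (t : ℝ) ^ 14)
    rw [h] at a1 a3
    rw [le_div_iff₀ h2]
    rw [← abs_of_pos h2, ← abs_mul, abs_le]
    constructor <;> linarith
  refine ⟨U.image (fun n => F n - F n0), ?_, ?_, ?_, ?_⟩
  · exact Finset.mem_image.mpr ⟨n0, hn0, sub_self _⟩
  · rw [Finset.card_image_of_injective _ hFinj]; exact hv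
  · intro a ha b hb hab
    obtain ⟨n, hn, rfl⟩ := Finset.mem_image.mp ha
    obtain ⟨m, hm, rfl⟩ := Finset.mem_image.mp hb
    simp only [F, Prod.fst_sub] at hab
    have : n = m := by omega
    rw [this]
  · intro a ha
    obtain ⟨n, hn, rfl⟩ := Finset.mem_image.mp ha
    rw [hU, Finset.mem_filter, Finset.mem_range] at hn hn0
    have hc := hn.2.trans hn0.2.symm
    simp only [cell, Prod.mk.injEq] at hc
    simp only [F, Prod.fst_sub, Prod.snd_sub]
    refine ⟨?_, ?_, ?_⟩
    · have h1 : (n : ℝ) ≤ t ^ 40 := by exact_mod_cast Nat.lt_succ_iff.mp hn.1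
      have h2 : (n0 : ℝ) ≤ t ^ 40 := by exact_mod_cast Nat.lt_succ_iff.mp hn0.1
      push_cast
      rw [abs_le]; constructor <;> nlinarith [Nat.cast_nonneg (α := ℝ) n, Nat.cast_nonneg (α := ℝ) n0]
    · have := hfr _ _ hc.1
      rw [← abs_neg]
      convert this using 2
      have e1 := Int.self_sub_floor (α * n)
      have e2 := Int.self_sub_floor (α * n0)
      push_cast
      linarith
    · have := hfr _ _ hc.2
      rw [← abs_neg]
      convert this using 2
      have e1 := Int.self_sub_floor (α * ⌊α * n⌋)
      have e2 := Int.self_sub_floor (α * ⌊α * n0⌋)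
      push_cast
      linarith

/-- the weighted norm -/
noncomputable def nuN (α Y ρ : ℝ) (a : ℤ × ℤ × ℤ) : ℝ :=
  max (|(a.1 : ℝ)| / Y) (max (|(a.2.1 : ℝ) - α * a.1| / ρ) (|(a.2.2 : ℝ) - α * a.2.1| / ρ))

lemma nuN_le {α Y ρ : ℝ} (hY : 0 < Y) (hρ : 0 < ρ) {a : ℤ × ℤ × ℤ} {l : ℝ} :
    nuN α Y ρ a ≤ l ↔ |(a.1 : ℝ)| ≤ l * Y ∧ |(a.2.1 : ℝ) - α * a.1| ≤ l * ρ ∧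
      |(a.2.2 : ℝ) - α * a.2.1| ≤ l * ρ := by
  unfold nuN
  rw [max_le_iff, max_le_iff, div_le_iff₀ hY, div_le_iff₀ hρ, div_le_iff₀ hρ]

/-- cross product: `(A, B, C)` -/
def crs (a b : ℤ × ℤ × ℤ) : ℤ × ℤ × ℤ :=
  (a.1 * b.2.1 - a.2.1 * b.1, a.2.2 * b.1 - a.1 * b.2.2, a.2.1 * b.2.2 - a.2.2 * b.2.1)

/-- dual norm -/
noncomputable def nuD (α Y ρ : ℝ) (a : ℤ × ℤ × ℤ) : ℝ :=
  max (|(a.1 : ℝ)| / (Y * ρ)) (max (|(a.2.1 : ℝ) + α * a.1| / (Y * ρ))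
    (|(a.1 : ℝ) * α ^ 2 + a.2.1 * α + a.2.2| / ρ ^ 2))

lemma nuD_le {α Y ρ : ℝ} (hY : 0 < Y) (hρ : 0 < ρ) {a : ℤ × ℤ × ℤ} {l : ℝ} :
    nuD α Y ρ a ≤ l ↔ |(a.1 : ℝ)| ≤ l * (Y * ρ) ∧ |(a.2.1 : ℝ) + α * a.1| ≤ l * (Y * ρ) ∧
      |(a.1 : ℝ) * α ^ 2 + a.2.1 * α + a.2.2| ≤ l * ρ ^ 2 := by
  unfold nuD
  rw [max_le_iff, max_le_iff, div_le_iff₀ (by positivity), div_le_iff₀ (by positivity),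
    div_le_iff₀ (by positivity)]

lemma abs_bil {a b c d u v : ℝ} (ha : |a| ≤ u) (hd : |d| ≤ u) (hb : |b| ≤ v) (hc : |c| ≤ v) :
    |a * b - c * d| ≤ 2 * (u * v) := by
  have h0 : 0 ≤ u := (abs_nonneg _).trans ha
  have h1 : 0 ≤ v := (abs_nonneg _).trans hb
  calc _ ≤ |a * b| + |c * d| := abs_sub _ _
    _ = |a| * |b| + |c| * |d| := by rw [abs_mul, abs_mul]
    _ ≤ u * v + v * u := by gcongr
    _ = _ := by ring

lemma crs_nuD {α Y ρ : ℝ} (hY : 0 < Y) (hρ : 0 < ρ) {a b : ℤ × ℤ × ℤ} {l m : ℝ}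
    (ha : nuN α Y ρ a ≤ l) (hb : nuN α Y ρ b ≤ m) : nuD α Y ρ (crs a b) ≤ 2 * (l * m) := by
  obtain ⟨a1, a2, a3⟩ := (nuN_le hY hρ).mp ha
  obtain ⟨b1, b2, b3⟩ := (nuN_le hY hρ).mp hb
  have hl : 0 ≤ l := (le_max_of_le_left (by positivity)).trans ha
  have hm : 0 ≤ m := (le_max_of_le_left (by positivity)).trans hb
  rw [nuD_le hY hρ]
  simp only [crs]
  push_cast
  have key : ∀ {p q r s : ℝ}, |p| ≤ l * Y → |q| ≤ m * ρ → |r| ≤ l * ρ → |s| ≤ m * Y →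
      |p * q - r * s| ≤ 2 * (l * m) * (Y * ρ) := by
    intro p q r s hp hq hr hs
    calc _ ≤ |p * q| + |r * s| := abs_sub _ _
      _ = |p| * |q| + |r| * |s| := by rw [abs_mul, abs_mul]
      _ ≤ (l * Y) * (m * ρ) + (l * ρ) * (m * Y) := by gcongr
      _ = _ := by ring
  refine ⟨?_, ?_, ?_⟩
  · have := key a1 b2 a2 b1
    convert this using 2; ring
  · have := key a1 b3 a3 b1
    rw [← abs_neg]
    convert this using 2; ring
  · calc _ = |((a.2.1 : ℝ) - α * a.1) * ((b.2.2 : ℝ) - α * b.2.1)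
          - ((a.2.2 : ℝ) - α * a.2.1) * ((b.2.1 : ℝ) - α * b.1)| := by congr 1; ring
      _ ≤ _ := abs_sub _ _
      _ = |(a.2.1 : ℝ) - α * a.1| * |(b.2.2 : ℝ) - α * b.2.1|
          + |(a.2.2 : ℝ) - α * a.2.1| * |(b.2.1 : ℝ) - α * b.1| := by rw [abs_mul, abs_mul]
      _ ≤ (l * ρ) * (m * ρ) + (l * ρ) * (m * ρ) := by gcongr
      _ = _ := by ring

end G1


section G1b

lemma nuN_par {α Y ρ : ℝ} {p d : ℤ × ℤ × ℤ} (hp : p.1 ≠ 0) (h : crs p d = 0) :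
    nuN α Y ρ d = |(d.1 : ℝ) / p.1| * nuN α Y ρ p := by
  have hp' : (p.1 : ℝ) ≠ 0 := by exact_mod_cast hp
  have h1 : p.1 * d.2.1 - p.2.1 * d.1 = 0 := congrArg Prod.fst h
  have h2 : p.2.2 * d.1 - p.1 * d.2.2 = 0 := congrArg (fun q => q.2.1) h
  have h1' : (p.1 : ℝ) * d.2.1 - p.2.1 * d.1 = 0 := by exact_mod_cast h1
  have h2' : (p.2.2 : ℝ) * d.1 - p.1 * d.2.2 = 0 := by exact_mod_cast h2
  obtain ⟨τ, hτ⟩ : ∃ τ : ℝ, τ = (d.1 : ℝ) / p.1 := ⟨_, rfl⟩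
  have e0 : (d.1 : ℝ) = τ * p.1 := by rw [hτ]; field_simp
  have e1 : (d.2.1 : ℝ) = τ * p.2.1 := by
    have : (p.1 : ℝ) * d.2.1 = p.1 * (τ * p.2.1) := by rw [e0] at h1'; linarith
    exact mul_left_cancel₀ hp' this
  have e2 : (d.2.2 : ℝ) = τ * p.2.2 := by
    have : (p.1 : ℝ) * d.2.2 = p.1 * (τ * p.2.2) := by rw [e0] at h2'; linarith
    exact mul_left_cancel₀ hp' this
  rw [← hτ]
  unfold nuN
  rw [mul_max_of_nonneg _ _ (abs_nonneg τ), mul_max_of_nonneg _ _ (abs_nonneg τ), e2, e1, e0]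
  have f1 : τ * (p.2.1 : ℝ) - α * (τ * p.1) = τ * (p.2.1 - α * p.1) := by ring
  have f2 : τ * (p.2.2 : ℝ) - α * (τ * p.2.1) = τ * (p.2.2 - α * p.2.1) := by ring
  rw [f1, f2, abs_mul, abs_mul, abs_mul]
  simp only [mul_div_assoc]

lemma nuD_smul {α Y ρ : ℝ} {v w : ℤ × ℤ × ℤ} {s : ℝ} (h1 : (v.1 : ℝ) = s * w.1)
    (h2 : (v.2.1 : ℝ) = s * w.2.1) (h3 : (v.2.2 : ℝ) = s * w.2.2) :
    nuD α Y ρ v = |s| * nuD α Y ρ w := by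
  unfold nuD
  rw [mul_max_of_nonneg _ _ (abs_nonneg s), mul_max_of_nonneg _ _ (abs_nonneg s), h1, h2, h3]
  have f1 : s * (w.2.1 : ℝ) + α * (s * w.1) = s * (w.2.1 + α * w.1) := by ring
  have f2 : s * (w.1 : ℝ) * α ^ 2 + s * w.2.1 * α + s * w.2.2
    = s * (w.1 * α ^ 2 + w.2.1 * α + w.2.2) := by ring
  rw [f1, f2, abs_mul, abs_mul, abs_mul]
  simp only [mul_div_assoc]

lemma nuD_pos {α Y ρ : ℝ} (hY : 0 < Y) (hρ : 0 < ρ) {v : ℤ × ℤ × ℤ} (hv : v ≠ 0) :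
    0 < nuD α Y ρ v := by
  by_contra h
  push Not at h
  obtain ⟨h1, h2, h3⟩ := (nuD_le hY hρ).mp h
  rw [zero_mul, abs_nonpos_iff] at h1 h2 h3
  rw [h1] at h2 h3
  have h2' : (v.2.1 : ℝ) = 0 := by linarith
  rw [h2'] at h3
  have h3' : (v.2.2 : ℝ) = 0 := by linarith
  apply hv
  refine Prod.ext (by exact_mod_cast h1) (Prod.ext (by exact_mod_cast h2') (by exact_mod_cast h3'))

lemma G1_core {α Y ρ : ℝ} (hY : 0 < Y) (hρ : 0 < ρ) (S : Finset (ℤ × ℤ × ℤ))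
    (h0S : (0 : ℤ × ℤ × ℤ) ∈ S) (hN : 2 ≤ S.card)
    (hinj : ∀ a ∈ S, ∀ b ∈ S, a.1 = b.1 → a = b)
    (hb : ∀ a ∈ S, nuN α Y ρ a ≤ 1)
    (hdet : ∀ a ∈ S, ∀ b ∈ S, ∀ c ∈ S, det3 a b c = 0) :
    (∃ P : ℤ × ℤ × ℤ, P ≠ 0 ∧ nuD α Y ρ P ≤ 64 / S.card) ∨
    (∃ p : ℤ × ℤ × ℤ, p.1 ≠ 0 ∧ nuN α Y ρ p ≤ 8 / S.card) := by
  classical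
  have hNR : (0 : ℝ) < S.card := by
    have : 0 < S.card := by omega
    exact_mod_cast this
  have hdiff : ∀ a ∈ S, ∀ b ∈ S, nuN α Y ρ (a - b) ≤ 2 := by
    intro a ha b hb'
    obtain ⟨a1, a2, a3⟩ := (nuN_le hY hρ).mp (hb a ha)
    obtain ⟨b1, b2, b3⟩ := (nuN_le hY hρ).mp (hb b hb')
    rw [nuN_le hY hρ]
    simp only [Prod.fst_sub, Prod.snd_sub]
    push_cast
    rw [abs_le] at a1 a2 a3 b1 b2 b3
    refine ⟨?_, ?_, ?_⟩ <;> rw [abs_le] <;> constructor <;> linarith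
  set D := S.offDiag.image (fun p => p.1 - p.2) with hD
  have hDne : D.Nonempty := by
    obtain ⟨a, ha, b, hb', hab⟩ := Finset.one_lt_card.mp hN
    exact ⟨a - b, Finset.mem_image.mpr ⟨(a, b), Finset.mem_offDiag.mpr ⟨ha, hb', hab⟩, rfl⟩⟩
  obtain ⟨p, hpD, hpmin⟩ := Finset.exists_min_image D (nuN α Y ρ) hDne
  have hmin : ∀ a ∈ S, ∀ b ∈ S, a ≠ b → nuN α Y ρ p ≤ nuN α Y ρ (a - b) := by
    intro a ha b hb' hab
    exact hpmin _ (Finset.mem_image.mpr ⟨(a, b), Finset.mem_offDiag.mpr ⟨ha, hb', hab⟩, rfl⟩)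
  obtain ⟨⟨u, v⟩, huv, hpuv⟩ := Finset.mem_image.mp hpD
  rw [Finset.mem_offDiag] at huv
  obtain ⟨hu, hv, huv⟩ := huv
  simp only at hpuv hu hv huv
  have hp1 : p.1 ≠ 0 := by
    intro h
    rw [← hpuv, Prod.fst_sub] at h
    exact huv (hinj u hu v hv (by omega))
  set l := nuN α Y ρ p with hl
  have hl2 : l ≤ 2 := by rw [hl, ← hpuv]; exact hdiff u hu v hv
  have hl0 : 0 < l := by
    have : (0 : ℝ) < |(p.1 : ℝ)| / Y := by
      have : (p.1 : ℝ) ≠ 0 := by exact_mod_cast hp1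
      positivity
    exact this.trans_le (le_max_left _ _)
  set w := crs p with hw
  have hwsub : ∀ a b, w (a - b) = w a - w b := by
    intro a b
    simp only [hw, crs, Prod.fst_sub, Prod.snd_sub]
    refine Prod.ext ?_ (Prod.ext ?_ ?_) <;> simp <;> ring
  have hfib : ∀ v ∈ S.image w, ((S.filter (fun a => w a = v)).card : ℝ) ≤ 8 / l := by
    intro v _
    set Fb := S.filter (fun a => w a = v) with hFb
    by_cases h2 : 2 ≤ Fb.card
    · have hne : Fb.Nonempty := Finset.card_pos.mp (by omega)
      obtain ⟨a0, ha0⟩ := hne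
      have hpar : ∀ a ∈ Fb, ∀ b ∈ Fb, nuN α Y ρ (a - b) = |((a - b).1 : ℝ) / p.1| * l := by
        intro a ha b hb'
        rw [hFb, Finset.mem_filter] at ha hb'
        apply nuN_par hp1
        change w (a - b) = 0
        rw [hwsub, ha.2, hb'.2, sub_self]
      have hS : ∀ a ∈ Fb, a ∈ S := fun a ha => (Finset.mem_filter.mp ha).1
      obtain ⟨a, ha, b, hb', hab, hle⟩ := ph_real Fb (fun a => ((a - a0).1 : ℝ) / p.1) (2 / l)
        (by
          intro a ha
          rw [le_div_iff₀ hl0, ← hpar a ha a0 ha0]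
          exact hdiff a (hS a ha) a0 (hS a0 ha0)) h2
      have e : ((a - a0).1 : ℝ) / p.1 - ((b - a0).1 : ℝ) / p.1 = ((a - b).1 : ℝ) / p.1 := by
        simp only [Prod.fst_sub]; push_cast; ring
      have h3 := hmin a (hS a ha) b (hS b hb') hab
      rw [hpar a ha b hb'] at h3
      simp only [e] at hle
      have h4 : 1 ≤ |((a - b).1 : ℝ) / p.1| := by
        by_contra hcon
        push Not at hcon
        nlinarith
      have h5 := h4.trans hle
      have hFc : (0 : ℝ) < Fb.card := by
        have : 0 < Fb.card := by omega
        exact_mod_cast this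
      rw [le_div_iff₀ hFc] at h5
      calc _ ≤ 4 * (2 / l) := by linarith
        _ = _ := by ring
    · have : (Fb.card : ℝ) ≤ 1 := by
        have : Fb.card ≤ 1 := by omega
        exact_mod_cast this
      rw [le_div_iff₀ hl0]
      nlinarith
  set T := S.image w with hT
  have hcount : (S.card : ℝ) ≤ T.card * (8 / l) := by
    have := Finset.card_eq_sum_card_image w S
    rw [this]
    push_cast
    calc _ ≤ ∑ v ∈ S.image w, 8 / l := Finset.sum_le_sum hfib
      _ = _ := by rw [Finset.sum_const, nsmul_eq_mul]
  by_cases hT2 : 2 ≤ T.card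
  · left
    have hTne : T.Nonempty := Finset.card_pos.mp (by omega)
    obtain ⟨v0, hv0, hv0max⟩ := Finset.exists_max_image T (nuD α Y ρ) hTne
    have hv0pos : 0 < nuD α Y ρ v0 := by
      obtain ⟨a, ha, b, hb', hab⟩ := Finset.one_lt_card.mp hT2
      by_cases ha0 : a = 0
      · have : b ≠ 0 := fun h => hab (ha0.trans h.symm)
        exact (nuD_pos hY hρ this).trans_le (hv0max b hb')
      · exact (nuD_pos hY hρ ha0).trans_le (hv0max a ha)
    have hv0ne : v0 ≠ 0 := by
      rintro rfl
      have : nuD α Y ρ 0 = 0 := by simp [nuD]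
      linarith
    have hv0le : nuD α Y ρ v0 ≤ 2 * (l * 1) := by
      obtain ⟨a, ha, rfl⟩ := Finset.mem_image.mp hv0
      exact crs_nuD hY hρ le_rfl (hb a ha)
    have hpara : ∀ v ∈ T, v.1 * v0.2.1 = v.2.1 * v0.1 ∧ v.1 * v0.2.2 = v.2.2 * v0.1 ∧
        v.2.1 * v0.2.2 = v.2.2 * v0.2.1 := by
      intro v' hv'
      obtain ⟨a, ha, rfl⟩ := Finset.mem_image.mp hv'
      obtain ⟨b, hb', rfl⟩ := Finset.mem_image.mp hv0
      have hd : det3 p a b = 0 := by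
        have h1 := hdet u hu a ha b hb'
        have h2 := hdet v hv a ha b hb'
        rw [← hpuv]
        unfold det3 at h1 h2 ⊢
        simp only [Prod.fst_sub, Prod.snd_sub]
        linear_combination h1 - h2
      unfold det3 at hd
      simp only [hw, crs]
      refine ⟨?_, ?_, ?_⟩
      · linear_combination (-p.1) * hd
      · linear_combination (p.2.1) * hd
      · linear_combination (-p.2.2) * hd
    have hs : ∀ v : ℤ × ℤ × ℤ, ∃ s : ℝ, v ∈ T → (v.1 : ℝ) = s * v0.1 ∧
        (v.2.1 : ℝ) = s * v0.2.1 ∧ (v.2.2 : ℝ) = s * v0.2.2 := by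
      intro v'
      by_cases hv' : v' ∈ T
      swap
      · exact ⟨0, fun h => absurd h hv'⟩
      obtain ⟨h1, h2, h3⟩ := hpara v' hv'
      have h1' : (v'.1 : ℝ) * v0.2.1 = v'.2.1 * v0.1 := by exact_mod_cast h1
      have h2' : (v'.1 : ℝ) * v0.2.2 = v'.2.2 * v0.1 := by exact_mod_cast h2
      have h3' : (v'.2.1 : ℝ) * v0.2.2 = v'.2.2 * v0.2.1 := by exact_mod_cast h3
      by_cases c1 : v0.1 = 0
      · by_cases c2 : v0.2.1 = 0
        · by_cases c3 : v0.2.2 = 0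
          · exact absurd (Prod.ext c1 (Prod.ext c2 c3)) hv0ne
          · have c3' : (v0.2.2 : ℝ) ≠ 0 := by exact_mod_cast c3
            refine ⟨v'.2.2 / v0.2.2, fun _ => ⟨?_, ?_, ?_⟩⟩ <;> field_simp <;> linarith
        · have c2' : (v0.2.1 : ℝ) ≠ 0 := by exact_mod_cast c2
          refine ⟨v'.2.1 / v0.2.1, fun _ => ⟨?_, ?_, ?_⟩⟩ <;> field_simp <;> linarith
      · have c1' : (v0.1 : ℝ) ≠ 0 := by exact_mod_cast c1
        refine ⟨v'.1 / v0.1, fun _ => ⟨?_, ?_, ?_⟩⟩ <;> field_simp <;> linarith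
    choose s hs using hs
    have hs1 : ∀ v ∈ T, |s v| ≤ 1 := by
      intro v' hv'
      obtain ⟨h1, h2, h3⟩ := hs v' hv'
      have h4 := hv0max v' hv'
      rw [nuD_smul h1 h2 h3] at h4
      by_contra hcon
      push Not at hcon
      nlinarith
    obtain ⟨a, ha, b, hb', hab, hle⟩ := ph_real T s 1 hs1 hT2
    refine ⟨a - b, sub_ne_zero.mpr hab, ?_⟩
    obtain ⟨a1, a2, a3⟩ := hs a ha
    obtain ⟨b1, b2, b3⟩ := hs b hb'
    have hTc : (0 : ℝ) < T.card := by
      have : 0 < T.card := by omega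
      exact_mod_cast this
    rw [nuD_smul (v := a - b) (w := v0) (s := s a - s b)
      (by simp only [Prod.fst_sub]; push_cast; linarith)
      (by simp only [Prod.fst_sub, Prod.snd_sub]; push_cast; linarith)
      (by simp only [Prod.snd_sub]; push_cast; linarith)]
    calc |s a - s b| * nuD α Y ρ v0 ≤ (4 * 1 / T.card) * (2 * (l * 1)) := by gcongr
      _ = 8 * l / T.card := by ring
      _ ≤ 64 / S.card := by
        rw [div_le_div_iff₀ hTc hNR]
        have : (S.card : ℝ) * l ≤ T.card * 8 := by
          calc _ ≤ T.card * (8 / l) * l := by gcongr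
            _ = _ := by field_simp
        linarith
  · right
    refine ⟨p, hp1, ?_⟩
    have hT1 : (T.card : ℝ) ≤ 1 := by
      have : T.card ≤ 1 := by omega
      exact_mod_cast this
    change l ≤ _
    rw [le_div_iff₀ hNR]
    calc l * S.card ≤ l * (T.card * (8 / l)) := by gcongr
      _ ≤ l * (1 * (8 / l)) := by gcongr
      _ = 8 := by field_simp

lemma G1_dual {α c0 : ℝ} (hα0 : 0 < α) (hα1 : α < 1) (hc0 : 0 < c0)
    (hbad : ∀ y z : ℤ, y ≠ 0 → c0 ≤ |(y : ℝ)| * |z - α * y|) {t : ℝ} (ht : 1 ≤ t)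
    (p : ℤ × ℤ × ℤ) (hp : p.1 ≠ 0) (h1 : |(p.1 : ℝ)| ≤ 8 * t ^ 28)
    (h2 : |(p.2.1 : ℝ) - α * p.1| ≤ 8 / t ^ 26) (h3 : |(p.2.2 : ℝ) - α * p.2.1| ≤ 8 / t ^ 26) :
    ∃ A B C : ℤ, (A, B) ≠ (0, 0) ∧ |(A : ℝ)| ≤ 3 * t ^ 14 ∧ |(B : ℝ)| ≤ 3 * t ^ 14 ∧
      |(A : ℝ) * α ^ 2 + B * α + C| ≤ 24 * (8 / c0 + 1) / t ^ 39 := by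
  classical
  obtain ⟨y, x, z⟩ := p
  simp only at hp h1 h2 h3
  have ht0 : 0 < t := by linarith
  set n := Nat.sqrt y.natAbs with hn
  have hn1 : n * n ≤ y.natAbs := Nat.sqrt_le _
  have hn2 : y.natAbs < (n + 1) * (n + 1) := Nat.lt_succ_sqrt _
  have hyn : 0 < y.natAbs := Int.natAbs_pos.mpr hp
  have hyp : (0 : ℤ) < |y| := abs_pos.mpr hp
  have eabs : ((y.natAbs : ℕ) : ℝ) = |(y : ℝ)| := by
    rw [Nat.cast_natAbs]; push_cast; rfl
  -- pigeonhole
  let f : ℕ × ℕ → ℤ := fun q => ((q.1 : ℤ) * z + (q.2 : ℤ) * x) % |y|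
  have hmaps : ∀ q ∈ (Finset.range (n + 1)) ×ˢ (Finset.range (n + 1)),
      f q ∈ Finset.Ico (0 : ℤ) |y| := by
    intro q _
    exact Finset.mem_Ico.mpr ⟨Int.emod_nonneg _ hyp.ne', Int.emod_lt_of_pos _ hyp⟩
  obtain ⟨q, hq, r, hr, hqr, hfe⟩ := Finset.exists_ne_map_eq_of_card_lt_of_maps_to
    (by
      rw [Int.card_Ico, Finset.card_product, Finset.card_range, sub_zero]
      have : |y|.toNat = y.natAbs := by rw [Int.abs_eq_natAbs, Int.toNat_natCast]
      rw [this]; exact hn2) hmaps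
  simp only [Finset.mem_product, Finset.mem_range] at hq hr
  have hdvd : |y| ∣ ((q.1 : ℤ) * z + (q.2 : ℤ) * x) - ((r.1 : ℤ) * z + (r.2 : ℤ) * x) :=
    Int.ModEq.dvd (Int.ModEq.symm hfe)
  rw [abs_dvd] at hdvd
  obtain ⟨k, hk⟩ := hdvd
  have hnt : (n : ℝ) ≤ 3 * t ^ 14 := by
    have h4 : (n : ℝ) * n ≤ |(y : ℝ)| := by rw [← eabs]; exact_mod_cast hn1
    have h5 : (n : ℝ) * n ≤ (3 * t ^ 14) * (3 * t ^ 14) := by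
      have : (3 * t ^ 14) * (3 * t ^ 14) = 9 * t ^ 28 := by ring
      rw [this]
      have : 0 ≤ t ^ 28 := by positivity
      linarith
    exact (mul_self_le_mul_self_iff (by positivity) (by positivity)).mpr h5
  have hA : |(((q.1 : ℤ) - r.1 : ℤ) : ℝ)| ≤ n := by
    have : |((q.1 : ℤ) - r.1)| ≤ n := by rw [abs_le]; constructor <;> omega
    exact_mod_cast this
  have hB : |(((q.2 : ℤ) - r.2 : ℤ) : ℝ)| ≤ n := by
    have : |((q.2 : ℤ) - r.2)| ≤ n := by rw [abs_le]; constructor <;> omega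
    exact_mod_cast this
  obtain ⟨A, hAdef⟩ : ∃ A : ℤ, A = (q.1 : ℤ) - r.1 := ⟨_, rfl⟩
  obtain ⟨B, hBdef⟩ : ∃ B : ℤ, B = (q.2 : ℤ) - r.2 := ⟨_, rfl⟩
  rw [← hAdef] at hA
  rw [← hBdef] at hB
  have hk' : (A : ℝ) * z + B * x = y * k := by
    have : A * z + B * x = y * k := by rw [← hk, hAdef, hBdef]; ring
    exact_mod_cast this
  refine ⟨A, B, -k, ?_, hA.trans hnt, hB.trans hnt, ?_⟩
  · intro h
    rw [Prod.mk.injEq] at h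
    apply hqr
    apply Prod.ext <;> omega
  set e1 := (x : ℝ) - α * y with he1
  set e2 := (z : ℝ) - α * x with he2
  have hid : ((A : ℝ) * α ^ 2 + B * α + ((-k : ℤ) : ℝ)) * y
      = -(e1 * (B + α * A) + e2 * A) := by
    push_cast
    rw [he1, he2]
    linear_combination hk'
  have hy0 : 0 < |(y : ℝ)| := by rw [← eabs]; exact_mod_cast hyn
  have hbd : |(A : ℝ) * α ^ 2 + B * α + ((-k : ℤ) : ℝ)| * |(y : ℝ)| ≤ 24 / t ^ 26 * n := by
    rw [← abs_mul, hid, abs_neg]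
    have hn0 : (0 : ℝ) ≤ n := by positivity
    calc _ ≤ |e1 * (B + α * A)| + |e2 * A| := abs_add_le _ _
      _ = |e1| * |(B : ℝ) + α * A| + |e2| * |(A : ℝ)| := by rw [abs_mul, abs_mul]
      _ ≤ 8 / t ^ 26 * (n + 1 * n) + 8 / t ^ 26 * n := by
        gcongr
        calc _ ≤ |(B : ℝ)| + |α * A| := abs_add_le _ _
          _ = |(B : ℝ)| + α * |(A : ℝ)| := by rw [abs_mul, abs_of_pos hα0]
          _ ≤ _ := by gcongr
      _ = _ := by ring
  have hlow : c0 * t ^ 26 / 8 ≤ |(y : ℝ)| := by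
    have h := hbad y x hp
    have : c0 ≤ |(y : ℝ)| * (8 / t ^ 26) := h.trans (by gcongr)
    rw [mul_div_assoc', le_div_iff₀ (by positivity)] at this
    linarith
  have hny : (n : ℝ) * t ^ 13 ≤ (8 / c0 + 1) * |(y : ℝ)| := by
    have h4 : (n : ℝ) * n ≤ |(y : ℝ)| := by rw [← eabs]; exact_mod_cast hn1
    have h5 : t ^ 26 ≤ 8 / c0 * |(y : ℝ)| := by
      rw [div_mul_eq_mul_div, le_div_iff₀ hc0]; linarith
    have h6 : ((n : ℝ) * t ^ 13) ^ 2 ≤ ((8 / c0 + 1) * |(y : ℝ)|) ^ 2 := by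
      calc ((n : ℝ) * t ^ 13) ^ 2 = (n * n) * t ^ 26 := by ring
        _ ≤ |(y : ℝ)| * (8 / c0 * |(y : ℝ)|) := by gcongr
        _ = (8 / c0) * |(y : ℝ)| ^ 2 := by ring
        _ ≤ (8 / c0 + 1) ^ 2 * |(y : ℝ)| ^ 2 := by
          have : 0 < 8 / c0 := by positivity
          gcongr
          nlinarith
        _ = _ := by ring
    exact le_of_sq_le_sq h6 (by positivity)
  have hfin : |(A : ℝ) * α ^ 2 + B * α + ((-k : ℤ) : ℝ)| * |(y : ℝ)|
      ≤ 24 * (8 / c0 + 1) / t ^ 39 * |(y : ℝ)| := by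
    calc _ ≤ 24 / t ^ 26 * n := hbd
      _ = 24 / t ^ 39 * (n * t ^ 13) := by field_simp
      _ ≤ 24 / t ^ 39 * ((8 / c0 + 1) * |(y : ℝ)|) := by gcongr
      _ = _ := by ring
  exact le_of_mul_le_mul_right hfin hy0

lemma G1 {α c0 : ℝ} (hα0 : 0 < α) (hα1 : α < 1) (hc0 : 0 < c0)
    (hbad : ∀ y z : ℤ, y ≠ 0 → c0 ≤ |(y : ℝ)| * |z - α * y|) :
    ∃ K : ℝ, 1 ≤ K ∧ ∀ t : ℕ, 1 ≤ t →
      (∃ a b c : ℤ × ℤ × ℤ, det3 a b c ≠ 0 ∧ nuN α ((t : ℝ) ^ 40) (1 / (t : ℝ) ^ 14) a ≤ 1 ∧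
        nuN α ((t : ℝ) ^ 40) (1 / (t : ℝ) ^ 14) b ≤ 1 ∧
        nuN α ((t : ℝ) ^ 40) (1 / (t : ℝ) ^ 14) c ≤ 1) ∨
      (∃ A B C : ℤ, (A, B, C) ≠ (0, 0, 0) ∧ |(A : ℝ)| ≤ K * (t : ℝ) ^ 14 ∧
        |(B : ℝ)| ≤ K * (t : ℝ) ^ 14 ∧ |(C : ℝ)| ≤ K * (t : ℝ) ^ 14 ∧
        |(A : ℝ) * α ^ 2 + B * α + C| ≤ K / (t : ℝ) ^ 39) := by
  set K0 : ℝ := 24 * (8 / c0 + 1) with hK0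
  have hK0p : 0 < K0 := by positivity
  refine ⟨K0 + 256, by linarith, ?_⟩
  intro t ht
  have htR : (1 : ℝ) ≤ t := by exact_mod_cast ht
  have ht0 : (0 : ℝ) < t := by linarith
  have hY : (0 : ℝ) < (t : ℝ) ^ 40 := by positivity
  have hρ : (0 : ℝ) < 1 / (t : ℝ) ^ 14 := by positivity
  obtain ⟨S, h0S, hcard, hinj, hb⟩ := G1_points (α := α) t ht
  have hb' : ∀ a ∈ S, nuN α ((t : ℝ) ^ 40) (1 / (t : ℝ) ^ 14) a ≤ 1 := by
    intro a ha
    rw [nuN_le hY hρ, one_mul, one_mul]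
    exact hb a ha
  by_cases hdet : ∀ a ∈ S, ∀ b ∈ S, ∀ c ∈ S, det3 a b c = 0
  swap
  · left
    push Not at hdet
    obtain ⟨a, ha, b, hb2, c, hc, h⟩ := hdet
    exact ⟨a, b, c, h, hb' a ha, hb' b hb2, hb' c hc⟩
  right
  have h2 : 2 ≤ S.card := by
    have : 1 ≤ t ^ 12 := Nat.one_le_pow _ _ ht
    omega
  have hcR : (t : ℝ) ^ 12 ≤ S.card := by exact_mod_cast hcard.le
  have hfinal : ∀ A B C : ℤ, (A, B, C) ≠ (0, 0, 0) → |(A : ℝ)| ≤ 64 * (t : ℝ) ^ 14 →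
      |(B : ℝ)| ≤ 128 * (t : ℝ) ^ 14 → |(A : ℝ) * α ^ 2 + B * α + C| ≤ (K0 + 64) / (t : ℝ) ^ 39 →
      (∃ A B C : ℤ, (A, B, C) ≠ (0, 0, 0) ∧ |(A : ℝ)| ≤ (K0 + 256) * (t : ℝ) ^ 14 ∧
        |(B : ℝ)| ≤ (K0 + 256) * (t : ℝ) ^ 14 ∧ |(C : ℝ)| ≤ (K0 + 256) * (t : ℝ) ^ 14 ∧
        |(A : ℝ) * α ^ 2 + B * α + C| ≤ (K0 + 256) / (t : ℝ) ^ 39) := by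
    intro A B C hne hA hB hP
    have ht14 : (1 : ℝ) ≤ (t : ℝ) ^ 14 := one_le_pow₀ htR
    refine ⟨A, B, C, hne, hA.trans ?_, hB.trans ?_, ?_, hP.trans ?_⟩
    · gcongr; linarith
    · gcongr; linarith
    · have e : (C : ℝ) = (A * α ^ 2 + B * α + C) - A * α ^ 2 - B * α := by ring
      have hP1 : (K0 + 64) / (t : ℝ) ^ 39 ≤ (K0 + 64) * (t : ℝ) ^ 14 := by
        rw [div_le_iff₀ (by positivity), mul_assoc]
        have : (1 : ℝ) ≤ (t : ℝ) ^ 14 * (t : ℝ) ^ 39 :=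
          one_le_mul_of_one_le_of_one_le ht14 (one_le_pow₀ htR)
        nlinarith
      have hα2 : α ^ 2 ≤ 1 := by nlinarith
      rw [e]
      calc _ ≤ |(A : ℝ) * α ^ 2 + B * α + C| + |A * α ^ 2| + |B * α| :=
            (abs_sub _ _).trans (add_le_add_left (abs_sub _ _) _)
        _ = |(A : ℝ) * α ^ 2 + B * α + C| + |(A : ℝ)| * α ^ 2 + |(B : ℝ)| * α := by
          rw [abs_mul, abs_mul, abs_of_pos hα0, abs_of_nonneg (sq_nonneg α)]
        _ ≤ (K0 + 64) * (t : ℝ) ^ 14 + (64 * (t : ℝ) ^ 14) * 1 + (128 * (t : ℝ) ^ 14) * 1 := by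
          gcongr
          exact hP.trans hP1
        _ = _ := by ring
    · gcongr; linarith
  rcases G1_core hY hρ S h0S h2 hinj hb' hdet with ⟨P, hP0, hP⟩ | ⟨p, hp1, hp⟩
  · have hP' : nuD α ((t : ℝ) ^ 40) (1 / (t : ℝ) ^ 14) P ≤ 64 / (t : ℝ) ^ 12 :=
      hP.trans (by gcongr)
    obtain ⟨h3, h4, h5⟩ := (nuD_le hY hρ).mp hP'
    have e1 : 64 / (t : ℝ) ^ 12 * ((t : ℝ) ^ 40 * (1 / (t : ℝ) ^ 14)) = 64 * (t : ℝ) ^ 14 := by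
      field_simp
    have e2 : 64 / (t : ℝ) ^ 12 * (1 / (t : ℝ) ^ 14) ^ 2 = 64 / (t : ℝ) ^ 40 := by
      field_simp
    rw [e1] at h3 h4
    rw [e2] at h5
    refine hfinal P.1 P.2.1 P.2.2 ?_ h3 ?_ (h5.trans ?_)
    · exact hP0
    · have e : (P.2.1 : ℝ) = (P.2.1 + α * P.1) - α * P.1 := by ring
      rw [e]
      calc _ ≤ |(P.2.1 : ℝ) + α * P.1| + |α * P.1| := abs_sub _ _
        _ = |(P.2.1 : ℝ) + α * P.1| + α * |(P.1 : ℝ)| := by rw [abs_mul, abs_of_pos hα0]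
        _ ≤ 64 * (t : ℝ) ^ 14 + 1 * (64 * (t : ℝ) ^ 14) := by gcongr
        _ = _ := by ring
    · calc (64 : ℝ) / (t : ℝ) ^ 40 ≤ 64 / (t : ℝ) ^ 39 := by
            gcongr
            norm_num
        _ ≤ _ := by gcongr; linarith
  · have hp' : nuN α ((t : ℝ) ^ 40) (1 / (t : ℝ) ^ 14) p ≤ 8 / (t : ℝ) ^ 12 :=
      hp.trans (by gcongr)
    obtain ⟨h3, h4, h5⟩ := (nuN_le hY hρ).mp hp'
    have e1 : 8 / (t : ℝ) ^ 12 * (t : ℝ) ^ 40 = 8 * (t : ℝ) ^ 28 := by field_simp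
    have e2 : 8 / (t : ℝ) ^ 12 * (1 / (t : ℝ) ^ 14) = 8 / (t : ℝ) ^ 26 := by field_simp
    rw [e1] at h3
    rw [e2] at h4 h5
    obtain ⟨A, B, C, hne, hA, hB, hP⟩ := G1_dual hα0 hα1 hc0 hbad htR p hp1 h3 h4 h5
    refine hfinal A B C ?_ (hA.trans ?_) (hB.trans ?_) (hP.trans ?_)
    · intro h
      rw [Prod.mk.injEq, Prod.mk.injEq] at h
      exact hne (by rw [h.1, h.2.1])
    · gcongr; norm_num
    · gcongr; norm_num
    · gcongr; linarith

end G1b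


section G2

/-- value of the quadratic form -/
noncomputable def qv (α : ℝ) (P : ℤ × ℤ × ℤ) : ℝ := (P.1 : ℝ) * α ^ 2 + P.2.1 * α + P.2.2

/-- box -/
def inB (H : ℕ) (P : ℤ × ℤ × ℤ) : Prop := |P.1| ≤ H ∧ |P.2.1| ≤ H ∧ |P.2.2| ≤ H

lemma inB_mono {H H' : ℕ} (h : H ≤ H') {P : ℤ × ℤ × ℤ} (hP : inB H P) : inB H' P :=
  ⟨hP.1.trans (by exact_mod_cast h), hP.2.1.trans (by exact_mod_cast h),
    hP.2.2.trans (by exact_mod_cast h)⟩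

lemma inB_real {H : ℕ} {P : ℤ × ℤ × ℤ} (hP : inB H P) :
    |(P.1 : ℝ)| ≤ H ∧ |(P.2.1 : ℝ)| ≤ H ∧ |(P.2.2 : ℝ)| ≤ H :=
  ⟨by exact_mod_cast hP.1, by exact_mod_cast hP.2.1, by exact_mod_cast hP.2.2⟩

/-- minimal point -/
def isMin (α : ℝ) (H : ℕ) (P : ℤ × ℤ × ℤ) : Prop :=
  P ≠ 0 ∧ inB H P ∧ ∀ Q, Q ≠ 0 → inB H Q → |qv α P| ≤ |qv α Q|

lemma exists_isMin (α : ℝ) (H : ℕ) {Q : ℤ × ℤ × ℤ} (hQ : Q ≠ 0) (hQB : inB H Q) :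
    ∃ P, isMin α H P := by
  classical
  let B : Finset (ℤ × ℤ × ℤ) := ((Finset.Icc (-(H : ℤ)) H) ×ˢ ((Finset.Icc (-(H : ℤ)) H) ×ˢ
    (Finset.Icc (-(H : ℤ)) H))).filter (fun P => P ≠ 0)
  have hB : ∀ P, P ∈ B ↔ P ≠ 0 ∧ inB H P := by
    intro P
    simp only [B, Finset.mem_filter, Finset.mem_product, Finset.mem_Icc, inB, abs_le]
    tauto
  obtain ⟨P, hP, hmin⟩ := Finset.exists_min_image B (fun P => |qv α P|) ⟨Q, (hB Q).mpr ⟨hQ, hQB⟩⟩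
  exact ⟨P, ((hB P).mp hP).1, ((hB P).mp hP).2, fun R hR hRB => hmin R ((hB R).mpr ⟨hR, hRB⟩)⟩

lemma qv_inB_bound {α : ℝ} (hα0 : 0 < α) (hα1 : α < 1) {H : ℕ} {P : ℤ × ℤ × ℤ} (hP : inB H P) :
    |(P.2.1 : ℝ) + α * P.1| ≤ 2 * H := by
  obtain ⟨h1, h2, _⟩ := inB_real hP
  calc _ ≤ |(P.2.1 : ℝ)| + |α * P.1| := abs_add_le _ _
    _ = |(P.2.1 : ℝ)| + α * |(P.1 : ℝ)| := by rw [abs_mul, abs_of_pos hα0]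
    _ ≤ H + 1 * H := by gcongr
    _ = _ := by ring

/-- cross products of consecutive points are controlled -/
lemma crs_pair {α : ℝ} (hα0 : 0 < α) (hα1 : α < 1) {H H' : ℕ} (hHH : H ≤ H')
    {P Q : ℤ × ℤ × ℤ} (hP : inB H P) (hQ : inB H' Q) (hl : |qv α Q| ≤ |qv α P|) :
    |((crs P Q).1 : ℝ)| ≤ 2 * (H * H') ∧
    |((crs P Q).2.1 : ℝ) - α * (crs P Q).1| ≤ 2 * (|qv α P| * H') ∧
    |((crs P Q).2.2 : ℝ) - α * (crs P Q).2.1| ≤ 4 * (|qv α P| * H') := by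
  obtain ⟨p1, p2, p3⟩ := inB_real hP
  obtain ⟨q1, q2, q3⟩ := inB_real hQ
  have p4 := qv_inB_bound hα0 hα1 hP
  have q4 := qv_inB_bound hα0 hα1 hQ
  have hHR : (H : ℝ) ≤ H' := by exact_mod_cast hHH
  simp only [crs]
  push_cast
  refine ⟨?_, ?_, ?_⟩
  · calc _ ≤ |(P.1 : ℝ) * Q.2.1| + |(P.2.1 : ℝ) * Q.1| := abs_sub _ _
      _ = |(P.1 : ℝ)| * |(Q.2.1 : ℝ)| + |(P.2.1 : ℝ)| * |(Q.1 : ℝ)| := by rw [abs_mul, abs_mul]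
      _ ≤ H * H' + H * H' := by gcongr
      _ = _ := by ring
  · calc _ = |Q.1 * qv α P - P.1 * qv α Q| := by unfold qv; congr 1; ring
      _ ≤ |Q.1 * qv α P| + |P.1 * qv α Q| := abs_sub _ _
      _ = |(Q.1 : ℝ)| * |qv α P| + |(P.1 : ℝ)| * |qv α Q| := by rw [abs_mul, abs_mul]
      _ ≤ H' * |qv α P| + H' * |qv α P| := by gcongr; exact p1.trans hHR
      _ = _ := by ring
  · calc _ = |qv α Q * (P.2.1 + α * P.1) - qv α P * (Q.2.1 + α * Q.1)| := by
          unfold qv; congr 1; ring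
      _ ≤ |qv α Q * (P.2.1 + α * P.1)| + |qv α P * (Q.2.1 + α * Q.1)| := abs_sub _ _
      _ = |qv α Q| * |P.2.1 + α * P.1| + |qv α P| * |Q.2.1 + α * Q.1| := by
          rw [abs_mul, abs_mul]
      _ ≤ |qv α P| * (2 * H') + |qv α P| * (2 * H') := by
          gcongr
          exact p4.trans (by gcongr)
      _ = _ := by ring

lemma crs_ne {α : ℝ} {H : ℕ} {P Q : ℤ × ℤ × ℤ} (hP : isMin α H P) (hQ0 : Q ≠ 0)
    (hl : |qv α Q| < |qv α P|) : crs P Q ≠ 0 := by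
  intro h
  have h1 : P.1 * Q.2.1 - P.2.1 * Q.1 = 0 := congrArg Prod.fst h
  have h2 : P.2.2 * Q.1 - P.1 * Q.2.2 = 0 := congrArg (fun q => q.2.1) h
  have h3 : P.2.1 * Q.2.2 - P.2.2 * Q.2.1 = 0 := congrArg (fun q => q.2.2) h
  have h1' : (P.1 : ℝ) * Q.2.1 - P.2.1 * Q.1 = 0 := by exact_mod_cast h1
  have h2' : (P.2.2 : ℝ) * Q.1 - P.1 * Q.2.2 = 0 := by exact_mod_cast h2
  have h3' : (P.2.1 : ℝ) * Q.2.2 - P.2.2 * Q.2.1 = 0 := by exact_mod_cast h3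
  have e1 : (Q.1 : ℝ) * qv α P = P.1 * qv α Q := by
    unfold qv; linear_combination h2' - α * h1'
  have e2 : (Q.2.1 : ℝ) * qv α P = P.2.1 * qv α Q := by
    unfold qv; linear_combination α ^ 2 * h1' - h3'
  have e3 : (Q.2.2 : ℝ) * qv α P = P.2.2 * qv α Q := by
    unfold qv; linear_combination -α ^ 2 * h2' + α * h3'
  have key : ∀ a b : ℤ, (a : ℝ) * qv α P = b * qv α Q → |a| ≤ |b| := by
    intro a b hab
    have h4 := congrArg abs hab
    rw [abs_mul, abs_mul] at h4
    have h0 : 0 < |qv α P| := (abs_nonneg _).trans_lt hl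
    have : |(a : ℝ)| * |qv α P| ≤ |(b : ℝ)| * |qv α P| := by
      rw [h4]; gcongr
    have := le_of_mul_le_mul_right this h0
    exact_mod_cast this
  have hQB : inB H Q := ⟨(key _ _ e1).trans hP.2.1.1, (key _ _ e2).trans hP.2.1.2.1,
    (key _ _ e3).trans hP.2.1.2.2⟩
  exact absurd (hP.2.2 Q hQ0 hQB) (not_le.mpr hl)

lemma det3_bound {α : ℝ} {H H' H'' : ℕ} (h1 : H ≤ H') (h2 : H' ≤ H'')
    {P Q R : ℤ × ℤ × ℤ} (hP : inB H P) (hQ : inB H' Q) (hR : inB H'' R)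
    (hl : |qv α Q| ≤ |qv α P|) (hl' : |qv α R| ≤ |qv α P|) :
    |(det3 P Q R : ℝ)| ≤ 6 * (|qv α P| * H' * H'') := by
  obtain ⟨p1, p2, _⟩ := inB_real hP
  obtain ⟨q1, q2, _⟩ := inB_real hQ
  obtain ⟨r1, r2, _⟩ := inB_real hR
  have hR1 : (H : ℝ) ≤ H' := by exact_mod_cast h1
  have hR2 : (H' : ℝ) ≤ H'' := by exact_mod_cast h2
  have key : ∀ a b c : ℝ, |a| ≤ |qv α P| → |b| ≤ H' → |c| ≤ H'' →
      |a * b * c| ≤ |qv α P| * H' * H'' := by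
    intro a b c ha hb hc
    rw [abs_mul, abs_mul]; gcongr
  have e : (det3 P Q R : ℝ) = qv α R * P.1 * Q.2.1 - qv α Q * P.1 * R.2.1
      - qv α R * P.2.1 * Q.1 + qv α Q * P.2.1 * R.1 + qv α P * Q.1 * R.2.1
      - qv α P * Q.2.1 * R.1 := by
    unfold det3 qv; push_cast; ring
  have k1 := abs_le.mp (key (qv α R) P.1 Q.2.1 hl' (p1.trans hR1) (q2.trans hR2))
  have k2 := abs_le.mp (key (qv α Q) P.1 R.2.1 hl (p1.trans hR1) r2)
  have k3 := abs_le.mp (key (qv α R) P.2.1 Q.1 hl' (p2.trans hR1) (q1.trans hR2))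
  have k4 := abs_le.mp (key (qv α Q) P.2.1 R.1 hl (p2.trans hR1) r1)
  have k5 := abs_le.mp (key (qv α P) Q.1 R.2.1 le_rfl q1 r2)
  have k6 := abs_le.mp (key (qv α P) Q.2.1 R.1 le_rfl q2 r1)
  rw [e, abs_le]
  constructor <;> linarith [k1.1, k1.2, k2.1, k2.2, k3.1, k3.2, k4.1, k4.2, k5.1, k5.2, k6.1, k6.2]

/-- the step relation -/
structure Stp (α K1 : ℝ) (H : ℕ) (P : ℤ × ℤ × ℤ) (H' : ℕ) (Q : ℤ × ℤ × ℤ) : Prop where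
  lt : H < H'
  minP : isMin α H P
  minQ : isMin α H' Q
  ql : |qv α Q| < |qv α P|
  small : |qv α P| ^ 4 * (H' : ℝ) ^ 11 ≤ 2 ^ 11
  yne : (crs P Q).1 ≠ 0
  grow : (H' : ℝ) ^ 3 ≤ K1 * (H : ℝ) ^ 4

lemma G2_step {α c0 c1 : ℝ} {d : ℕ} (hα0 : 0 < α) (hα1 : α < 1) (hc0 : 0 < c0)
    (hbad : ∀ y z : ℤ, y ≠ 0 → c0 ≤ |(y : ℝ)| * |z - α * y|) (hc1 : 0 < c1)
    (hliou : ∀ P : ℤ × ℤ × ℤ, P ≠ 0 → ∀ H : ℕ, 1 ≤ H → inB H P → c1 ≤ |qv α P| * (H : ℝ) ^ d)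
    {H0 : ℕ} (hH0 : 1 ≤ H0) (hH0c : 1 < c1 ^ 4 * (H0 : ℝ) ^ 11)
    (hH0d : (2 : ℝ) ^ 19 < (H0 : ℝ) ^ 7)
    (hyp : ∀ H : ℕ, H0 ≤ H → H ≤ H0 ^ (2 * d + 1) → ∃ P : ℤ × ℤ × ℤ, P ≠ 0 ∧ inB H P ∧
      |qv α P| ^ 4 * (H : ℝ) ^ 11 ≤ 1)
    {H : ℕ} (hH : H0 ≤ H) (hH3 : H ≤ H0 ^ 3) {P : ℤ × ℤ × ℤ} (hP : isMin α H P) :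
    ∃ H' Q, Stp α (4 ^ 4 * 2 ^ 11 / c0 ^ 4) H P H' Q := by
  classical
  have hH0R : (1 : ℝ) ≤ H0 := by exact_mod_cast hH0
  have hHR : (H0 : ℝ) ≤ H := by exact_mod_cast hH
  have hpos : 0 < |qv α P| := by
    have := hliou P hP.1 H (by omega) hP.2.1
    by_contra hcon
    have h0 : |qv α P| = 0 := le_antisymm (not_lt.mp hcon) (abs_nonneg _)
    rw [h0, zero_mul] at this
    linarith
  have hex : ∃ H', ∃ Q, Q ≠ 0 ∧ inB H' Q ∧ |qv α Q| < |qv α P| := by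
    refine ⟨H0 ^ (2 * d + 1), ?_⟩
    obtain ⟨Q, hQ0, hQB, hQ⟩ := hyp (H0 ^ (2 * d + 1)) (Nat.le_self_pow (by omega) _) le_rfl
    refine ⟨Q, hQ0, hQB, ?_⟩
    by_contra hcon
    push Not at hcon
    have h1 := hliou P hP.1 (H0 ^ 3) (Nat.one_le_pow _ _ (by omega)) (inB_mono hH3 hP.2.1)
    have h2 : c1 ≤ |qv α Q| * ((H0 ^ 3 : ℕ) : ℝ) ^ d := h1.trans (by gcongr)
    push_cast at h2 hQ
    have h3 : c1 ^ 4 ≤ (|qv α Q| * ((H0 : ℝ) ^ 3) ^ d) ^ 4 := by gcongr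
    have h4 : c1 ^ 4 * (H0 : ℝ) ^ 11 ≤ 1 := by
      calc c1 ^ 4 * (H0 : ℝ) ^ 11 ≤ (|qv α Q| * ((H0 : ℝ) ^ 3) ^ d) ^ 4 * (H0 : ℝ) ^ 11 := by
            gcongr
        _ = |qv α Q| ^ 4 * (H0 : ℝ) ^ (12 * d + 11) := by ring
        _ ≤ |qv α Q| ^ 4 * (H0 : ℝ) ^ ((2 * d + 1) * 11) := by
            gcongr
            omega
        _ = |qv α Q| ^ 4 * ((H0 : ℝ) ^ (2 * d + 1)) ^ 11 := by rw [← pow_mul]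
        _ ≤ 1 := hQ
    linarith
  have hle : Nat.find hex ≤ H0 ^ (2 * d + 1) := by
    by_contra hcon
    push Not at hcon
    have hnot := Nat.find_min hex hcon
    apply hnot
    obtain ⟨H', Q, hQ⟩ := hex
    -- redo
    obtain ⟨Q, hQ0, hQB, hQ⟩ := hyp (H0 ^ (2 * d + 1)) (Nat.le_self_pow (by omega) _) le_rfl
    refine ⟨Q, hQ0, hQB, ?_⟩
    by_contra hcon
    push Not at hcon
    have h1 := hliou P hP.1 (H0 ^ 3) (Nat.one_le_pow _ _ (by omega)) (inB_mono hH3 hP.2.1)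
    have h2 : c1 ≤ |qv α Q| * ((H0 ^ 3 : ℕ) : ℝ) ^ d := h1.trans (by gcongr)
    push_cast at h2 hQ
    have h3 : c1 ^ 4 ≤ (|qv α Q| * ((H0 : ℝ) ^ 3) ^ d) ^ 4 := by gcongr
    have h4 : c1 ^ 4 * (H0 : ℝ) ^ 11 ≤ 1 := by
      calc c1 ^ 4 * (H0 : ℝ) ^ 11 ≤ (|qv α Q| * ((H0 : ℝ) ^ 3) ^ d) ^ 4 * (H0 : ℝ) ^ 11 := by
            gcongr
        _ = |qv α Q| ^ 4 * (H0 : ℝ) ^ (12 * d + 11) := by ring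
        _ ≤ |qv α Q| ^ 4 * (H0 : ℝ) ^ ((2 * d + 1) * 11) := by
            gcongr
            omega
        _ = |qv α Q| ^ 4 * ((H0 : ℝ) ^ (2 * d + 1)) ^ 11 := by rw [← pow_mul]
        _ ≤ 1 := hQ
    linarith
  set H' := Nat.find hex with hH'
  obtain ⟨Q1, hQ10, hQ1B, hQ1⟩ := Nat.find_spec hex
  have hlt : H < H' := by
    by_contra hcon
    push Not at hcon
    exact absurd (hP.2.2 Q1 hQ10 (inB_mono hcon hQ1B)) (not_le.mpr hQ1)
  obtain ⟨Q, hQ⟩ := exists_isMin α H' hQ10 hQ1B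
  have hQl : |qv α Q| < |qv α P| := (hQ.2.2 Q1 hQ10 hQ1B).trans_lt hQ1
  have hsmall : |qv α P| ^ 4 * (H' : ℝ) ^ 11 ≤ 2 ^ 11 := by
    obtain ⟨R, hR0, hRB, hR⟩ := hyp (H' - 1) (by omega) (by omega)
    have h1 : |qv α P| ≤ |qv α R| := by
      by_contra hcon
      push Not at hcon
      exact Nat.find_min hex (m := H' - 1) (by omega) ⟨R, hR0, hRB, hcon⟩
    have h2 : (H' : ℝ) ≤ 2 * ((H' - 1 : ℕ) : ℝ) := by
      have : H' ≤ 2 * (H' - 1) := by omega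
      exact_mod_cast this
    calc |qv α P| ^ 4 * (H' : ℝ) ^ 11 ≤ |qv α R| ^ 4 * (2 * ((H' - 1 : ℕ) : ℝ)) ^ 11 := by gcongr
      _ = 2 ^ 11 * (|qv α R| ^ 4 * ((H' - 1 : ℕ) : ℝ) ^ 11) := by ring
      _ ≤ 2 ^ 11 * 1 := by gcongr
      _ = _ := by norm_num
  have hH'R : (H0 : ℝ) ≤ H' := by exact_mod_cast (hH.trans hlt.le)
  have hH'0 : (0 : ℝ) < H' := by linarith
  have hsm1 : 4 * (|qv α P| * H') < 1 := by
    have h0 : 0 ≤ 4 * (|qv α P| * H') := by positivity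
    have h1 : (4 * (|qv α P| * H')) ^ 4 * (H' : ℝ) ^ 7 ≤ 2 ^ 19 := by
      calc _ = 4 ^ 4 * (|qv α P| ^ 4 * (H' : ℝ) ^ 11) := by ring
        _ ≤ 4 ^ 4 * 2 ^ 11 := by gcongr
        _ = _ := by norm_num
    have h2 : (2 : ℝ) ^ 19 < (H' : ℝ) ^ 7 := hH0d.trans_le (by gcongr)
    by_contra hcon
    push Not at hcon
    have h3 : (1 : ℝ) ≤ (4 * (|qv α P| * H')) ^ 4 := one_le_pow₀ hcon
    nlinarith
  obtain ⟨b1, b2, b3⟩ := crs_pair hα0 hα1 hlt.le hP.2.1 hQ.2.1 hQl.le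
  have hne := crs_ne hP hQ.1 hQl
  have hyne : (crs P Q).1 ≠ 0 := by
    intro hy
    rw [hy] at b2
    have hz1 : (crs P Q).2.1 = 0 := by
      have : |((crs P Q).2.1 : ℝ)| < 1 := by
        push_cast at b2
        rw [mul_zero, sub_zero] at b2
        have : 0 ≤ |qv α P| * H' := by positivity
        linarith
      have : |(crs P Q).2.1| < 1 := by exact_mod_cast this
      exact Int.abs_lt_one_iff.mp this
    rw [hz1] at b3
    have hz2 : (crs P Q).2.2 = 0 := by
      have : |((crs P Q).2.2 : ℝ)| < 1 := by
        push_cast at b3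
        rw [mul_zero, sub_zero] at b3
        linarith
      have : |(crs P Q).2.2| < 1 := by exact_mod_cast this
      exact Int.abs_lt_one_iff.mp this
    exact hne (Prod.ext hy (Prod.ext hz1 hz2))
  refine ⟨H', Q, hlt, hP, hQ, hQl, hsmall, hyne, ?_⟩
  have hb := hbad _ (crs P Q).2.1 hyne
  have h1 : c0 ≤ (2 * (H * H')) * (2 * (|qv α P| * H')) := hb.trans (by gcongr)
  have h2 : c0 ^ 4 ≤ ((2 * (H * H')) * (2 * (|qv α P| * H'))) ^ 4 := by gcongr
  rw [div_mul_eq_mul_div, le_div_iff₀ (by positivity)]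
  calc (H' : ℝ) ^ 3 * c0 ^ 4
      ≤ (H' : ℝ) ^ 3 * ((2 * (H * H')) * (2 * (|qv α P| * H'))) ^ 4 := by gcongr
    _ = 4 ^ 4 * (|qv α P| ^ 4 * (H' : ℝ) ^ 11) * (H : ℝ) ^ 4 := by ring
    _ ≤ 4 ^ 4 * 2 ^ 11 * (H : ℝ) ^ 4 := by gcongr

end G2


section G2b

/-- duality pairing -/
def dt (s P : ℤ × ℤ × ℤ) : ℤ := P.2.2 * s.1 + P.2.1 * s.2.1 + P.1 * s.2.2

lemma dt_crs_left (P Q : ℤ × ℤ × ℤ) : dt (crs P Q) P = 0 := by unfold dt crs; ring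
lemma dt_crs_right (P Q : ℤ × ℤ × ℤ) : dt (crs P Q) Q = 0 := by unfold dt crs; ring
lemma dt_crs_det (P Q R : ℤ × ℤ × ℤ) (h : det3 P Q R = 0) : dt (crs P Q) R = 0 := by
  unfold det3 at h; unfold dt crs; simp only; linarith

lemma dt_par {s P Q : ℤ × ℤ × ℤ} (hP : dt s P = 0) (hQ : dt s Q = 0) :
    (crs P Q).1 * s.2.1 = s.1 * (crs P Q).2.1 ∧ (crs P Q).1 * s.2.2 = s.1 * (crs P Q).2.2 := by
  unfold dt at hP hQ
  unfold crs
  constructor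
  · simp only; linear_combination P.1 * hQ - Q.1 * hP
  · simp only; linear_combination Q.2.1 * hP - P.2.1 * hQ

lemma G2_loop {α c0 c1 : ℝ} {d : ℕ} (hα0 : 0 < α) (hα1 : α < 1) (hc0 : 0 < c0)
    (hbad : ∀ y z : ℤ, y ≠ 0 → c0 ≤ |(y : ℝ)| * |z - α * y|) (hc1 : 0 < c1)
    (hliou : ∀ P : ℤ × ℤ × ℤ, P ≠ 0 → ∀ H : ℕ, 1 ≤ H → inB H P → c1 ≤ |qv α P| * (H : ℝ) ^ d)
    {H0 : ℕ} (hH0 : 1 ≤ H0) (hH0c : 1 < c1 ^ 4 * (H0 : ℝ) ^ 11)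
    (hH0d : (2 : ℝ) ^ 19 < (H0 : ℝ) ^ 7)
    (hyp : ∀ H : ℕ, H0 ≤ H → H ≤ H0 ^ (2 * d + 1) → ∃ P : ℤ × ℤ × ℤ, P ≠ 0 ∧ inB H P ∧
      |qv α P| ^ 4 * (H : ℝ) ^ 11 ≤ 1)
    {K1 : ℝ} (hK1 : K1 = 4 ^ 4 * 2 ^ 11 / c0 ^ 4)
    (hH0e : 6 ^ 12 * 2 ^ 33 * K1 ^ 4 < (H0 : ℝ) ^ 5)
    (hH0f : 8 ^ 12 * 2 ^ 33 * K1 ^ 8 < c0 ^ 12 * (H0 : ℝ) ^ 7)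
    {H1 : ℕ} {s : ℤ × ℤ × ℤ} (hs : s.1 ≠ 0) (hs1 : |(s.1 : ℝ)| ≤ 2 * (H0 * H1))
    (hH1 : (H1 : ℝ) ^ 3 ≤ K1 * (H0 : ℝ) ^ 4) :
    ∀ n : ℕ, ∀ H P H' Q, Stp α K1 H P H' Q → H0 ≤ H → dt s P = 0 → dt s Q = 0 →
      H0 ^ 3 ≤ H' + n → False := by
  have hH0R : (1 : ℝ) ≤ H0 := by exact_mod_cast hH0
  have hK10 : 0 < K1 := by rw [hK1]; positivity
  have fin : ∀ H P H' Q, Stp α K1 H P H' Q → H0 ≤ H → dt s P = 0 → dt s Q = 0 →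
      H0 ^ 3 ≤ H' → False := by
    intro H P H' Q st hH hP hQ hge
    obtain ⟨b1, b2, b3⟩ := crs_pair hα0 hα1 st.lt.le st.minP.2.1 st.minQ.2.1 st.ql.le
    obtain ⟨e1, e2⟩ := dt_par hP hQ
    have hb := hbad s.1 s.2.1 hs
    have hy1 : (1 : ℝ) ≤ |((crs P Q).1 : ℝ)| := by exact_mod_cast Int.one_le_abs st.yne
    have e1R : ((crs P Q).1 : ℝ) * s.2.1 = s.1 * (crs P Q).2.1 := by exact_mod_cast e1
    have e3 : |((crs P Q).1 : ℝ)| * |(s.2.1 : ℝ) - α * s.1|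
        = |(s.1 : ℝ)| * |((crs P Q).2.1 : ℝ) - α * (crs P Q).1| := by
      rw [← abs_mul, ← abs_mul]; congr 1; linear_combination e1R
    have hc : c0 ≤ (2 * (H0 * H1)) * ((2 * (H0 * H1)) * (2 * (|qv α P| * H'))) := by
      calc c0 ≤ |(s.1 : ℝ)| * |(s.2.1 : ℝ) - α * s.1| := hb
        _ = 1 * |(s.2.1 : ℝ) - α * s.1| * |(s.1 : ℝ)| := by ring
        _ ≤ |((crs P Q).1 : ℝ)| * |(s.2.1 : ℝ) - α * s.1| * |(s.1 : ℝ)| := by gcongr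
        _ = |(s.1 : ℝ)| * (|(s.1 : ℝ)| * |((crs P Q).2.1 : ℝ) - α * (crs P Q).1|) := by
            rw [e3]; ring
        _ ≤ _ := by gcongr
    have hH'0 : (0 : ℝ) < H' := by
      have := st.lt
      have : 0 < H' := by omega
      exact_mod_cast this
    have hge' : (H0 : ℝ) ^ 3 ≤ H' := by exact_mod_cast hge
    have h12 : c0 ^ 12 * (H' : ℝ) ^ 21 ≤ 8 ^ 12 * 2 ^ 33 * K1 ^ 8 * (H0 : ℝ) ^ 56 := by
      calc c0 ^ 12 * (H' : ℝ) ^ 21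
          ≤ ((2 * (H0 * H1)) * ((2 * (H0 * H1)) * (2 * (|qv α P| * H')))) ^ 12 * (H' : ℝ) ^ 21 := by
            gcongr
        _ = 8 ^ 12 * (H0 : ℝ) ^ 24 * ((H1 : ℝ) ^ 3) ^ 8 * (|qv α P| ^ 4 * (H' : ℝ) ^ 11) ^ 3 := by ring
        _ ≤ 8 ^ 12 * (H0 : ℝ) ^ 24 * (K1 * (H0 : ℝ) ^ 4) ^ 8 * (2 ^ 11) ^ 3 := by
            have := st.small
            gcongr
        _ = _ := by ring
    have h13 : c0 ^ 12 * (H0 : ℝ) ^ 63 ≤ c0 ^ 12 * (H' : ℝ) ^ 21 := by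
      rw [show (H0 : ℝ) ^ 63 = ((H0 : ℝ) ^ 3) ^ 21 by ring]; gcongr
    have h14 : 8 ^ 12 * 2 ^ 33 * K1 ^ 8 * (H0 : ℝ) ^ 56 < c0 ^ 12 * (H0 : ℝ) ^ 63 := by
      calc _ < c0 ^ 12 * (H0 : ℝ) ^ 7 * (H0 : ℝ) ^ 56 := by gcongr
        _ = _ := by ring
    linarith
  intro n
  induction n with
  | zero => intro H P H' Q st hH hP hQ h; exact fin H P H' Q st hH hP hQ (by omega)
  | succ n ih =>
    intro H P H' Q st hH hP hQ h
    by_cases hge : H0 ^ 3 ≤ H'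
    · exact fin H P H' Q st hH hP hQ hge
    push Not at hge
    have hlt := st.lt
    obtain ⟨H'', R, st'⟩ := G2_step hα0 hα1 hc0 hbad hc1 hliou hH0 hH0c hH0d hyp
      (H := H') (by omega) hge.le st.minQ
    rw [← hK1] at st'
    refine ih H' Q H'' R st' (by omega) hQ ?_ (by have := st'.lt; omega)
    have hH'R : (H0 : ℝ) ≤ H' := by exact_mod_cast (by omega : H0 ≤ H')
    have hH'0 : (0 : ℝ) < H' := by linarith
    have hdet : det3 P Q R = 0 := by
      have hb := det3_bound (α := α) st.lt.le st'.lt.le st.minP.2.1 st.minQ.2.1 st'.minQ.2.1 st.ql.le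
        (st'.ql.le.trans st.ql.le)
      by_contra hne
      have h1 : (1 : ℝ) ≤ |(det3 P Q R : ℝ)| := by exact_mod_cast Int.one_le_abs hne
      have h2 : (1 : ℝ) ≤ 6 * (|qv α P| * H' * H'') := h1.trans hb
      have h3 : (1 : ℝ) ≤ (6 * (|qv α P| * H' * H'')) ^ 12 := one_le_pow₀ h2
      have h4 : (H' : ℝ) ^ 21 * (H' : ℝ) ^ 5 * 1
          ≤ (H' : ℝ) ^ 21 * (H' : ℝ) ^ 5 * (6 * (|qv α P| * H' * H'')) ^ 12 := by gcongr
      have h5 : (H' : ℝ) ^ 21 * (H' : ℝ) ^ 5 * (6 * (|qv α P| * H' * H'')) ^ 12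
          ≤ (6 ^ 12 * 2 ^ 33 * K1 ^ 4) * (H' : ℝ) ^ 21 := by
        calc _ = 6 ^ 12 * (|qv α P| ^ 4 * (H' : ℝ) ^ 11) ^ 3 * ((H'' : ℝ) ^ 3) ^ 4 * (H' : ℝ) ^ 5 := by
              ring
          _ ≤ 6 ^ 12 * (2 ^ 11) ^ 3 * (K1 * (H' : ℝ) ^ 4) ^ 4 * (H' : ℝ) ^ 5 := by
              have := st.small
              have := st'.grow
              gcongr
          _ = _ := by ring
      have h6 : (H' : ℝ) ^ 21 * (H' : ℝ) ^ 5 ≤ (6 ^ 12 * 2 ^ 33 * K1 ^ 4) * (H' : ℝ) ^ 21 := by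
        linarith
      have h7 : (H0 : ℝ) ^ 5 ≤ (H' : ℝ) ^ 5 := by gcongr
      have h8 : (0 : ℝ) < (H' : ℝ) ^ 21 := by positivity
      nlinarith
    have hd := dt_crs_det P Q R hdet
    obtain ⟨e1, e2⟩ := dt_par hP hQ
    have : (crs P Q).1 * dt s R = 0 := by
      have : (crs P Q).1 * dt s R = s.1 * dt (crs P Q) R := by
        unfold dt; linear_combination R.2.1 * e1 + R.1 * e2
      rw [this, hd, mul_zero]
    exact (mul_eq_zero.mp this).resolve_left st.yne

/-- final contradiction for small quadratic polynomials on a long range -/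
lemma G2 {α c0 c1 : ℝ} {d : ℕ} (hd : 1 ≤ d) (hα0 : 0 < α) (hα1 : α < 1) (hc0 : 0 < c0)
    (hbad : ∀ y z : ℤ, y ≠ 0 → c0 ≤ |(y : ℝ)| * |z - α * y|) (hc1 : 0 < c1)
    (hliou : ∀ P : ℤ × ℤ × ℤ, P ≠ 0 → ∀ H : ℕ, 1 ≤ H → inB H P → c1 ≤ |qv α P| * (H : ℝ) ^ d) :
    ∃ h0 : ℕ, ∀ H0 : ℕ, h0 ≤ H0 → ∃ H : ℕ, H0 ≤ H ∧ H ≤ H0 ^ (2 * d + 1) ∧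
      ∀ P : ℤ × ℤ × ℤ, P ≠ 0 → inB H P → 1 < |qv α P| ^ 4 * (H : ℝ) ^ 11 := by
  set K1 : ℝ := 4 ^ 4 * 2 ^ 11 / c0 ^ 4 with hK1
  have ev : ∀ᶠ H0 : ℕ in atTop, 1 ≤ H0 ∧ 1 < c1 ^ 4 * (H0 : ℝ) ^ 11 ∧ (2 : ℝ) ^ 19 < (H0 : ℝ) ^ 7
      ∧ 6 ^ 12 * 2 ^ 33 * K1 ^ 4 < (H0 : ℝ) ^ 5
      ∧ 8 ^ 12 * 2 ^ 33 * K1 ^ 8 < c0 ^ 12 * (H0 : ℝ) ^ 7 := by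
    have tp : ∀ k : ℕ, k ≠ 0 → Tendsto (fun H : ℕ => (H : ℝ) ^ k) atTop atTop := fun k hk =>
      (tendsto_pow_atTop hk).comp tendsto_natCast_atTop_atTop
    refine (eventually_ge_atTop 1).and (((Tendsto.const_mul_atTop (by positivity)
      (tp 11 (by norm_num))).eventually_gt_atTop 1).and
      (((tp 7 (by norm_num)).eventually_gt_atTop _).and
      (((tp 5 (by norm_num)).eventually_gt_atTop _).and ((Tendsto.const_mul_atTop (by positivity)
      (tp 7 (by norm_num))).eventually_gt_atTop _))))
  obtain ⟨h0, hh0⟩ := eventually_atTop.mp ev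
  refine ⟨h0, fun H0 hH => ?_⟩
  obtain ⟨a1, a2, a3, a4, a5⟩ := hh0 H0 hH
  by_contra hcon
  push Not at hcon
  obtain ⟨P, hP0, hPB, _⟩ := hcon H0 le_rfl (Nat.le_self_pow (by omega) _)
  obtain ⟨P0, hmin⟩ := exists_isMin α H0 hP0 hPB
  obtain ⟨H1, P1, st⟩ := G2_step hα0 hα1 hc0 hbad hc1 hliou a1 a2 a3 hcon
    (H := H0) le_rfl (Nat.le_self_pow (by omega) _) hmin
  rw [← hK1] at st
  obtain ⟨b1, _, _⟩ := crs_pair hα0 hα1 st.lt.le st.minP.2.1 st.minQ.2.1 st.ql.le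
  exact G2_loop hα0 hα1 hc0 hbad hc1 hliou a1 a2 a3 hcon hK1 a4 a5 st.yne b1 st.grow
    (H0 ^ 3) H0 P0 H1 P1 st le_rfl (dt_crs_left _ _) (dt_crs_right _ _) (by omega)

end G2b


section G3

lemma G3_num {w K t H Z : ℝ} (hw : 0 ≤ w) (hK : 1 ≤ K) (ht : 1 ≤ t) (hH : 0 ≤ H)
    (h2 : w ≤ K / t ^ 39) (h3 : H ≤ K * (t + 1) ^ 14) (hZ : (2 : ℝ) ^ 154 = Z)
    (h4 : K ^ 15 * Z ≤ t) : w ^ 4 * H ^ 11 ≤ 1 := by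
  have ht0 : 0 < t := by linarith
  have h5 : H ≤ K * (2 * t) ^ 14 := h3.trans
    (mul_le_mul_of_nonneg_left (pow_le_pow_left₀ (by linarith) (by linarith) 14) (by linarith))
  have a1 : w ^ 4 ≤ K ^ 4 / t ^ 156 := by
    refine (pow_le_pow_left₀ hw h2 4).trans (le_of_eq ?_)
    rw [div_pow, ← pow_mul]
  have a2 : H ^ 11 ≤ K ^ 11 * (Z * t ^ 154) := by
    refine (pow_le_pow_left₀ hH h5 11).trans (le_of_eq ?_)
    rw [mul_pow, ← pow_mul, mul_pow, ← hZ]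
  calc w ^ 4 * H ^ 11 ≤ (K ^ 4 / t ^ 156) * (K ^ 11 * (Z * t ^ 154)) :=
        mul_le_mul a1 a2 (by positivity) (by positivity)
    _ = (K ^ 15 * Z) / t ^ 2 := by
        rw [div_mul_eq_mul_div, div_eq_div_iff (by positivity) (by positivity)]; ring
    _ ≤ 1 := by
        rw [div_le_one (by positivity)]
        nlinarith

lemma Gmain {α c0 c1 : ℝ} {d : ℕ} (hd : 1 ≤ d) (hα0 : 0 < α) (hα1 : α < 1) (hc0 : 0 < c0)
    (hbad : ∀ y z : ℤ, y ≠ 0 → c0 ≤ |(y : ℝ)| * |z - α * y|) (hc1 : 0 < c1)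
    (hliou : ∀ P : ℤ × ℤ × ℤ, P ≠ 0 → ∀ H : ℕ, 1 ≤ H → inB H P → c1 ≤ |qv α P| * (H : ℝ) ^ d) :
    ∃ E t0 : ℕ, 1 ≤ t0 ∧ ∀ T0 : ℕ, t0 ≤ T0 → ∃ t : ℕ, T0 ≤ t ∧ t ≤ T0 ^ E ∧
      ∃ a b c : ℤ × ℤ × ℤ, det3 a b c ≠ 0 ∧ nuN α ((t : ℝ) ^ 40) (1 / (t : ℝ) ^ 14) a ≤ 1 ∧
        nuN α ((t : ℝ) ^ 40) (1 / (t : ℝ) ^ 14) b ≤ 1 ∧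
        nuN α ((t : ℝ) ^ 40) (1 / (t : ℝ) ^ 14) c ≤ 1 := by
  obtain ⟨K', hK'1, hG1⟩ := G1 hα0 hα1 hc0 hbad
  obtain ⟨h0, hG2⟩ := G2 hd hα0 hα1 hc0 hbad hc1 hliou
  set K : ℕ := ⌈K'⌉₊ with hK
  have hKK : K' ≤ K := Nat.le_ceil _
  have hK1 : 1 ≤ K := Nat.one_le_ceil_iff.mpr (by linarith)
  have hK1R : (1 : ℝ) ≤ K := by exact_mod_cast hK1
  obtain ⟨Z, hZ, hZ1⟩ : ∃ Z : ℕ, (2 : ℝ) ^ 154 = (Z : ℝ) ∧ 0 < Z :=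
    ⟨2 ^ 154, by norm_num, by positivity⟩
  refine ⟨15 * (2 * d + 1), h0 + K ^ 15 * Z, ?_, ?_⟩
  · have : 0 < K ^ 15 * Z := by positivity
    omega
  intro T0 hT0
  have hT0K15 : K ^ 15 * Z ≤ T0 := by omega
  have hT0K : K ≤ T0 := (Nat.le_self_pow (by norm_num) K).trans
    ((Nat.le_mul_of_pos_right _ (by positivity)).trans hT0K15)
  have hT1 : 1 ≤ T0 := hK1.trans hT0K
  obtain ⟨H, hH1, hH2, hHP⟩ := hG2 (K * T0 ^ 14) (by
    calc h0 ≤ T0 := by omega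
      _ ≤ T0 ^ 14 := Nat.le_self_pow (by norm_num) _
      _ ≤ K * T0 ^ 14 := Nat.le_mul_of_pos_left _ hK1)
  classical
  set t := Nat.findGreatest (fun t => K * t ^ 14 ≤ H) H with ht
  have hle_self : ∀ u : ℕ, u ≤ K * u ^ 14 := fun u =>
    (Nat.le_self_pow (by norm_num) u).trans (Nat.le_mul_of_pos_left _ hK1)
  have hsp : K * t ^ 14 ≤ H :=
    Nat.findGreatest_spec (P := fun t => K * t ^ 14 ≤ H) ((hle_self T0).trans hH1) hH1
  have hT0t : T0 ≤ t := Nat.le_findGreatest ((hle_self T0).trans hH1) hH1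
  have hgt : H < K * (t + 1) ^ 14 := by
    by_contra hcon
    push Not at hcon
    have : t + 1 ≤ t := Nat.le_findGreatest ((hle_self (t + 1)).trans hcon) hcon
    omega
  refine ⟨t, hT0t, ?_, ?_⟩
  · calc t ≤ H := (hle_self t).trans hsp
      _ ≤ (K * T0 ^ 14) ^ (2 * d + 1) := hH2
      _ ≤ (T0 * T0 ^ 14) ^ (2 * d + 1) := by gcongr
      _ = T0 ^ (15 * (2 * d + 1)) := by rw [← pow_succ', ← pow_mul]
  rcases hG1 t (by omega) with h | ⟨A, B, C, hne, hA, hB, hC, hq⟩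
  · exact h
  exfalso
  have htR : (1 : ℝ) ≤ t := by exact_mod_cast (by omega : 1 ≤ t)
  have hspR : (K : ℝ) * (t : ℝ) ^ 14 ≤ H := by exact_mod_cast hsp
  have hgtR : (H : ℝ) ≤ (K : ℝ) * ((t : ℝ) + 1) ^ 14 := by exact_mod_cast hgt.le
  have hbd : K' * (t : ℝ) ^ 14 ≤ H := le_trans (by gcongr) hspR
  have h1 := hHP (A, B, C) (by simpa using hne)
    ⟨by have := hA.trans hbd; exact_mod_cast this, by have := hB.trans hbd; exact_mod_cast this,
      by have := hC.trans hbd; exact_mod_cast this⟩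
  have h2 : |qv α (A, B, C)| ≤ K / (t : ℝ) ^ 39 := hq.trans (by gcongr)
  have h3 := G3_num (abs_nonneg _) hK1R htR (Nat.cast_nonneg H) h2 hgtR hZ
    (by exact_mod_cast hT0K15.trans hT0t)
  linarith

end G3


section Blk

/-- coefficients of the four linear forms -/
def Gm {R : Type*} [CommRing R] (a : R) : Fin 4 → Fin 4 → R :=
  ![![1, a, 0, 0], ![a, a ^ 2, -1, -a], ![0, a, 0, -1], ![0, 1, 0, 0]]

/-- inverse matrix -/
def Gi {R : Type*} [CommRing R] (a : R) : Fin 4 → Fin 4 → R :=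
  ![![1, 0, 0, -a], ![0, 0, 0, 1], ![a, -1, a, -a ^ 2], ![0, 0, -1, a]]

/-- block data -/
structure Blk (α γ T : ℝ) (μ : Fin 4 → ℝ) (Φ : Fin 3 → Fin 4 → ℤ) (a : Fin 4 → ℝ) : Prop where
  mu0 : μ 0 = 1
  mu1 : μ 1 ≠ α
  mu1' : |μ 1 - α| ≤ Real.exp (-T)
  mub : ∀ i, |μ i| ≤ 1
  bd : ∀ j i, |∑ l, Gm α i l * (Φ j l : ℝ)| ≤ Real.exp (a i)
  asum : ∑ i, a i ≤ -γ * T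
  ab : ∀ i, |a i| ≤ 3 * T
  ker : ∀ j, ∑ i, μ i * (Φ j i : ℝ) = 0
  span : ∀ v : Fin 4 → ℝ, ∑ i, μ i * v i = 0 → ∃ c : Fin 3 → ℝ, ∀ i, v i = ∑ j, c j * (Φ j i : ℝ)

/-- the integer vectors -/
def phiV (q p q' p' : ℤ) (s : ℤ × ℤ × ℤ) : Fin 4 → ℤ :=
  ![-s.2.1 * p' - s.1 * p, s.2.1 * q' + s.1 * q, -s.2.2 * p' - s.2.1 * p, s.2.2 * q' + s.2.1 * q]

lemma cramer3 {a b c : ℤ × ℤ × ℤ} (h : det3 a b c ≠ 0) (y x z : ℝ) :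
    ∃ k : Fin 3 → ℝ, y = k 0 * a.1 + k 1 * b.1 + k 2 * c.1 ∧
      x = k 0 * a.2.1 + k 1 * b.2.1 + k 2 * c.2.1 ∧
      z = k 0 * a.2.2 + k 1 * b.2.2 + k 2 * c.2.2 := by
  obtain ⟨a1, a2, a3⟩ := a
  obtain ⟨b1, b2, b3⟩ := b
  obtain ⟨c1, c2, c3⟩ := c
  have h' : ((det3 (a1, a2, a3) (b1, b2, b3) (c1, c2, c3) : ℤ) : ℝ) ≠ 0 := by exact_mod_cast h
  simp only [det3] at h'
  push_cast at h'
  set D : ℝ := (a1 : ℝ) * (b2 * c3 - b3 * c2) - a2 * (b1 * c3 - b3 * c1) + a3 * (b1 * c2 - b2 * c1)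
    with hD
  refine ⟨![(y * (b2 * c3 - b3 * c2) - x * (b1 * c3 - b3 * c1) + z * (b1 * c2 - b2 * c1)) / D,
    (a1 * (x * c3 - z * c2) - a2 * (y * c3 - z * c1) + a3 * (y * c2 - x * c1)) / D,
    (a1 * (b2 * z - b3 * x) - a2 * (b1 * z - b3 * y) + a3 * (b1 * x - b2 * y)) / D], ?_, ?_, ?_⟩ <;>
  · simp
    field_simp
    rw [hD]
    ring

lemma phi_span {q p q' p' : ℤ} (hD : (p * q' - p' * q) ^ 2 = 1) {a b c : ℤ × ℤ × ℤ}
    (h : det3 a b c ≠ 0) (v : Fin 4 → ℝ)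
    (hv : q * v 0 + p * v 1 + q' * v 2 + p' * v 3 = 0) :
    ∃ k : Fin 3 → ℝ, ∀ i, v i = k 0 * phiV q p q' p' a i + k 1 * phiV q p q' p' b i
      + k 2 * phiV q p q' p' c i := by
  set D : ℝ := (p : ℝ) * q' - p' * q with hDd
  have hD' : D ^ 2 = 1 := by rw [hDd]; exact_mod_cast hD
  obtain ⟨k, h1, h2, h3⟩ := cramer3 h (-D * (v 0 * q' + v 1 * p')) (D * (v 0 * q + v 1 * p))
    (D * (v 2 * q + v 3 * p))
  refine ⟨k, fun i => ?_⟩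
  fin_cases i
  · simp [phiV]
    linear_combination (-(p' : ℝ)) * h2 - p * h1 - v 0 * hD' + D * v 0 * hDd
  · simp [phiV]
    linear_combination (q' : ℝ) * h2 + q * h1 - v 1 * hD' + D * v 1 * hDd
  · simp [phiV]
    linear_combination (-(p' : ℝ)) * h3 - p * h2 - v 2 * hD' + D * v 2 * hDd + D * p * hv
  · simp [phiV]
    linear_combination (q' : ℝ) * h3 + q * h2 - v 3 * hD' + D * v 3 * hDd - D * q * hv

lemma phi_ker (q p q' p' : ℤ) (s : ℤ × ℤ × ℤ) :
    q * phiV q p q' p' s 0 + p * phiV q p q' p' s 1 + q' * phiV q p q' p' s 2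
      + p' * phiV q p q' p' s 3 = 0 := by
  simp [phiV]; ring

/-- size estimates -/
lemma phi_size {α q p q' p' Y ρ ak : ℝ} (hα0 : 0 < α) (hα1 : α < 1) (hq : 1 ≤ q)
    (hq'0 : 0 ≤ q') (hq' : q' ≤ q)
    (hρ : 0 < ρ) (hY : 1 ≤ Y) (hρ1 : ρ ≤ 1) (hE : |α * q' - p'| ≤ 1 / q)
    (hak : α * q - p = -ak * (α * q' - p')) (hd : 2 * Y * |ak - α| ≤ ρ)
    {y x z : ℝ} (hy : |y| ≤ Y) (hx : |x - α * y| ≤ ρ) (hz : |z - α * x| ≤ ρ) :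
    |(-x * p' - y * p) + α * (x * q' + y * q)| ≤ 4 * (ρ / q) ∧
    |α * (-x * p' - y * p) + α ^ 2 * (x * q' + y * q) - (-z * p' - x * p) - α * (z * q' + x * q)|
      ≤ 4 * (ρ / q) ∧
    |α * (x * q' + y * q) - (z * q' + x * q)| ≤ 4 * (ρ * q) ∧
    |x * q' + y * q| ≤ 4 * (Y * q) := by
  have hq0 : 0 < q := by linarith
  have hxY : |x| ≤ 2 * Y := by
    calc |x| = |(x - α * y) + α * y| := by congr 1; ring
      _ ≤ |x - α * y| + |α * y| := abs_add_le _ _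
      _ = |x - α * y| + α * |y| := by rw [abs_mul, abs_of_pos hα0]
      _ ≤ 1 + 1 * Y := by gcongr; linarith
      _ ≤ 2 * Y := by linarith
  have key : ∀ u w : ℝ, |w| ≤ 2 * Y → |u - α * w| ≤ ρ → |u - ak * w| ≤ 2 * ρ := by
    intro u w hw hu
    calc |u - ak * w| = |(u - α * w) - (ak - α) * w| := by congr 1; ring
      _ ≤ |u - α * w| + |(ak - α) * w| := abs_sub _ _
      _ = |u - α * w| + |ak - α| * |w| := by rw [abs_mul]
      _ ≤ ρ + |ak - α| * (2 * Y) := by gcongr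
      _ ≤ 2 * ρ := by linarith
  have k1 := key x y (by linarith) hx
  have k2 := key z x hxY hz
  have L0e : (-x * p' - y * p) + α * (x * q' + y * q) = (α * q' - p') * (x - ak * y) := by
    linear_combination y * hak
  have Lce : (-z * p' - x * p) + α * (z * q' + x * q) = (α * q' - p') * (z - ak * x) := by
    linear_combination x * hak
  have L0 : |(-x * p' - y * p) + α * (x * q' + y * q)| ≤ 2 * (ρ / q) := by
    rw [L0e, abs_mul]
    calc _ ≤ (1 / q) * (2 * ρ) := by gcongr
      _ = _ := by ring
  have Lc : |(-z * p' - x * p) + α * (z * q' + x * q)| ≤ 2 * (ρ / q) := by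
    rw [Lce, abs_mul]
    calc _ ≤ (1 / q) * (2 * ρ) := by gcongr
      _ = _ := by ring
  have hρq : 0 < ρ / q := by positivity
  refine ⟨by linarith, ?_, ?_, ?_⟩
  · calc _ = |α * ((-x * p' - y * p) + α * (x * q' + y * q))
          - ((-z * p' - x * p) + α * (z * q' + x * q))| := by congr 1; ring
      _ ≤ |α * ((-x * p' - y * p) + α * (x * q' + y * q))|
          + |((-z * p' - x * p) + α * (z * q' + x * q))| := abs_sub _ _
      _ = α * |((-x * p' - y * p) + α * (x * q' + y * q))|
          + |((-z * p' - x * p) + α * (z * q' + x * q))| := by rw [abs_mul, abs_of_pos hα0]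
      _ ≤ 1 * (2 * (ρ / q)) + 2 * (ρ / q) := by gcongr
      _ = _ := by ring
  · calc _ = |(z - α * x) * q' + (x - α * y) * q| := by rw [← abs_neg]; congr 1; ring
      _ ≤ |(z - α * x) * q'| + |(x - α * y) * q| := abs_add_le _ _
      _ = |z - α * x| * q' + |x - α * y| * q := by
          rw [abs_mul, abs_mul, abs_of_nonneg hq'0, abs_of_pos hq0]
      _ ≤ ρ * q + ρ * q := by gcongr
      _ ≤ _ := by nlinarith
  · calc _ ≤ |x * q'| + |y * q| := abs_add_le _ _
      _ = |x| * q' + |y| * q := by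
          rw [abs_mul, abs_mul, abs_of_nonneg hq'0, abs_of_pos hq0]
      _ ≤ 2 * Y * q + Y * q := by gcongr
      _ ≤ _ := by nlinarith

end Blk


section Blk2

lemma block_one {α t q p q' p' ak T τ γ : ℝ} {qi pi qi' pi' : ℤ} (hα0 : 0 < α) (hα1 : α < 1)
    (hqi : q = qi) (hpi : p = pi) (hqi' : q' = qi') (hpi' : p' = pi')
    (hdet : (pi * qi' - pi' * qi) ^ 2 = 1)
    (hq : 1 ≤ q) (hq'0 : 0 ≤ q') (hq' : q' ≤ q) (hp0 : 0 ≤ p) (hp : p ≤ q) (hp0' : 0 ≤ p')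
    (hp' : p' ≤ q') (ht : 1 ≤ t) (hT : T = Real.log q) (hτ : τ = Real.log t)
    (hE : |α * q' - p'| ≤ 1 / q) (hak : α * q - p = -ak * (α * q' - p'))
    (hE0 : α * q - p ≠ 0) (hE1 : |α * q - p| ≤ 1)
    (hd : 2 * t ^ 40 * |ak - α| ≤ 1 / t ^ 14)
    (h54 : 54 * τ ≤ T) (hT2 : 2 ≤ T) (hγ : γ * T ≤ τ) (hτ6 : 6 ≤ τ)
    {a b c : ℤ × ℤ × ℤ} (hdet3 : det3 a b c ≠ 0)
    (ha : nuN α (t ^ 40) (1 / t ^ 14) a ≤ 1)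
    (hb : nuN α (t ^ 40) (1 / t ^ 14) b ≤ 1)
    (hc : nuN α (t ^ 40) (1 / t ^ 14) c ≤ 1) :
    ∃ μ Φ w, Blk α γ T μ Φ w := by
  have hq0 : 0 < q := by linarith
  have ht0 : 0 < t := by linarith
  set Y : ℝ := t ^ 40 with hY
  set ρ : ℝ := 1 / t ^ 14 with hρ
  have hY1 : 1 ≤ Y := one_le_pow₀ ht
  have hρ0 : 0 < ρ := by positivity
  have hρ1 : ρ ≤ 1 := by
    rw [hρ, div_le_one (by positivity)]; exact one_le_pow₀ ht
  have lY : Real.log Y = 40 * τ := by rw [hY, Real.log_pow, hτ]; norm_num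
  have lρ : Real.log ρ = -(14 * τ) := by
    rw [hρ, one_div, Real.log_inv, Real.log_pow, hτ]; norm_num
  have l4 : Real.log 4 = 2 * Real.log 2 := by
    rw [show (4 : ℝ) = 2 ^ 2 by norm_num, Real.log_pow]; norm_num
  have l4' : Real.log 4 < 1.4 := by rw [l4]; have := Real.log_two_lt_d9; linarith
  have l4'' : 0 < Real.log 4 := Real.log_pos (by norm_num)
  have w0 : Real.log (4 * (ρ / q)) = Real.log 4 - 14 * τ - T := by
    rw [Real.log_mul (by norm_num) (by positivity), Real.log_div (by positivity) (by positivity), lρ,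
      hT]; ring
  have w2 : Real.log (4 * (ρ * q)) = Real.log 4 - 14 * τ + T := by
    rw [Real.log_mul (by norm_num) (by positivity), Real.log_mul (by positivity) (by positivity), lρ,
      hT]; ring
  have w3 : Real.log (4 * (Y * q)) = Real.log 4 + 40 * τ + T := by
    rw [Real.log_mul (by norm_num) (by positivity), Real.log_mul (by positivity) (by positivity), lY,
      hT]; ring
  have hYp : 0 < Y := by linarith
  have hν : ∀ j : Fin 3, nuN α Y ρ (![a, b, c] j) ≤ 1 := by
    intro j; fin_cases j
    · exact ha
    · exact hb
    · exact hc
  refine ⟨![1, p / q, q' / q, p' / q], fun j => phiV qi pi qi' pi' (![a, b, c] j),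
    ![Real.log (4 * (ρ / q)), Real.log (4 * (ρ / q)), Real.log (4 * (ρ * q)),
      Real.log (4 * (Y * q))], ?_⟩
  constructor
  · rfl
  · show p / q ≠ α
    intro h
    apply hE0
    rw [← h]; field_simp; ring
  · show |p / q - α| ≤ _
    have : p / q - α = -((α * q - p) / q) := by field_simp; ring
    rw [this, abs_neg, abs_div, abs_of_pos hq0, Real.exp_neg, hT, Real.exp_log hq0, div_eq_mul_inv]
    calc |α * q - p| * q⁻¹ ≤ 1 * q⁻¹ := by gcongr
      _ = _ := one_mul _
  · intro i
    fin_cases i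
    · simp
    · show |p / q| ≤ 1
      rw [abs_of_nonneg (by positivity), div_le_one hq0]; exact hp
    · show |q' / q| ≤ 1
      rw [abs_of_nonneg (by positivity), div_le_one hq0]; exact hq'
    · show |p' / q| ≤ 1
      rw [abs_of_nonneg (by positivity), div_le_one hq0]; linarith
  · intro j i
    have h1 := (nuN_le hYp hρ0).mp (hν j)
    rw [one_mul, one_mul] at h1
    obtain ⟨s0, s1, s2, s3⟩ := phi_size hα0 hα1 hq hq'0 hq' hρ0 hY1 hρ1 hE hak hd h1.1 h1.2.1 h1.2.2
    generalize (![a, b, c] j) = s at *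
    fin_cases i
    · simp only [Fin.sum_univ_four, Gm, phiV]
      simp
      rw [Real.exp_log (by positivity), ← hqi, ← hpi, ← hqi', ← hpi']
      convert s0 using 2; ring
    · simp only [Fin.sum_univ_four, Gm, phiV]
      simp
      rw [Real.exp_log (by positivity), ← hqi, ← hpi, ← hqi', ← hpi']
      convert s1 using 2; ring
    · simp only [Fin.sum_univ_four, Gm, phiV]
      simp
      rw [Real.exp_log (by positivity), ← hqi, ← hqi']
      convert s2 using 2; ring
    · simp only [Fin.sum_univ_four, Gm, phiV]
      simp
      rw [Real.exp_log (by positivity), ← hqi, ← hqi']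
      convert s3 using 2
  · simp only [Fin.sum_univ_four]
    simp
    rw [w0, w2, w3]
    linarith
  · intro i
    fin_cases i
    · show |Real.log (4 * (ρ / q))| ≤ _
      rw [w0, abs_le]; constructor <;> linarith
    · show |Real.log (4 * (ρ / q))| ≤ _
      rw [w0, abs_le]; constructor <;> linarith
    · show |Real.log (4 * (ρ * q))| ≤ _
      rw [w2, abs_le]; constructor <;> linarith
    · show |Real.log (4 * (Y * q))| ≤ _
      rw [w3, abs_le]; constructor <;> linarith
  · intro j
    have h1 := phi_ker qi pi qi' pi' (![a, b, c] j)
    have h2 : (q : ℝ) * phiV qi pi qi' pi' (![a, b, c] j) 0 + p * phiV qi pi qi' pi' (![a, b, c] j) 1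
      + q' * phiV qi pi qi' pi' (![a, b, c] j) 2 + p' * phiV qi pi qi' pi' (![a, b, c] j) 3 = 0 := by
      rw [hqi, hpi, hqi', hpi']; exact_mod_cast h1
    simp only [Fin.sum_univ_four]
    show 1 * _ + p / q * _ + q' / q * _ + p' / q * _ = (0 : ℝ)
    field_simp
    linarith
  · intro v hv
    obtain ⟨k, hk⟩ := phi_span hdet hdet3 v (by
      simp only [Fin.sum_univ_four] at hv
      change 1 * _ + p / q * _ + q' / q * _ + p' / q * _ = (0 : ℝ) at hv
      field_simp at hv
      rw [← hqi, ← hpi, ← hqi', ← hpi']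
      linarith)
    refine ⟨k, fun i => ?_⟩
    rw [hk i, Fin.sum_univ_three]
    rfl

lemma block {x : ℕ → ℕ} (hx : ∀ n, 0 < x n) {A : ℕ} (hA : ∀ n, x n ≤ A) {M : ℕ}
    (hM : ∀ n ≥ 1, ∃ k, n ≤ k ∧ k ≤ M * n ∧ ∀ t < n, x (k + t) = x t)
    {α : ℝ} (hα0 : 0 < α) (hα1 : α < 1)
    (hα : Tendsto (fun ℓ => (cfP x ℓ : ℝ) / (cfQ x ℓ : ℝ)) atTop (𝓝 α))
    (hG : ∃ E t0 : ℕ, 1 ≤ t0 ∧ ∀ T0 : ℕ, t0 ≤ T0 → ∃ t : ℕ, T0 ≤ t ∧ t ≤ T0 ^ E ∧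
      ∃ a b c : ℤ × ℤ × ℤ, det3 a b c ≠ 0 ∧ nuN α ((t : ℝ) ^ 40) (1 / (t : ℝ) ^ 14) a ≤ 1 ∧
        nuN α ((t : ℝ) ^ 40) (1 / (t : ℝ) ^ 14) b ≤ 1 ∧
        nuN α ((t : ℝ) ^ 40) (1 / (t : ℝ) ^ 14) c ≤ 1) :
    ∃ γ Λ : ℝ, ∃ N0 : ℕ, 0 < γ ∧ γ ≤ 1 ∧ 1 ≤ Λ ∧ 1 ≤ N0 ∧ ∀ n : ℕ, N0 ≤ n →
      ∃ T μ Φ a, (n : ℝ) ≤ T ∧ T ≤ Λ * n ∧ Blk α γ T μ Φ a := by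
  obtain ⟨E, t0, ht01, hG⟩ := hG
  set ε : ℝ := 1 / (108 * (E + 1)) with hε
  have hε0 : 0 < ε := by positivity
  have hε1 : ε * (108 * (E + 1)) = 1 := by rw [hε]; field_simp
  have hEn : (0 : ℝ) ≤ E := Nat.cast_nonneg _
  have hεl : ε ≤ 1 := by nlinarith
  set Λ : ℝ := 1 + 4 * M * Real.log (A + 1) with hΛ
  have hlA : 0 ≤ Real.log ((A : ℝ) + 1) := Real.log_nonneg (by
    have : (0 : ℝ) ≤ A := Nat.cast_nonneg _
    linarith)
  have hΛ1 : 1 ≤ Λ := by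
    have : 0 ≤ 4 * M * Real.log ((A : ℝ) + 1) := by positivity
    linarith
  have hΛ0 : 0 < Λ := by linarith
  refine ⟨ε / Λ, Λ, ⌈((t0 : ℝ) + 6) / ε⌉₊ + 6, by positivity, ?_, hΛ1, by omega, ?_⟩
  · rw [div_le_one hΛ0]; linarith
  intro n hn
  have hn6 : (6 : ℝ) ≤ n := by exact_mod_cast (by omega : 6 ≤ n)
  have hεn : (t0 : ℝ) + 6 ≤ ε * n := by
    have h1 : ((t0 : ℝ) + 6) / ε ≤ n := (Nat.le_ceil _).trans (by exact_mod_cast (le_trans (Nat.le_add_right _ 6) hn))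
    rw [div_le_iff₀ hε0] at h1
    linarith
  have ht0R : (1 : ℝ) ≤ t0 := by exact_mod_cast ht01
  set T0 : ℕ := ⌈Real.exp (ε * n)⌉₊ with hT0
  have hT0a : Real.exp (ε * n) ≤ T0 := Nat.le_ceil _
  have hT0b : (T0 : ℝ) ≤ Real.exp (2 * (ε * n)) := by
    have h1 : (T0 : ℝ) < Real.exp (ε * n) + 1 := Nat.ceil_lt_add_one (Real.exp_pos _).le
    have h2 : 2 ≤ Real.exp (ε * n) := by
      have := Real.add_one_le_exp (ε * n)
      linarith
    rw [two_mul, Real.exp_add]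
    nlinarith
  obtain ⟨t, htT, htE, a, b, c, hdet, ha, hb, hc⟩ := hG T0 (by
    have h1 : (t0 : ℝ) ≤ T0 := by
      have := Real.add_one_le_exp (ε * n)
      linarith
    exact_mod_cast h1)
  have htTR : (T0 : ℝ) ≤ t := by exact_mod_cast htT
  have ht1 : (1 : ℝ) ≤ t := by
    have := Real.add_one_le_exp (ε * n)
    linarith
  have ht0p : (0 : ℝ) < t := by linarith
  set τ := Real.log t with hτ
  have hτl : ε * n ≤ τ := by
    rw [hτ, Real.le_log_iff_exp_le ht0p]; linarith
  have hτu : 54 * τ ≤ n := by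
    have h1 : (t : ℝ) ≤ (T0 : ℝ) ^ E := by exact_mod_cast htE
    have h2 : (t : ℝ) ≤ Real.exp (E * (2 * (ε * n))) := by
      rw [Real.exp_nat_mul]
      exact h1.trans (by gcongr)
    have h3 : τ ≤ E * (2 * (ε * n)) := by
      rw [hτ, Real.log_le_iff_le_exp ht0p]; exact h2
    have h4 : 108 * (ε * E) ≤ 1 := by nlinarith
    have h5 : 108 * (ε * E) * n ≤ 1 * n := by gcongr
    nlinarith
  obtain ⟨k1, hk1, hk2, hk3⟩ := hM (4 * n) (by
    have : 6 ≤ n := by omega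
    omega)
  obtain ⟨k, rfl⟩ : ∃ k, k1 = k + 1 := ⟨k1 - 1, by omega⟩
  have htail := cfE_tail hx hα k (4 * n) (by omega) hk3
  have hl2 := Real.log_two_gt_d9
  have hq4 : Real.exp n ≤ cfQ x (4 * n) := by
    have h1 : (2 : ℝ) ^ (2 * n) ≤ cfQ x (4 * n) := by
      have := cfQ_even hx (2 * n)
      rw [show 2 * (2 * n) = 4 * n by ring] at this
      exact_mod_cast this
    refine le_trans ?_ h1
    rw [← Real.rpow_natCast, Real.rpow_def_of_pos (by norm_num)]
    apply Real.exp_le_exp.mpr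
    push_cast
    nlinarith
  have hqk : Real.exp n ≤ cfQ x (k + 1) := hq4.trans (by exact_mod_cast cfQ_mono hx hk1)
  have hqk0 : (0 : ℝ) < cfQ x (k + 1) := (Real.exp_pos _).trans_le hqk
  have hq1 : (1 : ℝ) ≤ cfQ x (k + 1) := by exact_mod_cast cfQ_pos hx (k + 1)
  set T := Real.log (cfQ x (k + 1)) with hT
  have hnT : (n : ℝ) ≤ T := by rw [hT, Real.le_log_iff_exp_le hqk0]; exact hqk
  have hTn : T ≤ Λ * n := by
    have h1 : (cfQ x (k + 1) : ℝ) ≤ ((A : ℝ) + 1) ^ (k + 1) := by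
      exact_mod_cast cfQ_upper hx hA (k + 1)
    have h2 : T ≤ ((k + 1 : ℕ) : ℝ) * Real.log ((A : ℝ) + 1) := by
      rw [← Real.log_pow]
      exact Real.log_le_log hqk0 h1
    have h3 : ((k + 1 : ℕ) : ℝ) ≤ M * (4 * n) := by exact_mod_cast hk2
    have h4 : ((k + 1 : ℕ) : ℝ) * Real.log ((A : ℝ) + 1) ≤ M * (4 * n) * Real.log ((A : ℝ) + 1) := by
      gcongr
    have : Λ * n = n + M * (4 * n) * Real.log ((A : ℝ) + 1) := by rw [hΛ]; ring
    linarith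
  have hEk := cfE_ge hx hα k
  have hEk1 := cfE_ge hx hα (k + 1)
  have hEk0 : cfE x α k ≠ 0 := by
    intro h
    rw [h, abs_zero] at hEk
    have : (0 : ℝ) < 1 / (2 * cfQ x (k + 1)) := by positivity
    linarith
  have hq2 : (1 : ℝ) ≤ cfQ x (k + 1 + 1) := by exact_mod_cast cfQ_pos hx (k + 1 + 1)
  have hEk10 : cfE x α (k + 1) ≠ 0 := by
    intro h
    rw [h, abs_zero] at hEk1
    have : (0 : ℝ) < 1 / (2 * cfQ x (k + 1 + 1)) := by positivity
    linarith
  set ak := -cfE x α (k + 1) / cfE x α k with hak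
  have hd : 2 * (t : ℝ) ^ 40 * |ak - α| ≤ 1 / (t : ℝ) ^ 14 := by
    have h1 : |ak - α| ≤ 3 / Real.exp n ^ 2 := htail.trans (by gcongr)
    rw [le_div_iff₀ (by positivity)]
    calc 2 * (t : ℝ) ^ 40 * |ak - α| * (t : ℝ) ^ 14
        ≤ 2 * (t : ℝ) ^ 40 * (3 / Real.exp n ^ 2) * (t : ℝ) ^ 14 := by gcongr
      _ = 6 * (t : ℝ) ^ 54 / Real.exp n ^ 2 := by ring
      _ ≤ 1 := by
        rw [div_le_one (by positivity)]
        have h2 : (t : ℝ) ^ 54 ≤ Real.exp n := by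
          rw [← Real.log_le_iff_le_exp (by positivity), Real.log_pow]
          push_cast
          linarith
        have h3 : 6 ≤ Real.exp n := by
          have := Real.add_one_le_exp (n : ℝ)
          linarith
        rw [sq]
        gcongr
  have hdet2 : ((cfP x (k + 1) : ℤ) * cfQ x k - cfP x k * cfQ x (k + 1)) ^ 2 = 1 := by
    have := cf_det_real x k
    have h2 : ((cfP x (k + 1) : ℤ) * cfQ x k - cfP x k * cfQ x (k + 1)) = (-1) ^ k := by
      exact_mod_cast this
    rw [h2, ← pow_mul, mul_comm, pow_mul]; simp
  have hPQ : ∀ i, (cfP x i : ℝ) ≤ cfQ x i := fun i => by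
    exact_mod_cast (Nat.le_mul_of_pos_left _ (hx 0)).trans (cfP_le_cfQ hx i)
  obtain ⟨μ, Φ, w, hB⟩ := block_one (α := α) (t := t) (q := cfQ x (k + 1)) (p := cfP x (k + 1))
    (q' := cfQ x k) (p' := cfP x k) (ak := ak) (T := T) (τ := τ) (γ := ε / Λ)
    (qi := cfQ x (k + 1)) (pi := cfP x (k + 1)) (qi' := cfQ x k) (pi' := cfP x k)
    hα0 hα1 (by simp) (by simp) (by simp) (by simp) hdet2 hq1 (by positivity)
    (by exact_mod_cast cfQ_mono_step hx k) (by positivity) (hPQ _)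
    (by positivity) (hPQ _) ht1 hT hτ (cfE_le' hx hα k)
    (by
      have : cfE x α (k + 1) = -ak * cfE x α k := by rw [hak]; field_simp
      exact this) hEk10
    (by
      have := cfE_le' hx hα (k + 1)
      refine this.trans ?_
      rw [div_le_one (by linarith)]; exact hq2)
    hd (by linarith) (by linarith)
    (by
      rw [div_mul_eq_mul_div, div_le_iff₀ hΛ0]
      calc ε * T ≤ ε * (Λ * n) := by gcongr
        _ = (ε * n) * Λ := by ring
        _ ≤ τ * Λ := by gcongr) (by linarith) hdet ha hb hc
  exact ⟨T, μ, Φ, w, hnT, hTn, hB⟩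

end Blk2


section NV

open MvPolynomial

lemma prod_monomials {σ ι R : Type*} [CommSemiring R] (s : Finset ι) (f : ι → σ →₀ ℕ) (a : ι → R) :
    ∏ i ∈ s, monomial (f i) (a i) = monomial (∑ i ∈ s, f i) (∏ i ∈ s, a i) := by
  classical
  induction s using Finset.induction_on with
  | empty => simp
  | insert i s hi ih =>
    rw [Finset.prod_insert hi, Finset.sum_insert hi, Finset.prod_insert hi, ih, monomial_mul]

lemma coeff_prod_shift {m : ℕ} (y : Fin m → ℝ) (J : Fin m → ℕ) (I : Fin m →₀ ℕ) :
    coeff I (∏ h, (X h + C (y h) : MvPolynomial (Fin m) ℝ) ^ J h)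
      = ∏ h, (((J h).choose (I h) : ℝ) * y h ^ (J h - I h)) := by
  classical
  have h1 : ∀ h, (X h + C (y h) : MvPolynomial (Fin m) ℝ) ^ J h
      = ∑ k ∈ Finset.range (J h + 1), monomial (Finsupp.single h k)
        (((J h).choose k : ℝ) * y h ^ (J h - k)) := by
    intro h
    rw [add_pow]
    refine Finset.sum_congr rfl fun k _ => ?_
    rw [X_pow_eq_monomial, ← C_pow, ← map_natCast (C (σ := Fin m) (R := ℝ)), mul_comm,
      mul_comm (monomial _ _), C_mul_monomial, C_mul_monomial, mul_one]
  simp_rw [h1]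
  rw [Finset.prod_univ_sum, coeff_sum]
  have h2 : ∀ K : Fin m → ℕ, ∏ h, (monomial (Finsupp.single h (K h))
        (((J h).choose (K h) : ℝ) * y h ^ (J h - K h)))
      = monomial (Finsupp.equivFunOnFinite.symm K)
        (∏ h, (((J h).choose (K h) : ℝ) * y h ^ (J h - K h))) := by
    intro K
    rw [prod_monomials]
    congr 1
    rw [← Finsupp.univ_sum_single (Finsupp.equivFunOnFinite.symm K)]
    simp
  simp_rw [h2, coeff_monomial]
  by_cases hI : ∀ h, I h ≤ J h
  · rw [Finset.sum_eq_single (I : Fin m → ℕ)]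
    · rw [if_pos (by ext; simp)]
    · intro K _ hK
      rw [if_neg]
      intro h
      apply hK
      rw [← h]; ext; simp
    · intro h
      exfalso; apply h
      rw [Fintype.mem_piFinset]
      intro h; rw [Finset.mem_range]; have := hI h; omega
  · push Not at hI
    obtain ⟨h, hh⟩ := hI
    rw [Finset.prod_eq_zero (Finset.mem_univ h) (by rw [Nat.choose_eq_zero_of_lt hh]; simp)]
    refine Finset.sum_eq_zero fun K hK => ?_
    rw [if_neg]
    rintro rfl
    rw [Fintype.mem_piFinset] at hK
    have := hK h
    simp at this hh
    omega

lemma coeff_shift {m : ℕ} (q : MvPolynomial (Fin m) ℝ) (y : Fin m → ℝ) (I : Fin m →₀ ℕ) :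
    coeff I (aeval (fun h => (X h + C (y h) : MvPolynomial (Fin m) ℝ)) q)
      = ∑ J ∈ q.support, coeff J q * ∏ h, (((J h).choose (I h) : ℝ) * y h ^ (J h - I h)) := by
  classical
  rw [aeval_eq_eval₂Hom, coe_eval₂Hom, eval₂_eq', coeff_sum]
  refine Finset.sum_congr rfl fun J _ => ?_
  rw [algebraMap_eq, coeff_C_mul, coeff_prod_shift]

lemma pow_choose (e : ℕ) : ∃ c : ℕ → ℝ, ∀ n : ℕ,
    (n : ℝ) ^ e = ∑ k ∈ Finset.range (e + 1), c k * (n.choose k : ℝ) := by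
  induction e with
  | zero => exact ⟨fun _ => 1, fun n => by simp⟩
  | succ e ih =>
    obtain ⟨c, hc⟩ := ih
    refine ⟨fun k => (if k = 0 then 0 else c (k - 1) * k) + (if k = e + 1 then 0 else c k * k),
      fun n => ?_⟩
    have key : ∀ k, (n : ℝ) * (n.choose k : ℝ)
        = (k + 1) * (n.choose (k + 1) : ℝ) + k * (n.choose k : ℝ) := by
      intro k
      have h1 := Nat.choose_succ_right_eq n k
      rcases le_or_gt k n with hk | hk
      · have h2 : ((n.choose (k + 1) : ℝ)) * (k + 1) = n.choose k * ((n : ℝ) - k) := by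
          rw [← Nat.cast_sub hk]; exact_mod_cast h1
        linarith
      · rw [Nat.choose_eq_zero_of_lt hk, Nat.choose_eq_zero_of_lt (by omega)]; simp
    rw [pow_succ, hc, Finset.sum_mul]
    have e1 : ∀ k ∈ Finset.range (e + 1), c k * (n.choose k : ℝ) * n
        = c k * (k + 1) * (n.choose (k + 1) : ℝ) + c k * k * (n.choose k : ℝ) := by
      intro k _
      linear_combination c k * key k
    rw [Finset.sum_congr rfl e1, Finset.sum_add_distrib]
    simp_rw [add_mul]
    rw [Finset.sum_add_distrib]
    congr 1
    · rw [Finset.sum_range_succ' _ (e + 1)]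
      simp
    · rw [Finset.sum_range_succ _ (e + 1)]
      simp only [if_true, zero_mul, add_zero]
      refine Finset.sum_congr rfl fun k hk => ?_
      rw [Finset.mem_range] at hk
      rw [if_neg (by omega)]

lemma functional_zero {m : ℕ} (q : MvPolynomial (Fin m) ℝ) (y : Fin m → ℝ) (D : Fin m → ℕ)
    (hc : ∀ I : Fin m →₀ ℕ, (∀ h, I h ≤ D h) →
      coeff I (aeval (fun h => (X h + C (y h) : MvPolynomial (Fin m) ℝ)) q) = 0)
    (f : MvPolynomial (Fin m) ℝ) (hf : ∀ h, degreeOf h f ≤ D h) :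
    ∑ J ∈ q.support, coeff J q * (∏ h, y h ^ J h) * eval (fun h => (J h : ℝ)) f = 0 := by
  classical
  have h1 : ∀ I : Fin m → ℕ, (∀ h, I h ≤ D h) →
      ∑ J ∈ q.support, coeff J q * (∏ h, y h ^ J h) * ∏ h, ((J h).choose (I h) : ℝ) = 0 := by
    intro I hI
    have := hc (Finsupp.equivFunOnFinite.symm I) (by simpa using hI)
    rw [coeff_shift] at this
    rw [← mul_zero (∏ h, y h ^ I h), ← this, Finset.mul_sum]
    refine Finset.sum_congr rfl fun J _ => ?_
    have e : ∀ h, y h ^ J h * ((J h).choose (I h) : ℝ)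
        = y h ^ I h * (((J h).choose (I h) : ℝ) * y h ^ (J h - I h)) := by
      intro h
      rcases le_or_gt (I h) (J h) with hk | hk
      · conv_lhs => rw [← Nat.add_sub_cancel' hk, pow_add, Nat.add_sub_cancel' hk]
        ring
      · rw [Nat.choose_eq_zero_of_lt hk]; simp
    rw [mul_assoc, ← Finset.prod_mul_distrib, Finset.prod_congr rfl (fun h _ => e h),
      Finset.prod_mul_distrib]
    simp only [Finsupp.equivFunOnFinite_symm_apply_apply]
    ring
  have h2 : ∀ s ∈ f.support,
      ∑ J ∈ q.support, coeff J q * (∏ h, y h ^ J h) * ∏ h, (J h : ℝ) ^ s h = 0 := by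
    intro s hs
    have hsD : ∀ h, s h ≤ D h := fun h => (monomial_le_degreeOf h hs).trans (hf h)
    choose c hcc using fun h => pow_choose (s h)
    simp_rw [hcc, Finset.prod_univ_sum, Finset.mul_sum]
    rw [Finset.sum_comm]
    refine Finset.sum_eq_zero fun I hI => ?_
    rw [Fintype.mem_piFinset] at hI
    rw [← mul_zero (∏ h, c h (I h)), ← h1 I (fun h => by
      have := Finset.mem_range.mp (hI h)
      have := hsD h
      omega), Finset.mul_sum]
    refine Finset.sum_congr rfl fun J _ => ?_
    rw [Finset.prod_mul_distrib]; ring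
  simp_rw [eval_eq', Finset.mul_sum]
  rw [Finset.sum_comm]
  refine Finset.sum_eq_zero fun s hs => ?_
  rw [← mul_zero (coeff s f), ← h2 s hs, Finset.mul_sum]
  refine Finset.sum_congr rfl fun J _ => ?_
  ring

end NV


section NV2

open MvPolynomial

lemma ultra_lim {ι : Type*} (l : Ultrafilter ι) (f : ι → ℝ) (B : ℝ) (h : ∀ᶠ s in l, |f s| ≤ B) :
    ∃ c, Tendsto f l (𝓝 c) ∧ |c| ≤ B := by
  have hK : IsCompact (Set.Icc (-B) B) := isCompact_Icc
  obtain ⟨c, hc, hl⟩ := hK.ultrafilter_le_nhds (l.map f) (by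
    rw [Filter.le_principal_iff]
    show ∀ᶠ s in l, f s ∈ Set.Icc (-B) B
    filter_upwards [h] with s hs using abs_le.mp hs)
  exact ⟨c, hl, abs_le.mpr hc⟩

lemma nonvanish {ι : Type*} (l : Ultrafilter ι) {m : ℕ} (q : MvPolynomial (Fin m) ℝ) (hq : q ≠ 0)
    (r : Fin m → ℕ) (hr : ∀ h, degreeOf h q ≤ r h) (y : ι → Fin m → ℝ)
    (hy0 : ∀ h, ∀ᶠ s in l, y s h ≠ 0) (hy : ∀ h, Tendsto (fun s => y s h) l (𝓝 0))
    (hc : ∀ᶠ s in l, ∀ I : Fin m →₀ ℕ, (∀ h, I h ≤ ∑ i ∈ Finset.univ.filter (h < ·), r i) →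
      coeff I (aeval (fun h => (X h + C (y s h) : MvPolynomial (Fin m) ℝ)) q) = 0) : False := by
  classical
  have hne : ∀ᶠ s in l, ∀ h, y s h ≠ 0 := eventually_all.mpr hy0
  -- dominant monomial
  obtain ⟨J1, hJ1, hdom⟩ : ∃ J1 ∈ q.support, ∀ᶠ s in l, ∀ J ∈ q.support,
      |∏ h, y s h ^ J h| ≤ |∏ h, y s h ^ J1 h| := by
    have := (Ultrafilter.eventually_exists_mem_iff (f := l) (is := (q.support : Set (Fin m →₀ ℕ)))
      (P := fun J1 s => ∀ J ∈ q.support, |∏ h, y s h ^ J h| ≤ |∏ h, y s h ^ J1 h|)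
      (Finset.finite_toSet _)).mp (Eventually.of_forall fun s => by
        obtain ⟨J1, h1, h2⟩ := Finset.exists_max_image q.support (fun J => |∏ h, y s h ^ J h|)
          (by rwa [Finset.nonempty_iff_ne_empty, Ne, support_eq_empty])
        exact ⟨J1, h1, h2⟩)
    simpa using this
  set R : (Fin m →₀ ℕ) → ι → ℝ := fun J s => (∏ h, y s h ^ J h) / ∏ h, y s h ^ J1 h with hR
  have hRlim : ∀ J, ∃ c, J ∈ q.support → Tendsto (R J) l (𝓝 c) := by
    intro J
    by_cases hJ : J ∈ q.support
    · obtain ⟨c, hc, _⟩ := ultra_lim l (R J) 1 (by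
        filter_upwards [hdom, hne] with s hs hn
        have : (∏ h, y s h ^ J1 h) ≠ 0 := Finset.prod_ne_zero_iff.mpr fun h _ => pow_ne_zero _ (hn h)
        rw [hR]
        simp only
        rw [abs_div, div_le_one (abs_pos.mpr this)]
        exact hs J hJ)
      exact ⟨c, fun _ => hc⟩
    · exact ⟨0, fun h => absurd h hJ⟩
  choose ρ hρ using hRlim
  have hρ1 : ρ J1 = 1 := by
    refine tendsto_nhds_unique (hρ J1 hJ1) (tendsto_const_nhds.congr' ?_)
    filter_upwards [hne] with s hn
    have : (∏ h, y s h ^ J1 h) ≠ 0 := Finset.prod_ne_zero_iff.mpr fun h _ => pow_ne_zero _ (hn h)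
    exact (div_self this).symm
  -- the space on which the logarithmic form converges
  let lam : ι → Fin m → ℝ := fun s h => Real.log |y s h|
  let W : Submodule ℝ (Fin m → ℝ) :=
    { carrier := {w | ∃ c, Tendsto (fun s => ∑ h, lam s h * w h) l (𝓝 c)}
      add_mem' := by
        rintro a b ⟨c, hc⟩ ⟨d, hd⟩
        refine ⟨c + d, (hc.add hd).congr fun s => ?_⟩
        rw [← Finset.sum_add_distrib]
        refine Finset.sum_congr rfl fun h _ => ?_
        simp only [Pi.add_apply]; ring
      zero_mem' := ⟨0, by simp⟩
      smul_mem' := by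
        rintro k a ⟨c, hc⟩
        refine ⟨k * c, (hc.const_mul k).congr fun s => ?_⟩
        rw [Finset.mul_sum]
        refine Finset.sum_congr rfl fun h _ => ?_
        simp only [Pi.smul_apply, smul_eq_mul]; ring }
  have hWS : ∀ J ∈ q.support, ρ J ≠ 0 → (fun h => (J h : ℝ) - J1 h) ∈ W := by
    intro J hJ hJ0
    refine ⟨Real.log |ρ J|, ?_⟩
    have h1 : Tendsto (fun s => Real.log |R J s|) l (𝓝 (Real.log |ρ J|)) :=
      ((hρ J hJ).abs).log (abs_ne_zero.mpr hJ0)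
    refine h1.congr' ?_
    filter_upwards [hne] with s hn
    have e : ∀ K : Fin m →₀ ℕ, (∏ h, y s h ^ K h) ≠ 0 := fun K =>
      Finset.prod_ne_zero_iff.mpr fun h _ => pow_ne_zero _ (hn h)
    have e2 : ∀ K : Fin m →₀ ℕ, Real.log |∏ h, y s h ^ K h| = ∑ h, lam s h * K h := by
      intro K
      rw [Real.log_abs, Real.log_prod (fun h _ => pow_ne_zero _ (hn h))]
      refine Finset.sum_congr rfl fun h _ => ?_
      rw [Real.log_pow, ← Real.log_abs (y s h)]
      simp only [lam]; ring
    rw [hR]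
    simp only
    rw [abs_div, Real.log_div (abs_ne_zero.mpr (e J)) (abs_ne_zero.mpr (e J1)), e2, e2,
      ← Finset.sum_sub_distrib]
    refine Finset.sum_congr rfl fun h _ => ?_
    ring
  have hWe : ∀ i, (Pi.single i 1 : Fin m → ℝ) ∉ W := by
    rintro i ⟨c, hc⟩
    have h1 : Tendsto (fun s => lam s i) l (𝓝 c) := by
      refine hc.congr fun s => ?_
      rw [Finset.sum_eq_single i]
      · simp
      · intro b _ hb; simp [Pi.single_eq_of_ne hb]
      · simp
    have h2 : Tendsto (fun s => lam s i) l atBot := by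
      have h3 : Tendsto (fun s => |y s i|) l (𝓝[>] 0) := by
        rw [tendsto_nhdsWithin_iff]
        refine ⟨by simpa using (hy i).abs, ?_⟩
        filter_upwards [hy0 i] with s hs using abs_pos.mpr hs
      exact Real.tendsto_log_nhdsGT_zero.comp h3
    exact not_tendsto_nhds_of_tendsto_atBot h2 c h1
  have hτ : ∀ i, ∃ f : (Fin m → ℝ) →ₗ[ℝ] ℝ, f (Pi.single i 1) = 1 ∧ ∀ w ∈ W, f w = 0 := by
    intro i
    obtain ⟨f, hf, hfW⟩ := Submodule.exists_le_ker_of_notMem (hWe i)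
    refine ⟨(f (Pi.single i 1))⁻¹ • f, by simp [hf], fun w hw => ?_⟩
    have : f w = 0 := hfW hw
    simp [this]
  choose f hf1 hfW using hτ
  have hfexp : ∀ i (w : Fin m → ℝ), f i w = ∑ h, w h * f i (Pi.single h 1) := by
    intro i w
    conv_lhs => rw [← Finset.univ_sum_single w]
    rw [map_sum]
    refine Finset.sum_congr rfl fun h _ => ?_
    have : (Pi.single h (w h) : Fin m → ℝ) = w h • Pi.single h 1 := by
      ext j; by_cases hj : j = h
      · subst hj; simp
      · simp [Pi.single_eq_of_ne hj]
    rw [this, map_smul, smul_eq_mul]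
  -- the polynomial
  let fac : Fin m → ℕ → MvPolynomial (Fin m) ℝ := fun i a =>
    (∑ h ∈ Finset.univ.filter (· < i), C (f i (Pi.single h 1)) * (X h - C (J1 h : ℝ)))
      + C ((a : ℝ) - J1 i)
  let F : MvPolynomial (Fin m) ℝ := ∏ i, ∏ a ∈ (Finset.range (r i + 1)).erase (J1 i), fac i a
  have hJr : ∀ J ∈ q.support, ∀ i, J i ≤ r i := fun J hJ i => (monomial_le_degreeOf i hJ).trans (hr i)
  have hfacdeg : ∀ i a h, degreeOf h (fac i a) ≤ if h < i then 1 else 0 := by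
    intro i a h
    refine (degreeOf_add_le _ _ _).trans (max_le ?_ (by rw [degreeOf_C]; exact Nat.zero_le _))
    refine (degreeOf_sum_le _ _ _).trans (Finset.sup_le fun j hj => ?_)
    refine (degreeOf_C_mul_le _ _ _).trans ?_
    refine (degreeOf_sub_le _ _ _).trans (max_le ?_ (by rw [degreeOf_C]; exact Nat.zero_le _))
    rw [degreeOf_X]
    by_cases hji : h = j
    · subst hji
      rw [if_pos rfl, if_pos (Finset.mem_filter.mp hj).2]
    · rw [if_neg hji]; exact Nat.zero_le _
  have hFdeg : ∀ h, degreeOf h F ≤ ∑ i ∈ Finset.univ.filter (h < ·), r i := by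
    intro h
    refine (degreeOf_prod_le _ _ _).trans ?_
    rw [Finset.sum_filter]
    refine Finset.sum_le_sum fun i _ => ?_
    refine (degreeOf_prod_le _ _ _).trans ?_
    refine (Finset.sum_le_sum fun a _ => hfacdeg i a h).trans ?_
    rw [Finset.sum_const, Finset.card_erase_of_mem (Finset.mem_range.mpr (by
      have := hJr J1 hJ1 i
      omega)), Finset.card_range]
    split_ifs <;> simp
  have hfacev : ∀ i a (J : Fin m →₀ ℕ), eval (fun h => (J h : ℝ)) (fac i a)
      = (∑ h ∈ Finset.univ.filter (· < i), f i (Pi.single h 1) * ((J h : ℝ) - J1 h))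
        + ((a : ℝ) - J1 i) := by
    intro i a J
    simp [fac, map_sum]
  have hF1 : eval (fun h => (J1 h : ℝ)) F ≠ 0 := by
    simp only [F, map_prod]
    refine Finset.prod_ne_zero_iff.mpr fun i _ => Finset.prod_ne_zero_iff.mpr fun a ha => ?_
    rw [hfacev]
    simp only [sub_self, mul_zero, Finset.sum_const_zero, zero_add]
    rw [sub_ne_zero]
    exact_mod_cast (Finset.mem_erase.mp ha).1
  have hFS : ∀ J ∈ q.support, ρ J ≠ 0 → J ≠ J1 → eval (fun h => (J h : ℝ)) F = 0 := by
    intro J hJ hJ0 hJne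
    have hex : (Finset.univ.filter fun i => J i ≠ J1 i).Nonempty := by
      by_contra hcon
      rw [Finset.not_nonempty_iff_eq_empty, Finset.filter_eq_empty_iff] at hcon
      apply hJne
      ext i
      have := hcon (Finset.mem_univ i)
      simpa using this
    obtain ⟨i, hi, hmax⟩ := Finset.exists_maximal hex
    have hi' : J i ≠ J1 i := (Finset.mem_filter.mp hi).2
    have hgt : ∀ h, i < h → J h = J1 h := by
      intro h hh
      by_contra hcon
      exact absurd (hmax (Finset.mem_filter.mpr ⟨Finset.mem_univ h, hcon⟩) hh.le) (not_le.mpr hh)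
    simp only [F, map_prod]
    refine Finset.prod_eq_zero (Finset.mem_univ i) (Finset.prod_eq_zero (i := J i) ?_ ?_)
    · rw [Finset.mem_erase, Finset.mem_range]
      exact ⟨hi', by have := hJr J hJ i; omega⟩
    · rw [hfacev]
      have h1 := hfW i _ (hWS J hJ hJ0)
      rw [hfexp, ← Finset.sum_filter_add_sum_filter_not _ (· < i)] at h1
      have h2 : ∑ h ∈ Finset.univ.filter (fun h => ¬ h < i), ((J h : ℝ) - J1 h) * f i (Pi.single h 1)
          = (J i : ℝ) - J1 i := by
        rw [Finset.sum_eq_single i]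
        · rw [hf1, mul_one]
        · intro h hh hne
          have : i < h := lt_of_le_of_ne (not_lt.mp (Finset.mem_filter.mp hh).2) (Ne.symm hne)
          rw [hgt h this]; simp
        · intro h; exfalso; apply h; simp
      rw [h2] at h1
      rw [← h1]
      congr 1
      refine Finset.sum_congr rfl fun h _ => mul_comm _ _
  -- conclusion
  have hlim : Tendsto (fun s => ∑ J ∈ q.support, coeff J q * R J s * eval (fun h => (J h : ℝ)) F) l
      (𝓝 (∑ J ∈ q.support, coeff J q * ρ J * eval (fun h => (J h : ℝ)) F)) := by
    refine tendsto_finsetSum _ fun J hJ => ?_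
    exact ((hρ J hJ).const_mul _).mul_const _
  have hz : ∀ᶠ s in l, (0 : ℝ) = ∑ J ∈ q.support, coeff J q * R J s * eval (fun h => (J h : ℝ)) F := by
    filter_upwards [hc, hne] with s hs hn
    have h1 := functional_zero q (y s) _ hs F hFdeg
    rw [← zero_div (∏ h, y s h ^ J1 h), ← h1, Finset.sum_div]
    refine Finset.sum_congr rfl fun J _ => ?_
    simp only [hR]; ring
  have hlim0 := tendsto_nhds_unique (tendsto_const_nhds.congr' hz) hlim
  rw [Finset.sum_eq_single J1] at hlim0
  · rw [hρ1, mul_one] at hlim0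
    exact (mul_ne_zero (mem_support_iff.mp hJ1) hF1) hlim0.symm
  · intro J hJ hJne
    by_cases h0 : ρ J = 0
    · rw [h0]; simp
    · rw [hFS J hJ h0 hJne, mul_zero]
  · intro h; exact absurd hJ1 h

end NV2


section Chern

lemma exp_quad {x : ℝ} (hx : |x| ≤ 1) : Real.exp x ≤ 1 + x + x ^ 2 := by
  have := Real.abs_exp_sub_one_sub_id_le hx
  have := (abs_le.mp this).2
  linarith

lemma simplex_sym (n : ℕ) (i k : Fin 4) :
    ∑ j ∈ Finset.piAntidiag (Finset.univ : Finset (Fin 4)) n, ((j i : ℕ) : ℝ)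
      = ∑ j ∈ Finset.piAntidiag (Finset.univ : Finset (Fin 4)) n, ((j k : ℕ) : ℝ) := by
  refine Finset.sum_bij' (fun j _ => j ∘ Equiv.swap i k) (fun j _ => j ∘ Equiv.swap i k) ?_ ?_ ?_ ?_ ?_
  · intro j hj
    simp only [Finset.mem_piAntidiag, Function.comp_apply] at hj ⊢
    exact ⟨by rw [← hj.1]; exact Equiv.sum_comp (Equiv.swap i k) j, fun _ _ => Finset.mem_univ _⟩
  · intro j hj
    simp only [Finset.mem_piAntidiag, Function.comp_apply] at hj ⊢
    exact ⟨by rw [← hj.1]; exact Equiv.sum_comp (Equiv.swap i k) j, fun _ _ => Finset.mem_univ _⟩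
  · intro j hj; ext x; simp
  · intro j hj; ext x; simp
  · intro j hj; simp

lemma simplex_one (n : ℕ) (i : Fin 4) :
    4 * ∑ j ∈ Finset.piAntidiag (Finset.univ : Finset (Fin 4)) n, ((j i : ℕ) : ℝ)
      = n * (Finset.piAntidiag (Finset.univ : Finset (Fin 4)) n).card := by
  have h1 : ∑ k : Fin 4, ∑ j ∈ Finset.piAntidiag (Finset.univ : Finset (Fin 4)) n, ((j k : ℕ) : ℝ)
      = n * (Finset.piAntidiag (Finset.univ : Finset (Fin 4)) n).card := by
    rw [Finset.sum_comm, Finset.sum_congr rfl (g := fun _ => (n : ℝ))]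
    · simp [mul_comm]
    · intro j hj
      rw [Finset.mem_piAntidiag] at hj
      rw [← hj.1]; push_cast; rfl
  rw [Finset.sum_congr rfl (fun k _ => simplex_sym n k i)] at h1
  simpa using h1

lemma chern_one (n : ℕ) (b : Fin 4 → ℝ) {K e : ℝ} (hK1 : K ≤ 1)
    (hb : ∀ i, |b i| * n ≤ K) (hs : (∑ i, b i) * n ≤ 4 * e) :
    ∑ j ∈ Finset.piAntidiag (Finset.univ : Finset (Fin 4)) n, Real.exp (∑ i, b i * (j i : ℝ))
      ≤ (Finset.piAntidiag (Finset.univ : Finset (Fin 4)) n).card * Real.exp (e + K ^ 2) := by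
  set S := Finset.piAntidiag (Finset.univ : Finset (Fin 4)) n with hS
  have hK0 : 0 ≤ K := le_trans (by positivity) (hb 0)
  have hx : ∀ j ∈ S, |∑ i, b i * (j i : ℝ)| ≤ K := by
    intro j hj
    rw [hS, Finset.mem_piAntidiag] at hj
    by_cases hn : n = 0
    · have : ∀ i, j i = 0 := by
        intro i
        have h1 := hj.1
        rw [hn] at h1
        exact (Finset.sum_eq_zero_iff.mp h1) i (Finset.mem_univ i)
      simp [this, hK0]
    have hn0 : (0 : ℝ) < n := by positivity
    calc |∑ i, b i * (j i : ℝ)| ≤ ∑ i, |b i * (j i : ℝ)| := Finset.abs_sum_le_sum_abs _ _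
      _ ≤ ∑ i, K / n * (j i : ℝ) := by
          refine Finset.sum_le_sum fun i _ => ?_
          rw [abs_mul, Nat.abs_cast]
          refine mul_le_mul_of_nonneg_right ?_ (Nat.cast_nonneg _)
          rw [le_div_iff₀ hn0]; exact hb i
      _ = K / n * ((∑ i, j i : ℕ) : ℝ) := by rw [← Finset.mul_sum]; push_cast; rfl
      _ = K := by rw [hj.1]; field_simp
  have h2 : ∑ j ∈ S, ∑ i, b i * (j i : ℝ) = (∑ i, b i) * n * S.card / 4 := by
    rw [Finset.sum_comm]
    have : ∀ i, ∑ j ∈ S, b i * (j i : ℝ) = b i * (n * S.card / 4) := by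
      intro i
      rw [← Finset.mul_sum]
      have := simplex_one n i
      rw [← hS] at this
      rw [← this]; ring
    rw [Finset.sum_congr rfl (fun i _ => this i), ← Finset.sum_mul]; ring
  calc ∑ j ∈ S, Real.exp (∑ i, b i * (j i : ℝ))
      ≤ ∑ j ∈ S, (1 + K ^ 2 + ∑ i, b i * (j i : ℝ)) := by
        refine Finset.sum_le_sum fun j hj => ?_
        have h3 := exp_quad ((hx j hj).trans hK1)
        have h4 := sq_le_sq' (abs_le.mp (hx j hj)).1 (abs_le.mp (hx j hj)).2
        linarith
    _ = S.card * (1 + K ^ 2 + (∑ i, b i) * n / 4) := by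
        rw [Finset.sum_add_distrib, h2, Finset.sum_const, nsmul_eq_mul]; ring
    _ ≤ S.card * (e + K ^ 2 + 1) := by
        refine mul_le_mul_of_nonneg_left ?_ (Nat.cast_nonneg _)
        linarith
    _ ≤ S.card * Real.exp (e + K ^ 2) :=
        mul_le_mul_of_nonneg_left (Real.add_one_le_exp _) (Nat.cast_nonneg _)

/-- the set of multidegree exponents -/
def expS {m : ℕ} (ρ : Fin m → ℕ) : Finset (Fin m → Fin 4 → ℕ) :=
  Fintype.piFinset fun h => Finset.piAntidiag (Finset.univ : Finset (Fin 4)) (ρ h)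

lemma mem_expS {m : ℕ} {ρ : Fin m → ℕ} {J : Fin m → Fin 4 → ℕ} :
    J ∈ expS ρ ↔ ∀ h, ∑ i, J h i = ρ h := by
  simp [expS, Fintype.mem_piFinset, Finset.mem_piAntidiag]

lemma chernoff {m : ℕ} {γ r : ℝ} (hγ : 0 < γ) (hγ1 : γ ≤ 1) (hr : 0 < r) (ρ : Fin m → ℕ)
    (θ : Fin m → ℝ) (B : Fin m → Fin 4 → ℝ) (h1 : ∀ h, r ≤ θ h * ρ h) (h2 : ∀ h, θ h * ρ h ≤ 2 * r)
    (hB : ∀ h i, |B h i| ≤ 3 * θ h) (hBs : ∀ h, ∑ i, B h i ≤ -γ * θ h) :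
    (((expS ρ).filter fun J => -(γ * m * r / 16) < ∑ h, ∑ i, B h i * (J h i : ℝ)).card : ℝ)
      ≤ (expS ρ).card * Real.exp (-(m * γ ^ 2 / 4608)) := by
  set t : ℝ := γ / 288 with ht
  have ht0 : 0 < t := by positivity
  set lam : ℝ := t / r with hlam
  have hlam0 : 0 < lam := by positivity
  have hlr : lam * r = t := by rw [hlam]; field_simp
  have hone : ∀ h, ∑ j ∈ Finset.piAntidiag (Finset.univ : Finset (Fin 4)) (ρ h),
      Real.exp (∑ i, (lam * B h i) * (j i : ℝ))
      ≤ (Finset.piAntidiag (Finset.univ : Finset (Fin 4)) (ρ h)).card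
        * Real.exp (-(γ * t / 4) + (6 * t) ^ 2) := by
    intro h
    refine chern_one (ρ h) (fun i => lam * B h i) (by rw [ht]; linarith) (fun i => ?_) ?_
    · rw [abs_mul, abs_of_pos hlam0]
      calc lam * |B h i| * ρ h ≤ lam * (3 * θ h) * ρ h := by
            refine mul_le_mul_of_nonneg_right ?_ (Nat.cast_nonneg _)
            exact mul_le_mul_of_nonneg_left (hB h i) hlam0.le
        _ = 3 * lam * (θ h * ρ h) := by ring
        _ ≤ 3 * lam * (2 * r) := mul_le_mul_of_nonneg_left (h2 h) (by positivity)
        _ = 6 * t := by rw [← hlr]; ring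
    · rw [← Finset.mul_sum]
      calc lam * (∑ i, B h i) * ρ h ≤ lam * (-γ * θ h) * ρ h := by
            refine mul_le_mul_of_nonneg_right ?_ (Nat.cast_nonneg _)
            exact mul_le_mul_of_nonneg_left (hBs h) hlam0.le
        _ = -(lam * γ * (θ h * ρ h)) := by ring
        _ ≤ -(lam * γ * r) := neg_le_neg (mul_le_mul_of_nonneg_left (h1 h) (by positivity))
        _ = 4 * -(γ * t / 4) := by rw [← hlr]; ring
  have hprod : ∑ J ∈ expS ρ, Real.exp (lam * ∑ h, ∑ i, B h i * (J h i : ℝ))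
      = ∏ h, ∑ j ∈ Finset.piAntidiag (Finset.univ : Finset (Fin 4)) (ρ h),
        Real.exp (∑ i, (lam * B h i) * (j i : ℝ)) := by
    rw [Finset.prod_univ_sum]
    refine Finset.sum_congr rfl fun J _ => ?_
    rw [← Real.exp_sum, Finset.mul_sum]
    congr 1
    refine Finset.sum_congr rfl fun h _ => ?_
    rw [Finset.mul_sum]
    exact Finset.sum_congr rfl fun i _ => by ring
  have htot : ∑ J ∈ expS ρ, Real.exp (lam * ∑ h, ∑ i, B h i * (J h i : ℝ))
      ≤ (expS ρ).card * Real.exp (-(m * γ ^ 2 / 2304)) := by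
    rw [hprod]
    refine (Finset.prod_le_prod (fun h _ => Finset.sum_nonneg fun _ _ => (Real.exp_pos _).le)
      (fun h _ => hone h)).trans (le_of_eq ?_)
    rw [Finset.prod_mul_distrib, Finset.prod_const, Finset.card_univ, Fintype.card_fin,
      ← Real.exp_nat_mul, expS, Fintype.card_piFinset]
    push_cast
    congr 2
    rw [ht]; ring
  set bad := (expS ρ).filter fun J => -(γ * m * r / 16) < ∑ h, ∑ i, B h i * (J h i : ℝ)
  have hbad : bad.card * Real.exp (-(m * γ ^ 2 / 4608))
      ≤ ∑ J ∈ expS ρ, Real.exp (lam * ∑ h, ∑ i, B h i * (J h i : ℝ)) := by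
    calc bad.card * Real.exp (-(m * γ ^ 2 / 4608))
        = ∑ J ∈ bad, Real.exp (-(m * γ ^ 2 / 4608)) := by simp
      _ ≤ ∑ J ∈ bad, Real.exp (lam * ∑ h, ∑ i, B h i * (J h i : ℝ)) := by
          refine Finset.sum_le_sum fun J hJ => Real.exp_le_exp.mpr ?_
          have h3 := (Finset.mem_filter.mp hJ).2
          have h4 := mul_le_mul_of_nonneg_left h3.le hlam0.le
          refine le_trans (le_of_eq ?_) h4
          have : lam * -(γ * m * r / 16) = -(γ * m * (lam * r) / 16) := by ring
          rw [this, hlr, ht]; ring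
      _ ≤ _ := Finset.sum_le_sum_of_subset_of_nonneg (Finset.filter_subset _ _)
          fun _ _ _ => (Real.exp_pos _).le
  have h5 := hbad.trans htot
  have h6 : Real.exp (-(m * γ ^ 2 / 2304)) = Real.exp (-(m * γ ^ 2 / 4608))
      * Real.exp (-(m * γ ^ 2 / 4608)) := by rw [← Real.exp_add]; congr 1; ring
  rw [h6, ← mul_assoc] at h5
  exact le_of_mul_le_mul_right h5 (Real.exp_pos _)

end Chern


section AuxP

open MvPolynomial

lemma hom_aeval {σ S B : Type*} [CommRing S] [CommRing B] [Algebra ℤ S] [Algebra ℤ B] (φ : S →+* B) (f : σ → S)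
    (p : MvPolynomial σ ℤ) : φ (aeval f p) = aeval (fun x => φ (f x)) p := by
  rw [map_aeval, aeval_eq_eval₂Hom]
  congr 2
  exact RingHom.ext_int _ _

lemma int_kernel {K : Type*} [Field K] [Algebra ℚ K] [FiniteDimensional ℚ K] {S Bd : Type*}
    [Fintype S] [Fintype Bd] (N : S → Bd → K)
    (hlt : Fintype.card Bd * Module.finrank ℚ K < Fintype.card S) :
    ∃ c : S → ℤ, c ≠ 0 ∧ ∀ b, ∑ s, (c s : K) * N s b = 0 := by
  classical
  let F : (S → ℚ) →ₗ[ℚ] (Bd → K) :=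
    { toFun := fun c b => ∑ s, algebraMap ℚ K (c s) * N s b
      map_add' := by
        intro c c'; ext b; simp only [Pi.add_apply, map_add, add_mul, Finset.sum_add_distrib]
      map_smul' := by
        intro k c; ext b; simp only [Pi.smul_apply, smul_eq_mul, map_mul, Algebra.smul_def, mul_assoc, Finset.mul_sum, RingHom.id_apply] }
  have hF : LinearMap.ker F ≠ ⊥ := F.ker_ne_bot_of_finrank_lt <| by
    rw [Module.finrank_pi_fintype, Module.finrank_fintype_fun_eq_card]
    simpa using hlt
  obtain ⟨c, hc, hc0⟩ := Submodule.exists_mem_ne_zero_of_ne_bot hF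
  obtain ⟨b, hb⟩ := IsLocalization.exist_integer_multiples_of_finite (nonZeroDivisors ℤ) c
  have hb0 : ((b : ℤ) : ℚ) ≠ 0 := by
    exact_mod_cast nonZeroDivisors.ne_zero b.2
  choose z hz using hb
  have hz' : ∀ s, ((z s : ℤ) : ℚ) = (b : ℤ) * c s := by
    intro s
    have := hz s
    simpa [Algebra.smul_def] using this
  refine ⟨z, ?_, ?_⟩
  · intro h
    apply hc0
    ext s
    have := hz' s
    rw [h] at this
    simp only [Pi.zero_apply, Int.cast_zero] at this
    have := (mul_eq_zero.mp this.symm).resolve_left hb0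
    simpa using this
  · intro x
    have h1 : ∑ s, algebraMap ℚ K (c s) * N s x = 0 := congrFun hc x
    have h2 : ∀ s, (z s : K) * N s x = algebraMap ℚ K ((b : ℤ) : ℚ) * (algebraMap ℚ K (c s) * N s x) := by
      intro s
      rw [← mul_assoc, ← map_mul, ← hz' s]
      simp
    rw [Finset.sum_congr rfl (fun s _ => h2 s), ← Finset.mul_sum, h1, mul_zero]

/-- exponent vector -/
noncomputable def toF {m : ℕ} (J : Fin m → Fin 4 → ℕ) : (Fin m × Fin 4) →₀ ℕ :=
  Finsupp.equivFunOnFinite.symm fun x => J x.1 x.2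

@[simp] lemma toF_apply {m : ℕ} (J : Fin m → Fin 4 → ℕ) (x : Fin m × Fin 4) :
    toF J x = J x.1 x.2 := rfl

lemma toF_inj {m : ℕ} {J J' : Fin m → Fin 4 → ℕ} (h : toF J = toF J') : J = J' := by
  ext a b
  have := DFunLike.congr_fun h (a, b)
  simpa using this

/-- the polynomial after the linear change of variables -/
noncomputable def tld {m : ℕ} {R : Type*} [CommRing R] (a : R)
    (p : MvPolynomial (Fin m × Fin 4) ℤ) : MvPolynomial (Fin m × Fin 4) R :=
  aeval (fun x => ∑ l, C (Gi a x.2 l) * X (x.1, l)) p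

lemma Gi_map {R S : Type*} [CommRing R] [CommRing S] (f : R →+* S) (a : R) (i l : Fin 4) :
    f (Gi a i l) = Gi (f a) i l := by
  fin_cases i <;> fin_cases l <;> simp [Gi]

lemma map_tld {m : ℕ} {R S : Type*} [CommRing R] [CommRing S] (f : R →+* S) (a : R)
    (p : MvPolynomial (Fin m × Fin 4) ℤ) : map f (tld a p) = tld (f a) p := by
  unfold tld
  rw [hom_aeval]
  congr 2
  ext1 x
  simp [Gi_map]

lemma weight_single {m : ℕ} (J : (Fin m × Fin 4) →₀ ℕ) (h : Fin m) :
    (Finsupp.weight (fun x : Fin m × Fin 4 => (Pi.single x.1 1 : Fin m → ℕ)) J) h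
      = ∑ i, J (h, i) := by
  rw [Finsupp.weight_apply, Finsupp.sum_fintype _ _ (by simp), Finset.sum_apply,
    Fintype.sum_prod_type, Finset.sum_eq_single h]
  · simp
  · intro b _ hb
    refine Finset.sum_eq_zero fun i _ => ?_
    simp [Pi.single_eq_of_ne (Ne.symm hb)]
  · simp

lemma tld_homog {m : ℕ} {R : Type*} [CommRing R] (a : R) (p : MvPolynomial (Fin m × Fin 4) ℤ)
    (ρ : Fin m → ℕ) (hp : ∀ J ∈ p.support, ∀ h, ∑ i, J (h, i) = ρ h) :
    ∀ J ∈ (tld a p).support, ∀ h, ∑ i, J (h, i) = ρ h := by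
  have hw : IsWeightedHomogeneous (fun x : Fin m × Fin 4 => (Pi.single x.1 1 : Fin m → ℕ))
      (tld a p) ρ := by
    unfold tld
    rw [aeval_def, eval₂_eq']
    refine IsWeightedHomogeneous.sum _ _ _ fun J hJ => ?_
    rw [MvPolynomial.algebraMap_apply]
    refine IsWeightedHomogeneous.C_mul ?_ _
    have h1 := IsWeightedHomogeneous.prod Finset.univ
      (fun x : Fin m × Fin 4 => (∑ l, C (Gi a x.2 l) * X (x.1, l) : MvPolynomial (Fin m × Fin 4) R) ^ J x)
      (fun x => J x • (Pi.single x.1 1 : Fin m → ℕ))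
      (w := fun x : Fin m × Fin 4 => (Pi.single x.1 1 : Fin m → ℕ)) (fun x _ => by
        refine IsWeightedHomogeneous.pow ?_ _
        refine IsWeightedHomogeneous.sum _ _ _ fun l _ => ?_
        refine IsWeightedHomogeneous.C_mul ?_ _
        exact isWeightedHomogeneous_X R (fun x : Fin m × Fin 4 => (Pi.single x.1 1 : Fin m → ℕ)) (x.1, l))
    convert h1 using 1
    ext h
    rw [← hp J hJ h, ← weight_single J h, Finsupp.weight_apply, Finsupp.sum_fintype _ _ (by simp)]
  intro J hJ h
  have := hw (mem_support_iff.mp hJ)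
  rw [← weight_single J h, this]

lemma aux_poly {α : ℝ} (halg : IsAlgebraic ℚ α) {m : ℕ} (ρ : Fin m → ℕ)
    (good : (Fin m → Fin 4 → ℕ) → Prop) [DecidablePred good]
    (hlt : ((expS ρ).filter fun J => ¬ good J).card * Module.finrank ℚ (IntermediateField.adjoin ℚ {α})
      < (expS ρ).card) :
    ∃ p : MvPolynomial (Fin m × Fin 4) ℤ, p ≠ 0 ∧
      (∀ J ∈ p.support, ∀ h, ∑ i, J (h, i) = ρ h) ∧
      ∀ J ∈ (tld α p).support, good fun h i => J (h, i) := by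
  classical
  have : FiniteDimensional ℚ (IntermediateField.adjoin ℚ {α}) :=
    IntermediateField.adjoin.finiteDimensional halg.isIntegral
  set aK : IntermediateField.adjoin ℚ {α} := IntermediateField.AdjoinSimple.gen ℚ α with haK
  obtain ⟨c, hc0, hc⟩ := int_kernel (K := IntermediateField.adjoin ℚ {α})
    (S := {J // J ∈ expS ρ}) (Bd := {J // J ∈ (expS ρ).filter fun J => ¬ good J})
    (fun J J' => coeff (toF J'.1) (tld aK (monomial (toF J.1) 1))) (by
      simpa only [Fintype.card_coe] using hlt)
  set p : MvPolynomial (Fin m × Fin 4) ℤ := ∑ J : {J // J ∈ expS ρ}, monomial (toF J.1) (c J) with hp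
  have hcoef : ∀ J : {J // J ∈ expS ρ}, coeff (toF J.1) p = c J := by
    intro J
    rw [hp, coeff_sum, Finset.sum_eq_single J]
    · simp
    · intro J' _ hne
      rw [coeff_monomial, if_neg]
      intro h
      exact hne (Subtype.ext (toF_inj h))
    · simp
  have hpsupp : ∀ J ∈ p.support, ∀ h, ∑ i, J (h, i) = ρ h := by
    intro J hJ h
    rw [mem_support_iff, hp, coeff_sum] at hJ
    obtain ⟨J', _, hJ'⟩ := Finset.exists_ne_zero_of_sum_ne_zero hJ
    rw [coeff_monomial] at hJ'
    have : toF J'.1 = J := by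
      by_contra hne
      rw [if_neg hne] at hJ'
      exact hJ' rfl
    rw [← this]
    simpa using mem_expS.mp J'.2 h
  refine ⟨p, ?_, hpsupp, ?_⟩
  · intro h0
    apply hc0
    ext J
    rw [← hcoef J, h0]; simp
  · intro J hJ
    by_contra hng
    have hJ2 := tld_homog α p ρ hpsupp J hJ
    have hJF : toF (fun h i => J (h, i)) = J := by ext x; rfl
    have hmem : (fun h i => J (h, i)) ∈ (expS ρ).filter fun J => ¬ good J :=
      Finset.mem_filter.mpr ⟨mem_expS.mpr hJ2, hng⟩
    have h1 := hc ⟨_, hmem⟩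
    simp only [hJF] at h1
    have h2 : coeff J (tld aK p) = 0 := by
      rw [← h1, hp]
      unfold tld
      rw [map_sum, coeff_sum]
      refine Finset.sum_congr rfl fun J' _ => ?_
      have : (monomial (toF J'.1) (c J') : MvPolynomial (Fin m × Fin 4) ℤ)
          = c J' • monomial (toF J'.1) 1 := by
        rw [smul_monomial]; simp
      rw [this, map_zsmul, coeff_smul, zsmul_eq_mul]
    have h3 : α = algebraMap (IntermediateField.adjoin ℚ {α}) ℝ aK := by
      rw [haK]; exact (IntermediateField.AdjoinSimple.algebraMap_gen ℚ α).symm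
    rw [mem_support_iff] at hJ
    apply hJ
    rw [h3, ← map_tld, coeff_map, h2, map_zero]

end AuxP


section TayS

open MvPolynomial

/-- Taylor expansion in the direction of the first coordinate in each block -/
noncomputable def Tay {m : ℕ} {R : Type*} [CommRing R] (p : MvPolynomial (Fin m × Fin 4) ℤ)
    (v : Fin m × Fin 4 → R) : MvPolynomial (Fin m) R :=
  aeval (fun x => C (v x) + if x.2 = 0 then X x.1 else 0) p

lemma Tay_map {m : ℕ} {R S : Type*} [CommRing R] [CommRing S] (f : R →+* S)
    (p : MvPolynomial (Fin m × Fin 4) ℤ) (v : Fin m × Fin 4 → R) :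
    map f (Tay p v) = Tay p (fun x => f (v x)) := by
  unfold Tay
  rw [hom_aeval]
  congr 2
  ext1 x
  rw [map_add, map_C]
  split_ifs <;> simp

lemma Tay_shift {m : ℕ} (p : MvPolynomial (Fin m × Fin 4) ℤ) (v : Fin m × Fin 4 → ℝ)
    (y : Fin m → ℝ) :
    Tay p (fun x => v x + if x.2 = 0 then y x.1 else 0)
      = aeval (fun h => (X h + C (y h) : MvPolynomial (Fin m) ℝ)) (Tay p v) := by
  have h1 := hom_aeval (aeval (fun h => (X h + C (y h) : MvPolynomial (Fin m) ℝ))).toRingHom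
    (fun x : Fin m × Fin 4 => (C (v x) + if x.2 = 0 then X x.1 else 0 : MvPolynomial (Fin m) ℝ)) p
  unfold Tay
  refine Eq.trans ?_ h1.symm
  congr 2
  ext1 x
  by_cases hx : x.2 = 0
  · simp [hx, algebraMap_eq]; ring
  · simp [hx, algebraMap_eq]

lemma Tay_eval {m : ℕ} (p : MvPolynomial (Fin m × Fin 4) ℤ) (v : Fin m × Fin 4 → ℝ)
    (w : Fin m → ℝ) :
    eval w (Tay p v) = aeval (fun x => v x + if x.2 = 0 then w x.1 else 0) p := by
  unfold Tay
  rw [hom_aeval]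
  congr 2
  ext1 x
  by_cases hx : x.2 = 0
  · simp [hx]
  · simp [hx]

lemma Tay_degree {m : ℕ} (p : MvPolynomial (Fin m × Fin 4) ℤ) (ρ : Fin m → ℕ)
    (hp : ∀ J ∈ p.support, ∀ h, ∑ i, J (h, i) = ρ h) (v : Fin m × Fin 4 → ℝ) (h : Fin m) :
    degreeOf h (Tay p v) ≤ ρ h := by
  classical
  unfold Tay
  rw [aeval_def, eval₂_eq']
  refine (degreeOf_sum_le _ _ _).trans (Finset.sup_le fun J hJ => ?_)
  rw [MvPolynomial.algebraMap_apply]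
  refine (degreeOf_C_mul_le _ _ _).trans ?_
  refine (degreeOf_prod_le _ _ _).trans ?_
  have h1 : ∀ x : Fin m × Fin 4, degreeOf h ((C (v x) + if x.2 = 0 then X x.1 else 0 :
      MvPolynomial (Fin m) ℝ) ^ J x) ≤ if x.1 = h then J x else 0 := by
    intro x
    refine (degreeOf_pow_le _ _ _).trans ?_
    have h2 : degreeOf h (C (v x) + if x.2 = 0 then X x.1 else 0 : MvPolynomial (Fin m) ℝ)
        ≤ if x.1 = h then 1 else 0 := by
      refine (degreeOf_add_le _ _ _).trans (max_le (by rw [degreeOf_C]; exact Nat.zero_le _) ?_)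
      split_ifs with h3 h4 h4
      · rw [degreeOf_X]; split_ifs <;> simp
      · rw [degreeOf_X, if_neg (Ne.symm h4)]
      · simp
      · simp
    refine (Nat.mul_le_mul_left _ h2).trans ?_
    split_ifs <;> simp
  refine (Finset.sum_le_sum fun x _ => h1 x).trans ?_
  rw [Fintype.sum_prod_type, Finset.sum_eq_single h]
  · simp [hp J hJ h]
  · intro b _ hb; simp [hb]
  · simp

lemma Gi_Gm (a : ℝ) (i k : Fin 4) : ∑ l, Gi a i l * Gm a l k = if i = k then 1 else 0 := by
  fin_cases i <;> fin_cases k <;> simp [Gi, Gm, Fin.sum_univ_four] <;> ring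

lemma Tay_tld {m : ℕ} (p : MvPolynomial (Fin m × Fin 4) ℤ) (α : ℝ) (v : Fin m × Fin 4 → ℝ) :
    Tay p v = aeval (fun x => (C (∑ l, Gm α x.2 l * v (x.1, l)) + C (Gm α x.2 0) * X x.1 :
      MvPolynomial (Fin m) ℝ)) (tld α p) := by
  have h1 := hom_aeval (aeval (fun x : Fin m × Fin 4 =>
    (C (∑ l, Gm α x.2 l * v (x.1, l)) + C (Gm α x.2 0) * X x.1 :
      MvPolynomial (Fin m) ℝ))).toRingHom
    (fun x : Fin m × Fin 4 => (∑ l, C (Gi α x.2 l) * X (x.1, l) : MvPolynomial (Fin m × Fin 4) ℝ)) p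
  unfold Tay tld
  refine Eq.trans ?_ h1.symm
  congr 2
  ext1 x
  obtain ⟨h, i⟩ := x
  have e : ∀ k : Fin 4, (C (Gm α k 0) * X h : MvPolynomial (Fin m) ℝ) = ∑ l, C (Gm α k l) *
      (if l = 0 then X h else 0) := by
    intro k; simp
  have e2 : ∀ k : Fin 4, (C (∑ l, Gm α k l * v (h, l)) + C (Gm α k 0) * X h : MvPolynomial (Fin m) ℝ)
      = ∑ l, C (Gm α k l) * (C (v (h, l)) + if l = 0 then X h else 0) := by
    intro k
    rw [e, map_sum, ← Finset.sum_add_distrib]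
    refine Finset.sum_congr rfl fun l _ => ?_
    rw [C_mul]; ring
  have e3 : ∑ l, C (Gi α i l) * (C (∑ l', Gm α l l' * v (h, l')) + C (Gm α l 0) * X h :
      MvPolynomial (Fin m) ℝ) = C (v (h, i)) + if i = 0 then X h else 0 := by
    simp_rw [e2, Finset.mul_sum]
    rw [Finset.sum_comm]
    have e4 : ∀ k, ∑ l, C (Gi α i l) * (C (Gm α l k) * (C (v (h, k)) + if k = 0 then X h else 0 :
        MvPolynomial (Fin m) ℝ)) = if i = k then (C (v (h, k)) + if k = 0 then X h else 0) else 0 := by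
      intro k
      simp_rw [← mul_assoc, ← C_mul]
      rw [← Finset.sum_mul, ← map_sum, Gi_Gm]
      split_ifs <;> simp
    rw [Finset.sum_congr rfl fun k _ => e4 k]
    simp
  rw [AlgHom.toRingHom_eq_coe, RingHom.coe_coe, map_sum, ← e3]
  refine Finset.sum_congr rfl fun l _ => ?_
  simp [algebraMap_eq]

/-- coefficientwise domination -/
def Maj {m : ℕ} (f F : MvPolynomial (Fin m) ℝ) : Prop := ∀ I, |coeff I f| ≤ coeff I F

lemma Maj.add {m : ℕ} {f F g G : MvPolynomial (Fin m) ℝ} (h1 : Maj f F) (h2 : Maj g G) :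
    Maj (f + g) (F + G) := fun I => by
  rw [coeff_add, coeff_add]
  exact (abs_add_le _ _).trans (add_le_add (h1 I) (h2 I))

lemma Maj.mul {m : ℕ} {f F g G : MvPolynomial (Fin m) ℝ} (h1 : Maj f F) (h2 : Maj g G) :
    Maj (f * g) (F * G) := fun I => by
  classical
  rw [coeff_mul, coeff_mul]
  refine (Finset.abs_sum_le_sum_abs _ _).trans (Finset.sum_le_sum fun x _ => ?_)
  rw [abs_mul]
  exact mul_le_mul (h1 _) (h2 _) (abs_nonneg _) ((abs_nonneg _).trans (h1 _))

lemma Maj.C {m : ℕ} {a b : ℝ} (h : |a| ≤ b) : Maj (m := m) (C a) (C b) := fun I => by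
  classical
  rw [coeff_C, coeff_C]
  split_ifs <;> simp [h]

lemma Maj.X {m : ℕ} (h : Fin m) : Maj (X h) (X h) := fun I => by
  classical
  rw [coeff_X]
  split_ifs <;> simp

lemma Maj.one {m : ℕ} : Maj (m := m) 1 1 := by
  have := Maj.C (m := m) (a := 1) (b := 1) (by simp)
  simpa using this

lemma Maj.prod {m : ℕ} {ι : Type*} (s : Finset ι) {f F : ι → MvPolynomial (Fin m) ℝ}
    (h : ∀ i, Maj (f i) (F i)) : Maj (∏ i ∈ s, f i) (∏ i ∈ s, F i) := by
  classical
  induction s using Finset.induction_on with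
  | empty => simpa using Maj.one
  | insert i s hi ih =>
    rw [Finset.prod_insert hi, Finset.prod_insert hi]
    exact (h i).mul ih

lemma Maj.pow {m : ℕ} {f F : MvPolynomial (Fin m) ℝ} (h : Maj f F) (n : ℕ) :
    Maj (f ^ n) (F ^ n) := by
  induction n with
  | zero => simpa using Maj.one
  | succ n ih => rw [pow_succ, pow_succ]; exact ih.mul h

lemma Maj.sum {m : ℕ} {ι : Type*} (s : Finset ι) {f F : ι → MvPolynomial (Fin m) ℝ}
    (h : ∀ i, Maj (f i) (F i)) : Maj (∑ i ∈ s, f i) (∑ i ∈ s, F i) := fun I => by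
  rw [coeff_sum, coeff_sum]
  exact (Finset.abs_sum_le_sum_abs _ _).trans (Finset.sum_le_sum fun i _ => h i I)

lemma Maj.bound {m : ℕ} {f F : MvPolynomial (Fin m) ℝ} (h : Maj f F) (w : Fin m → ℝ)
    (hw : ∀ h, 0 ≤ w h) (I : Fin m →₀ ℕ) : |coeff I f| * ∏ h, w h ^ I h ≤ eval w F := by
  have hF : ∀ J, 0 ≤ coeff J F := fun J => (abs_nonneg _).trans (h J)
  have hn : ∀ J : Fin m →₀ ℕ, 0 ≤ ∏ h, w h ^ J h := fun J =>
    Finset.prod_nonneg fun i _ => pow_nonneg (hw i) _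
  refine (mul_le_mul_of_nonneg_right (h I) (hn I)).trans ?_
  rw [eval_eq']
  by_cases hI : I ∈ F.support
  · exact Finset.single_le_sum (f := fun J => coeff J F * ∏ h, w h ^ J h)
      (fun J _ => mul_nonneg (hF J) (hn J)) hI
  · rw [notMem_support_iff.mp hI, zero_mul]
    exact Finset.sum_nonneg fun J _ => mul_nonneg (hF J) (hn J)

lemma Gm_col {α : ℝ} (h0 : 0 < α) (h1 : α < 1) (i : Fin 4) : |Gm α i 0| ≤ 1 := by
  fin_cases i <;> simp [Gm, abs_of_pos h0, h1.le]

/-- the size estimate for the Taylor coefficients -/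
lemma val_bound {m : ℕ} {α : ℝ} (h0 : 0 < α) (h1 : α < 1) (p : MvPolynomial (Fin m × Fin 4) ℤ)
    (v : Fin m × Fin 4 → ℝ) (U : ℝ) (hU : 0 ≤ U) (a : Fin m → Fin 4 → ℝ) (T : Fin m → ℝ)
    (hv : ∀ h i, |∑ l, Gm α i l * v (h, l)| ≤ U * Real.exp (a h i))
    (ha : ∀ h i, |a h i| ≤ 3 * T h) (I : Fin m →₀ ℕ) :
    |coeff I (Tay p v)| ≤ ∑ J ∈ (tld α p).support, |coeff J (tld α p)| * (U + 1) ^ (∑ x, J x)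
      * Real.exp ((∑ h, ∑ i, a h i * (J (h, i) : ℝ)) + 3 * ∑ h, T h * (I h : ℝ)) := by
  set q := tld α p with hq
  have hM : Maj (Tay p v) (∑ J ∈ q.support, C |coeff J q| *
      ∏ x : Fin m × Fin 4, (C (U * Real.exp (a x.1 x.2)) + X x.1) ^ J x) := by
    rw [Tay_tld p α v, ← hq, aeval_def, eval₂_eq']
    refine Maj.sum _ fun J => ?_
    rw [MvPolynomial.algebraMap_apply]
    refine (Maj.C le_rfl).mul (Maj.prod _ fun x => Maj.pow ?_ _)
    refine (Maj.C (hv x.1 x.2)).add ?_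
    have := (Maj.C (m := m) (Gm_col h0 h1 x.2)).mul (Maj.X x.1)
    simpa using this
  have hb := hM.bound (fun h => Real.exp (-(3 * T h))) (fun h => (Real.exp_pos _).le) I
  have e1 : ∏ h, Real.exp (-(3 * T h)) ^ I h = Real.exp (-(3 * ∑ h, T h * (I h : ℝ))) := by
    rw [Finset.mul_sum, ← Finset.sum_neg_distrib, Real.exp_sum]
    refine Finset.prod_congr rfl fun h _ => ?_
    rw [← Real.exp_nat_mul]; congr 1; ring
  rw [e1, Real.exp_neg, ← div_eq_mul_inv, div_le_iff₀ (Real.exp_pos _)] at hb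
  refine hb.trans ?_
  rw [map_sum, Finset.sum_mul]
  refine Finset.sum_le_sum fun J _ => ?_
  rw [Real.exp_add, ← mul_assoc]
  refine mul_le_mul_of_nonneg_right ?_ (Real.exp_pos _).le
  rw [map_mul, eval_C, map_prod, mul_assoc]
  refine mul_le_mul_of_nonneg_left ?_ (abs_nonneg _)
  have e2 : (U + 1) ^ (∑ x, J x) * Real.exp (∑ h, ∑ i, a h i * (J (h, i) : ℝ))
      = ∏ x : Fin m × Fin 4, ((U + 1) * Real.exp (a x.1 x.2)) ^ J x := by
    simp_rw [mul_pow]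
    rw [Finset.prod_mul_distrib, Finset.prod_pow_eq_pow_sum, ← Fintype.sum_prod_type'
      (f := fun h i => a h i * (J (h, i) : ℝ)), Real.exp_sum]
    congr 1
    refine Finset.prod_congr rfl fun x _ => ?_
    rw [← Real.exp_nat_mul]; congr 1; ring
  rw [e2]
  refine Finset.prod_le_prod (fun x _ => ?_) fun x _ => ?_
  · simp only [map_pow, map_add, eval_C, eval_X]; positivity
  · simp only [map_pow, map_add, eval_C, eval_X]
    refine pow_le_pow_left₀ (by positivity) ?_ _
    have : Real.exp (-(3 * T x.1)) ≤ Real.exp (a x.1 x.2) :=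
      Real.exp_le_exp.mpr (abs_le.mp (ha x.1 x.2)).1
    linarith

end TayS


section GridS

open MvPolynomial

lemma totalDegree_subst {σ τ : Type*} [Fintype σ] [Fintype τ] (P : MvPolynomial σ ℝ) (ℓ : σ → τ → ℝ) :
    (aeval (fun x => ∑ y, C (ℓ x y) * X y : σ → MvPolynomial τ ℝ) P).totalDegree ≤ P.totalDegree := by
  classical
  rw [aeval_def, eval₂_eq']
  refine totalDegree_finsetSum_le fun J hJ => ?_
  rw [algebraMap_eq]
  refine (totalDegree_mul _ _).trans ?_
  rw [totalDegree_C, zero_add]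
  refine (totalDegree_finsetProd _ _).trans ?_
  refine le_trans (Finset.sum_le_sum (g := fun x => J x) fun x _ => ?_) ?_
  · refine (totalDegree_pow _ _).trans ?_
    have : (∑ y, C (ℓ x y) * X y : MvPolynomial τ ℝ).totalDegree ≤ 1 := by
      refine totalDegree_finsetSum_le fun y _ => ?_
      refine (totalDegree_mul _ _).trans ?_
      rw [totalDegree_C, totalDegree_X]
    calc J x * _ ≤ J x * 1 := Nat.mul_le_mul_left _ this
      _ = J x := mul_one _
  · have := le_totalDegree hJ
    rwa [Finsupp.sum_fintype _ _ (by simp)] at this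

lemma grid_vanish {σ τ : Type*} [Fintype σ] [Fintype τ] (P : MvPolynomial σ ℝ) (N : ℕ)
    (hN : P.totalDegree ≤ N) (ℓ : σ → τ → ℝ)
    (hz : ∀ u : τ → ℕ, (∀ y, u y ≤ N) → eval (fun x => ∑ y, (u y : ℝ) * ℓ x y) P = 0) (u : τ → ℝ) :
    eval (fun x => ∑ y, u y * ℓ x y) P = 0 := by
  classical
  set Q := aeval (fun x => ∑ y, C (ℓ x y) * X y : σ → MvPolynomial τ ℝ) P with hQ
  have hev : ∀ u : τ → ℝ, eval u Q = eval (fun x => ∑ y, u y * ℓ x y) P := by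
    intro u
    rw [hQ, map_aeval, coe_eval₂Hom]
    have : (eval u).comp (algebraMap ℝ (MvPolynomial τ ℝ)) = RingHom.id ℝ := by
      ext x; simp [algebraMap_eq]
    rw [this, eval₂_id]
    congr 2
    ext1 x
    rw [map_sum]
    exact Finset.sum_congr rfl fun y _ => by simp [mul_comm]
  have hQ0 : Q = 0 := by
    refine eq_zero_of_eval_zero_at_prod_finset Q
      (fun _ => (Finset.range (N + 1)).image (fun n : ℕ => (n : ℝ))) (fun i => ?_) fun x hx => ?_
    · rw [Finset.card_image_of_injective _ Nat.cast_injective, Finset.card_range]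
      have h1 := degreeOf_le_totalDegree Q i
      have h2 := totalDegree_subst P ℓ
      rw [← hQ] at h2
      omega
    · have : ∀ y, ∃ n : ℕ, n ≤ N ∧ (n : ℝ) = x y := by
        intro y
        obtain ⟨n, hn, he⟩ := Finset.mem_image.mp (hx y)
        exact ⟨n, by have := Finset.mem_range.mp hn; omega, he⟩
      choose k hk hkx using this
      have h3 := hz k hk
      rw [hev]
      simpa only [hkx] using h3
  rw [← hev, hQ0, map_zero]

/-- Taylor coefficient as a polynomial -/
noncomputable def tcoef {m : ℕ} (p : MvPolynomial (Fin m × Fin 4) ℤ) (I : Fin m →₀ ℕ) :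
    MvPolynomial (Fin m × Fin 4) ℝ :=
  coeff I (Tay p (fun x => (X x : MvPolynomial (Fin m × Fin 4) ℝ)))

lemma tcoef_eval {m : ℕ} (p : MvPolynomial (Fin m × Fin 4) ℤ) (I : Fin m →₀ ℕ)
    (v : Fin m × Fin 4 → ℝ) : eval v (tcoef p I) = coeff I (Tay p v) := by
  unfold tcoef
  rw [← coeff_map, Tay_map]
  simp

lemma tay_vanish {m : ℕ} {α : ℝ} (h0 : 0 < α) (h1 : α < 1) (p : MvPolynomial (Fin m × Fin 4) ℤ)
    (I : Fin m →₀ ℕ) (N : ℕ) (hN : (tcoef p I).totalDegree ≤ N)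
    (Φ : Fin m → Fin 3 → Fin 4 → ℤ) (a : Fin m → Fin 4 → ℝ) (T : Fin m → ℝ)
    (hbd : ∀ h j i, |∑ l, Gm α i l * (Φ h j l : ℝ)| ≤ Real.exp (a h i))
    (ha : ∀ h i, |a h i| ≤ 3 * T h)
    (hsmall : ∑ J ∈ (tld α p).support, |coeff J (tld α p)| * (3 * (N : ℝ) + 1) ^ (∑ x, J x)
      * Real.exp ((∑ h, ∑ i, a h i * (J (h, i) : ℝ)) + 3 * ∑ h, T h * (I h : ℝ)) < 1)
    (u : Fin m → Fin 3 → ℝ) :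
    coeff I (Tay p (fun x => ∑ j, u x.1 j * (Φ x.1 j x.2 : ℝ))) = 0 := by
  classical
  have hconv : ∀ u : Fin m × Fin 3 → ℝ, (fun x : Fin m × Fin 4 => ∑ y : Fin m × Fin 3,
      u y * (if y.1 = x.1 then (Φ x.1 y.2 x.2 : ℝ) else 0))
      = fun x => ∑ j, u (x.1, j) * (Φ x.1 j x.2 : ℝ) := by
    intro u
    ext x
    rw [Fintype.sum_prod_type, Finset.sum_eq_single x.1]
    · simp
    · intro b _ hb; simp [hb]
    · simp
  have key := grid_vanish (tcoef p I) N hN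
    (fun x (y : Fin m × Fin 3) => if y.1 = x.1 then (Φ x.1 y.2 x.2 : ℝ) else 0) (fun k hk => by
      rw [hconv (fun y => (k y : ℝ)), tcoef_eval]
      have hb := val_bound h0 h1 p (fun x => ∑ j, (k (x.1, j) : ℝ) * (Φ x.1 j x.2 : ℝ)) (3 * (N : ℝ))
        (by positivity) a T (fun h i => by
          have e : ∑ l, Gm α i l * ∑ j, (k (h, j) : ℝ) * (Φ h j l : ℝ)
              = ∑ j, (k (h, j) : ℝ) * ∑ l, Gm α i l * (Φ h j l : ℝ) := by
            simp_rw [Finset.mul_sum]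
            rw [Finset.sum_comm]
            exact Finset.sum_congr rfl fun j _ => Finset.sum_congr rfl fun l _ => by ring
          simp only
          rw [e]
          refine (Finset.abs_sum_le_sum_abs _ _).trans ?_
          refine (Finset.sum_le_sum (g := fun _ => (N : ℝ) * Real.exp (a h i)) fun j _ => ?_).trans ?_
          · rw [abs_mul, Nat.abs_cast]
            exact mul_le_mul (by exact_mod_cast hk (h, j)) (hbd h j i) (abs_nonneg _) (Nat.cast_nonneg _)
          · simp; linarith) ha I
      have hlt := hb.trans_lt hsmall
      have hIntg : coeff I (Tay p (fun x => ∑ j, (k (x.1, j) : ℝ) * (Φ x.1 j x.2 : ℝ)))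
          = ((coeff I (Tay p (fun x => ∑ j, (k (x.1, j) : ℤ) * Φ x.1 j x.2)) : ℤ) : ℝ) := by
        have := Tay_map (Int.castRingHom ℝ) p (fun x => ∑ j, (k (x.1, j) : ℤ) * Φ x.1 j x.2)
        rw [← eq_intCast (Int.castRingHom ℝ), ← coeff_map, this]
        simp
      rw [hIntg] at hlt ⊢
      have : |coeff I (Tay p (fun x => ∑ j, (k (x.1, j) : ℤ) * Φ x.1 j x.2))| < 1 := by
        exact_mod_cast hlt
      rw [Int.abs_lt_one_iff.mp this, Int.cast_zero]) (fun y => u y.1 y.2)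
  rw [hconv, tcoef_eval] at key
  exact key

end GridS


section CoreS

open MvPolynomial

lemma small_eventually {ι : Type*} (l : Ultrafilter ι) {m : ℕ} (S : Finset ((Fin m × Fin 4) →₀ ℕ))
    (k : ((Fin m × Fin 4) →₀ ℕ) → ℝ) (a : ι → Fin m → Fin 4 → ℝ) (T : ι → Fin m → ℝ) (T0 : ι → ℝ)
    (B : Fin m → Fin 4 → ℝ) (θ : Fin m → ℝ) (hT0 : Tendsto T0 l atTop)
    (hB : ∀ h i, Tendsto (fun s => a s h i / T0 s) l (𝓝 (B h i)))
    (hθ : ∀ h, Tendsto (fun s => T s h / T0 s) l (𝓝 (θ h))) (I : Fin m →₀ ℕ)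
    (hneg : ∀ J ∈ S, (∑ h, ∑ i, B h i * (J (h, i) : ℝ)) + 3 * ∑ h, θ h * (I h : ℝ) < 0) :
    ∀ᶠ s in l, ∑ J ∈ S, k J * Real.exp ((∑ h, ∑ i, a s h i * (J (h, i) : ℝ))
      + 3 * ∑ h, T s h * (I h : ℝ)) < 1 := by
  have h1 : Tendsto (fun s => ∑ J ∈ S, k J * Real.exp ((∑ h, ∑ i, a s h i * (J (h, i) : ℝ))
      + 3 * ∑ h, T s h * (I h : ℝ))) l (𝓝 (∑ J ∈ S, k J * 0)) := by
    refine tendsto_finsetSum _ fun J hJ => Tendsto.const_mul _ (Real.tendsto_exp_atBot.comp ?_)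
    have h2 : Tendsto (fun s => (∑ h, ∑ i, a s h i / T0 s * (J (h, i) : ℝ))
        + 3 * ∑ h, T s h / T0 s * (I h : ℝ)) l
        (𝓝 ((∑ h, ∑ i, B h i * (J (h, i) : ℝ)) + 3 * ∑ h, θ h * (I h : ℝ))) := by
      refine Tendsto.add ?_ (Tendsto.const_mul _ ?_)
      · exact tendsto_finsetSum _ fun h _ => tendsto_finsetSum _ fun i _ => (hB h i).mul_const _
      · exact tendsto_finsetSum _ fun h _ => (hθ h).mul_const _
    refine (hT0.atTop_mul_neg (hneg J hJ) h2).congr' ?_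
    filter_upwards [hT0.eventually_gt_atTop 0] with s hs
    rw [mul_add, Finset.mul_sum]
    congr 1
    · refine Finset.sum_congr rfl fun h _ => ?_
      rw [Finset.mul_sum]
      refine Finset.sum_congr rfl fun i _ => ?_
      field_simp
    · rw [mul_left_comm, Finset.mul_sum]
      congr 1
      refine Finset.sum_congr rfl fun h _ => ?_
      field_simp
  have h3 : (∑ J ∈ S, k J * 0) < 1 := by simp
  exact h1.eventually_lt_const h3

lemma choose_t {ι : Type*} (l : Ultrafilter ι) {m : ℕ} {α : ℝ} (p : MvPolynomial (Fin m × Fin 4) ℤ)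
    (hp0 : p ≠ 0) (μ : ι → Fin m → Fin 4 → ℝ) (μ' : Fin m → Fin 4 → ℝ)
    (hμ1 : ∀ s h, μ s h 1 ≠ α) (hμ' : ∀ h, μ' h 1 = α) :
    ∃ b : Fin m × Fin 4 → ℝ, aeval b p ≠ 0 ∧
      ∀ h, ∀ᶠ s in l, ∑ i, μ s h i * b (h, i) ≠ ∑ i, μ' h i * b (h, i) := by
  classical
  obtain ⟨x, hx⟩ : ∃ x : Fin m × Fin 4 → ℝ, aeval x p ≠ 0 := by
    by_contra hcon
    push Not at hcon
    apply hp0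
    have : map (Int.castRingHom ℝ) p = 0 := by
      apply MvPolynomial.funext
      intro x
      rw [map_zero, ← hcon x, eval_map, aeval_def]
      congr 1
    exact map_injective _ Int.cast_injective (by rw [this, map_zero])
  let b : ℝ → Fin m × Fin 4 → ℝ := fun t y => x y + if y.2 = 1 then t else 0
  let g : Polynomial ℝ := aeval (fun y : Fin m × Fin 4 =>
    (Polynomial.C (x y) + if y.2 = 1 then Polynomial.X else 0 : Polynomial ℝ)) p
  have hg : ∀ t, g.eval t = aeval (b t) p := by
    intro t
    have := hom_aeval (Polynomial.evalRingHom t) (fun y : Fin m × Fin 4 =>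
      (Polynomial.C (x y) + if y.2 = 1 then Polynomial.X else 0 : Polynomial ℝ)) p
    rw [Polynomial.coe_evalRingHom] at this
    simp only [g]
    rw [this]
    congr 2
    ext1 y
    simp only [b]
    split_ifs <;> simp
  have hg0 : g ≠ 0 := by
    intro h
    apply hx
    have := hg 0
    rw [h, Polynomial.eval_zero] at this
    rw [this]
    congr 2
    ext1 y
    simp [b]
  have hfin1 : {t | aeval (b t) p = 0}.Finite := by
    refine (g.rootSet_finite ℝ).subset fun t ht => ?_
    rw [Polynomial.mem_rootSet]
    refine ⟨hg0, ?_⟩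
    rw [Polynomial.coe_aeval_eq_eval, hg]; exact ht
  have hfin2 : ∀ h, {t | ∀ᶠ s in l, ∑ i, μ s h i * b t (h, i) = ∑ i, μ' h i * b t (h, i)}.Finite := by
    intro h
    apply Set.Subsingleton.finite
    intro t ht t' ht'
    by_contra hne
    obtain ⟨s, hs, hs'⟩ := (ht.and ht').exists
    simp only [b, Fin.sum_univ_four] at hs hs'
    simp at hs hs'
    have h1 : (μ s h 1 - α) * (t - t') = 0 := by
      have h2 := hμ' h
      rw [h2] at hs hs'
      linear_combination hs - hs'
    rcases mul_eq_zero.mp h1 with h2 | h2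
    · exact hμ1 s h (sub_eq_zero.mp h2)
    · exact hne (sub_eq_zero.mp h2)
  obtain ⟨t, ht⟩ := (hfin1.union (Set.finite_iUnion hfin2)).infinite_compl.nonempty
  simp only [Set.mem_compl_iff, Set.mem_union, Set.mem_iUnion, not_or, not_exists,
    Set.mem_ofPred_eq] at ht
  exact ⟨b t, ht.1, fun h => Ultrafilter.eventually_not.mpr (ht.2 h)⟩

lemma machine_core {ι : Type*} (l : Ultrafilter ι) {m : ℕ} {α γ : ℝ} (h0 : 0 < α) (h1 : α < 1)
    (p : MvPolynomial (Fin m × Fin 4) ℤ) (hp0 : p ≠ 0) (ρ : Fin m → ℕ)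
    (hp : ∀ J ∈ p.support, ∀ h, ∑ i, J (h, i) = ρ h)
    (T : ι → Fin m → ℝ) (μ : ι → Fin m → Fin 4 → ℝ) (Φ : ι → Fin m → Fin 3 → Fin 4 → ℤ)
    (a : ι → Fin m → Fin 4 → ℝ) (hblk : ∀ s h, Blk α γ (T s h) (μ s h) (Φ s h) (a s h))
    (T0 : ι → ℝ) (B : Fin m → Fin 4 → ℝ) (θ : Fin m → ℝ) (hT0 : Tendsto T0 l atTop)
    (hT : ∀ h, Tendsto (fun s => T s h) l atTop)
    (hB : ∀ h i, Tendsto (fun s => a s h i / T0 s) l (𝓝 (B h i)))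
    (hθ : ∀ h, Tendsto (fun s => T s h / T0 s) l (𝓝 (θ h)))
    (hneg : ∀ J ∈ (tld α p).support, ∀ I : Fin m →₀ ℕ,
      (∀ h, I h ≤ ∑ i ∈ Finset.univ.filter (h < ·), ρ i) →
      (∑ h, ∑ i, B h i * (J (h, i) : ℝ)) + 3 * ∑ h, θ h * (I h : ℝ) < 0) : False := by
  classical
  have hfinI : {I : Fin m →₀ ℕ | ∀ h, I h ≤ ∑ i ∈ Finset.univ.filter (h < ·), ρ i}.Finite :=
    (Set.finite_Iic (Finsupp.equivFunOnFinite.symm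
      fun h => ∑ i ∈ Finset.univ.filter (h < ·), ρ i)).subset fun I hI h => hI h
  have hvan : ∀ᶠ s in l, ∀ I ∈ {I : Fin m →₀ ℕ | ∀ h, I h ≤ ∑ i ∈ Finset.univ.filter (h < ·), ρ i},
      ∀ u : Fin m → Fin 3 → ℝ,
        coeff I (Tay p (fun x => ∑ j, u x.1 j * (Φ s x.1 j x.2 : ℝ))) = 0 := by
    rw [eventually_all_finite hfinI]
    intro I hI
    filter_upwards [small_eventually l (tld α p).support
      (fun J => |coeff J (tld α p)| * (3 * ((tcoef p I).totalDegree : ℝ) + 1) ^ (∑ x, J x))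
      a T T0 B θ hT0 hB hθ I (fun J hJ => hneg J hJ I hI)] with s hs
    exact tay_vanish h0 h1 p I _ le_rfl (Φ s) (a s) (T s) (fun h => (hblk s h).bd)
      (fun h => (hblk s h).ab) hs
  have hμlim : ∀ h i, ∃ c, Tendsto (fun s => μ s h i) l (𝓝 c) := fun h i => by
    obtain ⟨c, hc, _⟩ := ultra_lim l (fun s => μ s h i) 1
      (Eventually.of_forall fun s => (hblk s h).mub i)
    exact ⟨c, hc⟩
  choose μ' hμ' using hμlim
  have hμα : ∀ h, μ' h 1 = α := by
    intro h
    refine tendsto_nhds_unique (hμ' h 1) ?_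
    rw [tendsto_iff_norm_sub_tendsto_zero]
    refine squeeze_zero (fun _ => norm_nonneg _) (fun s => (hblk s h).mu1') ?_
    exact Real.tendsto_exp_atBot.comp (tendsto_neg_atTop_atBot.comp (hT h))
  obtain ⟨b, hb0, hb⟩ := choose_t l p hp0 μ μ' (fun s h => (hblk s h).mu1) hμα
  set ξ : Fin m → ℝ := fun h => -∑ i, μ' h i * b (h, i) with hξ
  set y : ι → Fin m → ℝ := fun s h => -(∑ i, μ s h i * b (h, i)) - ξ h with hy
  set v : Fin m × Fin 4 → ℝ := fun x => b x + if x.2 = 0 then ξ x.1 else 0 with hv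
  refine nonvanish l (Tay p v) ?_ ρ (Tay_degree p ρ hp v) y ?_ ?_ ?_
  · intro hz
    apply hb0
    have h2 := Tay_eval p v (fun h => -ξ h)
    rw [hz, map_zero] at h2
    rw [h2]
    congr 2
    ext1 x
    simp only [hv]
    split_ifs <;> ring
  · intro h
    filter_upwards [hb h] with s hs h2
    apply hs
    simp only [hy, hξ] at h2
    linarith
  · intro h
    have h2 : Tendsto (fun s => ∑ i, μ s h i * b (h, i)) l (𝓝 (∑ i, μ' h i * b (h, i))) :=
      tendsto_finsetSum _ fun i _ => (hμ' h i).mul_const _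
    have h3 := (h2.neg).sub_const (ξ h)
    rw [show -(∑ i, μ' h i * b (h, i)) - ξ h = 0 by simp only [hξ]; ring] at h3
    exact h3
  · filter_upwards [hvan] with s hs I hI
    rw [← Tay_shift]
    have hker : ∀ h, ∑ i, μ s h i * (v (h, i) + if i = 0 then y s h else 0) = 0 := by
      intro h
      have := (hblk s h).mu0
      simp only [hv, hy, Fin.sum_univ_four]
      simp [this]
      ring
    have hsp : ∀ h, ∃ c : Fin 3 → ℝ, ∀ i, (v (h, i) + if i = 0 then y s h else 0)
        = ∑ j, c j * (Φ s h j i : ℝ) := fun h => (hblk s h).span _ (hker h)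
    choose u hu using hsp
    have h2 := hs I hI u
    refine Eq.trans ?_ h2
    congr 2
    ext1 x
    exact hu x.1 x.2

end CoreS


section MachS

open MvPolynomial

lemma expS_pos {m : ℕ} (ρ : Fin m → ℕ) : 0 < (expS ρ).card := by
  classical
  refine Finset.card_pos.mpr ⟨fun h i => if i = 0 then ρ h else 0, mem_expS.mpr fun h => ?_⟩
  simp

lemma machine {α γ Λ : ℝ} {N0 : ℕ} (h0 : 0 < α) (h1 : α < 1) (halg : IsAlgebraic ℚ α)
    (hγ : 0 < γ) (hγ1 : γ ≤ 1) (hΛ : 1 ≤ Λ) (hN0 : 1 ≤ N0)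
    (hb : ∀ n : ℕ, N0 ≤ n → ∃ T μ Φ a, (n : ℝ) ≤ T ∧ T ≤ Λ * n ∧ Blk α γ T μ Φ a) : False := by
  classical
  set d := Module.finrank ℚ (IntermediateField.adjoin ℚ {α}) with hd
  -- number of blocks
  obtain ⟨m, hm1, hm⟩ : ∃ m : ℕ, 1 ≤ m ∧ (d : ℝ) * Real.exp (-(m * γ ^ 2 / 4608)) < 1 := by
    have ht : Tendsto (fun m : ℕ => (d : ℝ) * Real.exp (-((m : ℝ) * (γ ^ 2 / 4608)))) atTop
        (𝓝 (d * 0)) := by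
      refine Tendsto.const_mul _ (Real.tendsto_exp_atBot.comp (tendsto_neg_atTop_atBot.comp ?_))
      exact tendsto_natCast_atTop_atTop.atTop_mul_const (by positivity)
    rw [mul_zero] at ht
    obtain ⟨m, hm, hm'⟩ := ((ht.eventually_lt_const one_pos).and (eventually_ge_atTop 1)).exists
    refine ⟨m, hm', ?_⟩
    rw [mul_div_assoc]; exact hm
  have hmR : (1 : ℝ) ≤ m := by exact_mod_cast hm1
  obtain ⟨Δ, hΔ⟩ := exists_nat_ge (192 * m * Λ / γ)
  have hΔ' : 192 * m * Λ ≤ Δ * γ := by rwa [div_le_iff₀ hγ] at hΔ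
  have hΔ0 : (0 : ℝ) < Δ := by
    refine lt_of_lt_of_le ?_ hΔ
    positivity
  have hΔ1 : 1 ≤ Δ := by
    have : 0 < Δ := by exact_mod_cast hΔ0
    omega
  have hΔ1' : (1 : ℝ) ≤ Δ := by exact_mod_cast hΔ1
  have hblocks : ∀ (s : ℕ) (h : Fin m), ∃ T μ Φ a, ((Δ ^ (h : ℕ) * (s + N0) : ℕ) : ℝ) ≤ T ∧
      T ≤ Λ * ((Δ ^ (h : ℕ) * (s + N0) : ℕ) : ℝ) ∧ Blk α γ T μ Φ a := by
    intro s h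
    refine hb _ ?_
    have : 1 ≤ Δ ^ (h : ℕ) := Nat.one_le_pow _ _ hΔ1
    nlinarith
  choose T μ Φ a hT1 hT2 hblk using hblocks
  set l : Ultrafilter ℕ := hyperfilter ℕ with hl
  have hlT : (l : Filter ℕ) ≤ atTop := by
    rw [← Nat.cofinite_eq_atTop]; exact hyperfilter_le_cofinite
  set T0 : ℕ → ℝ := fun s => (s : ℝ) + N0 with hT0d
  have hT0p : ∀ s, 0 < T0 s := by
    intro s
    have : (1 : ℝ) ≤ N0 := by exact_mod_cast hN0
    simp only [hT0d]; positivity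
  have hT0 : Tendsto T0 l atTop :=
    (tendsto_atTop_add_const_right _ _ tendsto_natCast_atTop_atTop).mono_left hlT
  have hT1' : ∀ s (h : Fin m), (Δ : ℝ) ^ (h : ℕ) * T0 s ≤ T s h := by
    intro s h
    have := hT1 s h
    push_cast at this
    exact this
  have hT2' : ∀ s h, T s h ≤ Λ * (Δ : ℝ) ^ (h : ℕ) * T0 s := by
    intro s h
    have := hT2 s h
    push_cast at this
    rw [mul_assoc]
    exact this
  have hTt : ∀ h, Tendsto (fun s => T s h) l atTop := by
    intro h
    refine tendsto_atTop_mono (fun s => ?_) hT0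
    refine le_trans ?_ (hT1' s h)
    exact le_mul_of_one_le_left (hT0p s).le (one_le_pow₀ hΔ1')
  have hr1 : ∀ s (h : Fin m), (Δ : ℝ) ^ (h : ℕ) ≤ T s h / T0 s := fun s h => by
    rw [le_div_iff₀ (hT0p s)]; exact hT1' s h
  have hr2 : ∀ s h, T s h / T0 s ≤ Λ * (Δ : ℝ) ^ (h : ℕ) := fun s h => by
    rw [div_le_iff₀ (hT0p s)]; exact hT2' s h
  have hr3 : ∀ s h i, |a s h i / T0 s| ≤ 3 * (T s h / T0 s) := fun s h i => by
    rw [abs_div, abs_of_pos (hT0p s), ← mul_div_assoc]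
    exact div_le_div_of_nonneg_right ((hblk s h).ab i) (hT0p s).le
  have hθ : ∀ h, ∃ c, Tendsto (fun s => T s h / T0 s) l (𝓝 c) := fun h => by
    obtain ⟨c, hc, _⟩ := ultra_lim l (fun s => T s h / T0 s) (Λ * (Δ : ℝ) ^ (h : ℕ))
      (Eventually.of_forall fun s => by
        rw [abs_of_nonneg (le_trans (by positivity) (hr1 s h))]; exact hr2 s h)
    exact ⟨c, hc⟩
  choose θ hθ using hθ
  have hBe : ∀ h i, ∃ c, Tendsto (fun s => a s h i / T0 s) l (𝓝 c) := fun h i => by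
    obtain ⟨c, hc, _⟩ := ultra_lim l (fun s => a s h i / T0 s) (3 * (Λ * (Δ : ℝ) ^ (h : ℕ)))
      (Eventually.of_forall fun s => (hr3 s h i).trans
        (mul_le_mul_of_nonneg_left (hr2 s h) (by norm_num)))
    exact ⟨c, hc⟩
  choose B hB using hBe
  have hθ1 : ∀ h : Fin m, (Δ : ℝ) ^ (h : ℕ) ≤ θ h := fun h =>
    ge_of_tendsto (hθ h) (Eventually.of_forall fun s => hr1 s h)
  have hθ2 : ∀ h, θ h ≤ Λ * (Δ : ℝ) ^ (h : ℕ) := fun h =>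
    le_of_tendsto (hθ h) (Eventually.of_forall fun s => hr2 s h)
  have hθ0 : ∀ h, 0 < θ h := fun h => lt_of_lt_of_le (by positivity) (hθ1 h)
  have hB3 : ∀ h i, |B h i| ≤ 3 * θ h := fun h i =>
    le_of_tendsto_of_tendsto (hB h i).abs ((hθ h).const_mul 3)
      (Eventually.of_forall fun s => hr3 s h i)
  have hBs : ∀ h, ∑ i, B h i ≤ -γ * θ h := fun h =>
    le_of_tendsto_of_tendsto (tendsto_finsetSum _ fun i _ => hB h i) ((hθ h).const_mul (-γ))
      (Eventually.of_forall fun s => by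
        show ∑ i, a s h i / T0 s ≤ -γ * (T s h / T0 s)
        rw [← Finset.sum_div, ← mul_div_assoc]
        exact div_le_div_of_nonneg_right (hblk s h).asum (hT0p s).le)
  have hθlt : ∀ h i : Fin m, h < i → θ h ≤ γ / (192 * m) * θ i := by
    intro h i hi
    have e1 : (Δ : ℝ) ^ (h : ℕ) * Δ ≤ (Δ : ℝ) ^ (i : ℕ) := by
      rw [← pow_succ]
      exact pow_le_pow_right₀ hΔ1' hi
    have e2 : Λ ≤ γ / (192 * m) * Δ := by
      rw [div_mul_eq_mul_div, le_div_iff₀ (by positivity)]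
      linarith
    calc θ h ≤ Λ * (Δ : ℝ) ^ (h : ℕ) := hθ2 h
      _ ≤ γ / (192 * m) * Δ * (Δ : ℝ) ^ (h : ℕ) := mul_le_mul_of_nonneg_right e2 (by positivity)
      _ = γ / (192 * m) * ((Δ : ℝ) ^ (h : ℕ) * Δ) := by ring
      _ ≤ γ / (192 * m) * θ i :=
          mul_le_mul_of_nonneg_left (e1.trans (hθ1 i)) (by positivity)
  set r : ℝ := Λ * (Δ : ℝ) ^ m with hr
  have hr0 : 0 < r := by positivity
  have hrθ : ∀ h, θ h ≤ r := fun h => (hθ2 h).trans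
    (mul_le_mul_of_nonneg_left (pow_le_pow_right₀ hΔ1' h.2.le) (by positivity))
  set ρ : Fin m → ℕ := fun h => ⌈r / θ h⌉₊ with hρ
  have hρ1 : ∀ h, r ≤ θ h * ρ h := fun h => by
    have := Nat.le_ceil (r / θ h)
    rw [div_le_iff₀ (hθ0 h)] at this
    rw [mul_comm]; exact this
  have hρ2 : ∀ h, θ h * ρ h ≤ 2 * r := fun h => by
    have h2 := (Nat.ceil_lt_add_one (div_nonneg hr0.le (hθ0 h).le)).le
    have h3 := mul_le_mul_of_nonneg_left h2 (hθ0 h).le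
    have h4 : θ h * (r / θ h + 1) = r + θ h := by
      have := (hθ0 h).ne'
      field_simp
    rw [h4] at h3
    have := hrθ h
    calc θ h * ρ h ≤ r + θ h := h3
      _ ≤ 2 * r := by linarith
  have hch := chernoff hγ hγ1 hr0 ρ θ B hρ1 hρ2 hB3 hBs
  obtain ⟨p, hp0, hp, hpg⟩ := aux_poly halg ρ
    (fun J => ∑ h, ∑ i, B h i * (J h i : ℝ) ≤ -(γ * m * r / 16)) (by
      simp only [not_le]
      have hS : (0 : ℝ) < (expS ρ).card := by exact_mod_cast expS_pos ρ
      have h2 := mul_le_mul_of_nonneg_right hch (Nat.cast_nonneg (α := ℝ) d)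
      have h3 : ((expS ρ).card : ℝ) * Real.exp (-(m * γ ^ 2 / 4608)) * d < (expS ρ).card := by
        calc ((expS ρ).card : ℝ) * Real.exp (-(m * γ ^ 2 / 4608)) * d
            = (expS ρ).card * (d * Real.exp (-(m * γ ^ 2 / 4608))) := by ring
          _ < (expS ρ).card * 1 := mul_lt_mul_of_pos_left hm hS
          _ = (expS ρ).card := mul_one _
      have h4 := h2.trans_lt h3
      exact_mod_cast h4)
  refine machine_core l h0 h1 p hp0 ρ hp T μ Φ a hblk T0 B θ hT0 hTt hB hθ ?_
  intro J hJ I hI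
  have hg := hpg J hJ
  have hcost : ∑ h, θ h * (I h : ℝ) ≤ ∑ h : Fin m, ∑ i : Fin m, γ / (192 * m) * (2 * r) := by
    refine Finset.sum_le_sum fun h _ => ?_
    calc θ h * (I h : ℝ) ≤ θ h * ((∑ i ∈ Finset.univ.filter (h < ·), ρ i : ℕ) : ℝ) :=
          mul_le_mul_of_nonneg_left (by exact_mod_cast hI h) (hθ0 h).le
      _ = ∑ i ∈ Finset.univ.filter (h < ·), θ h * ρ i := by push_cast; rw [Finset.mul_sum]
      _ ≤ ∑ i ∈ Finset.univ.filter (h < ·), γ / (192 * m) * (2 * r) := by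
          refine Finset.sum_le_sum fun i hi => ?_
          calc θ h * ρ i ≤ γ / (192 * m) * θ i * ρ i :=
                mul_le_mul_of_nonneg_right (hθlt h i (Finset.mem_filter.mp hi).2) (Nat.cast_nonneg _)
            _ = γ / (192 * m) * (θ i * ρ i) := by ring
            _ ≤ γ / (192 * m) * (2 * r) := mul_le_mul_of_nonneg_left (hρ2 i) (by positivity)
      _ ≤ ∑ i : Fin m, γ / (192 * m) * (2 * r) :=
          Finset.sum_le_sum_of_subset_of_nonneg (Finset.filter_subset _ _)
            fun _ _ _ => by positivity
  have e3 : ∑ h : Fin m, ∑ i : Fin m, γ / (192 * m) * (2 * r) = γ * m * r / 96 := by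
    simp only [Finset.sum_const, Finset.card_univ, Fintype.card_fin, nsmul_eq_mul]
    field_simp
    ring
  rw [e3] at hcost
  have hpos : 0 < γ * m * r := by positivity
  simp only at hg
  linarith

end MachS


lemma qv_ne_zero {α c0 : ℝ} (hc0 : 0 < c0)
    (hbad : ∀ y z : ℤ, y ≠ 0 → c0 ≤ |(y : ℝ)| * |z - α * y|) (halg : IsAlgebraic ℚ α)
    (hdeg : (minpoly ℚ α).natDegree ≠ 2) (A B C : ℤ) (hP : ¬ (A = 0 ∧ B = 0 ∧ C = 0)) :
    (A : ℝ) * α ^ 2 + B * α + C ≠ 0 := by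
  intro hz
  set f : Polynomial ℚ := Polynomial.C (A : ℚ) * Polynomial.X ^ 2 + Polynomial.C (B : ℚ) * Polynomial.X
    + Polynomial.C (C : ℚ) with hf
  have hf0 : f ≠ 0 := by
    intro h
    apply hP
    have h2 : f.coeff 2 = A := by
      rw [hf]; simp only [Polynomial.coeff_add, Polynomial.coeff_C_mul, Polynomial.coeff_X_pow,
        Polynomial.coeff_X, Polynomial.coeff_C]; norm_num
    have h1 : f.coeff 1 = B := by
      rw [hf]; simp only [Polynomial.coeff_add, Polynomial.coeff_C_mul, Polynomial.coeff_X_pow,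
        Polynomial.coeff_X, Polynomial.coeff_C]; norm_num
    have h3 : f.coeff 0 = C := by
      rw [hf]; simp only [Polynomial.coeff_add, Polynomial.coeff_C_mul, Polynomial.coeff_X_pow,
        Polynomial.coeff_X, Polynomial.coeff_C]; norm_num
    rw [h, Polynomial.coeff_zero] at h1 h2 h3
    exact ⟨by exact_mod_cast h2.symm, by exact_mod_cast h1.symm, by exact_mod_cast h3.symm⟩
  have hfα : Polynomial.aeval α f = 0 := by
    rw [hf]; simpa using hz
  have h1 : (minpoly ℚ α).natDegree ≤ f.natDegree :=
    Polynomial.natDegree_le_natDegree (minpoly.degree_le_of_ne_zero ℚ α hf0 hfα)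
  have h2 : f.natDegree ≤ 2 := by rw [hf]; exact Polynomial.natDegree_quadratic_le
  have h3 := minpoly.natDegree_pos halg.isIntegral
  have h4 : (minpoly ℚ α).natDegree = 1 := by omega
  obtain ⟨q, hq⟩ := minpoly.natDegree_eq_one_iff.mp h4
  have h5 := hbad q.den q.num (by exact_mod_cast q.den_nz)
  have h6 : ((q.num : ℤ) : ℝ) - α * ((q.den : ℤ) : ℝ) = 0 := by
    have hd : (q.den : ℝ) ≠ 0 := by exact_mod_cast q.den_nz
    have : α = (q.num : ℝ) / q.den := by
      rw [← hq, eq_ratCast]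
      exact Rat.cast_def q
    rw [this]; push_cast; field_simp; ring
  rw [h6, abs_zero, mul_zero] at h5
  linarith


/-- Theorem 5: let `X` be a linearly recurrent subshift on the alphabet of
positive integers: `X` is shift-invariant and there is a constant `c > 0` such
that, in every element of `X`, the gap between two consecutive occurrences of
any (nonempty) factor `W` is at most `c·|W|`.  Then every element of `C_X` is
either a quadratic irrational or a transcendental number. -/
theorem statement7 (X : Set (ℕ → ℕ))
    (hposX : ∀ x ∈ X, ∀ n, 0 < x n)
    (hshift : ∀ x ∈ X, (fun n => x (n + 1)) ∈ X)
    (c : ℝ) (hc : 0 < c)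
    (hlr : ∀ x ∈ X, ∀ W : List ℕ, W ≠ [] → ∀ i, Occurs x W i →
      ∃ j, i < j ∧ (j : ℝ) ≤ (i : ℝ) + c * (W.length : ℝ) ∧ Occurs x W j)
    (α : ℝ) (hα01 : α ∈ Set.Ioo (0 : ℝ) 1) (x : ℕ → ℕ) (hx : x ∈ X)
    (hα : Tendsto (fun ℓ => (cfP x ℓ : ℝ) / (cfQ x ℓ : ℝ)) atTop (𝓝 α)) :
    (IsAlgebraic ℚ α ∧ (minpoly ℚ α).natDegree = 2) ∨ Transcendental ℚ α := by
  by_cases halg : IsAlgebraic ℚ α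
  swap
  · exact Or.inr halg
  by_cases hdeg : (minpoly ℚ α).natDegree = 2
  · exact Or.inl ⟨halg, hdeg⟩
  exfalso
  obtain ⟨A, hA⟩ := comb_bounded (hlr x hx)
  obtain ⟨M, hM⟩ := comb_return (hlr x hx)
  obtain ⟨c0, hc0, hbad⟩ := cf_badly (hposX x hx) hA hα
  obtain ⟨c1, hc1, d, hd⟩ := liouville2 halg
  have hG := Gmain (d := max d 1) (le_max_right _ _) hα01.1 hα01.2 hc0 hbad hc1 (by
    intro P hP H hH hin
    have hH' : (1 : ℝ) ≤ H := by exact_mod_cast hH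
    have hne : (P.1 : ℝ) * α ^ 2 + P.2.1 * α + P.2.2 ≠ 0 :=
      qv_ne_zero hc0 hbad halg hdeg P.1 P.2.1 P.2.2 (by
        rintro ⟨h1, h2, h3⟩
        exact hP (Prod.ext h1 (Prod.ext h2 h3)))
    have h1 := hd P.1 P.2.1 P.2.2 hne H hH' (by exact_mod_cast hin.1) (by exact_mod_cast hin.2.1)
      (by exact_mod_cast hin.2.2)
    refine h1.trans ?_
    unfold qv
    exact mul_le_mul_of_nonneg_left (pow_le_pow_right₀ hH' (le_max_left _ _)) (abs_nonneg _))
  obtain ⟨γ, Λ, N0, hγ, hγ1, hΛ, hN0, hb⟩ := block (hposX x hx) hA hM hα01.1 hα01.2 hα hG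
  exact machine hα01.1 hα01.2 halg hγ hγ1 hΛ hN0 hb
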